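/- Assume the sparsity condition (H_n is bounded as n → ∞ and max_{i∈[n]} Σ_{j=1}^n p_{i,j}(log p_{i,j})² = o(log n)) and the non-degeneracy condition (lim_{ε→0⁺} limsup_{n→∞} (1/n)·#{(i,j) : p_{i,j} > 1−ε} = 0). Then: (a) with probability tending to 1 as n → ∞, the random stochastic matrix P_σ has a unique stationary distribution π (a probability vector with π P_σ = π); and (b) for every fixed λ > 0, every δ ∈ (0,1), and every sequence of times t_n ∈ ℕ with t_n/t_ENT → λ: if λ < 1 then ℙ(P_σ has a unique stationary distribution π and min_{i∈[n]} ‖P_σ^{t_n}(i,·) − π‖_TV > 1−δ) → 1, while if λ > 1 then ℙ(P_σ has a unique stationary distribution π and max_{i∈[n]} ‖P_σ^{t_n}(i,·) − π‖_TV < δ) → 1. -/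

import Mathlib

open Filter
open scoped BigOperators Classical

/-- The random environment: `n` permutations of `[n]`. -/
abbrev Env (n : ℕ) := Fin n → Equiv.Perm (Fin n)

/-- The random stochastic matrix `P_σ(i,j) = p_{i, σ_i⁻¹(j)}`. -/
noncomputable def Pmat (n : ℕ) (p : Fin n → Fin n → ℝ) (σ : Env n) (i j : Fin n) : ℝ :=
  p i ((σ i).symm j)

/-- Probability of an event under the uniform measure on environments
(product of uniform measures on permutations). -/
noncomputable def Pr (n : ℕ) (E : Env n → Prop) : ℝ :=
  (∑ σ : Env n, if E σ then (1 : ℝ) else 0) / (Fintype.card (Env n) : ℝ)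

/-- The average row entropy `H_n`. -/
noncomputable def avgEntropy (n : ℕ) (p : Fin n → Fin n → ℝ) : ℝ :=
  -(1 / (n : ℝ)) * ∑ i : Fin n, ∑ j : Fin n, p i j * Real.log (p i j)

/-- `t`-th matrix power of a transition kernel. -/
noncomputable def matPow (n : ℕ) (P : Fin n → Fin n → ℝ) (t : ℕ) : Fin n → Fin n → ℝ :=
  fun i j => ((Matrix.of P) ^ t) i j

/-- Total variation distance between two vectors on `[n]`. -/
noncomputable def tv (n : ℕ) (μ ν : Fin n → ℝ) : ℝ :=
  (1 / 2) * ∑ j : Fin n, |μ j - ν j|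

/-- `π` is a stationary distribution of `P`. -/
def StatDist (n : ℕ) (P : Fin n → Fin n → ℝ) (π : Fin n → ℝ) : Prop :=
  (∀ j, 0 ≤ π j) ∧ (∑ j : Fin n, π j = 1) ∧ (∀ j, ∑ i : Fin n, π i * P i j = π j)

namespace Cutoff

variable {n : ℕ}

/-! ### Expectation over the environment -/

/-- Expectation under the uniform measure on environments. -/
noncomputable def Ex (f : Env n → ℝ) : ℝ := (∑ σ, f σ) / (Fintype.card (Env n) : ℝ)

lemma card_env_pos : (0 : ℝ) < (Fintype.card (Env n) : ℝ) := by
  exact_mod_cast Fintype.card_pos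

lemma Pr_eq_Ex (E : Env n → Prop) : Pr n E = Ex (fun σ => if E σ then (1 : ℝ) else 0) := rfl

lemma Ex_mono {f g : Env n → ℝ} (h : ∀ σ, f σ ≤ g σ) : Ex f ≤ Ex g :=
  div_le_div_of_nonneg_right (Finset.sum_le_sum fun σ _ => h σ) card_env_pos.le

lemma Ex_const (c : ℝ) : Ex (fun _ : Env n => c) = c := by
  have := (card_env_pos (n := n)).ne'
  simp only [Ex, Finset.sum_const, Finset.card_univ, nsmul_eq_mul]
  field_simp

lemma Ex_add (f g : Env n → ℝ) : Ex (fun σ => f σ + g σ) = Ex f + Ex g := by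
  simp only [Ex, Finset.sum_add_distrib, add_div]

lemma Ex_mul_left (c : ℝ) (f : Env n → ℝ) : Ex (fun σ => c * f σ) = c * Ex f := by
  simp only [Ex, ← Finset.mul_sum, mul_div_assoc]

lemma Ex_sum {ι : Type*} (s : Finset ι) (f : ι → Env n → ℝ) :
    Ex (fun σ => ∑ i ∈ s, f i σ) = ∑ i ∈ s, Ex (f i) := by
  simp only [Ex]
  rw [Finset.sum_comm, Finset.sum_div]

lemma Ex_sq_le (f : Env n → ℝ) : (Ex f) ^ 2 ≤ Ex (fun σ => f σ ^ 2) := by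
  have hc := card_env_pos (n := n)
  have := sq_sum_le_card_mul_sum_sq (s := (Finset.univ : Finset (Env n))) (f := f)
  rw [Ex, Ex, div_pow, div_le_div_iff₀ (by positivity) hc]
  rw [Finset.card_univ] at this
  nlinarith

lemma Ex_abs_le_sqrt (f : Env n → ℝ) : Ex (fun σ => |f σ|) ≤ Real.sqrt (Ex (fun σ => f σ ^ 2)) := by
  apply Real.le_sqrt_of_sq_le
  simpa using Ex_sq_le (fun σ => |f σ|)

lemma Pr_mono {E F : Env n → Prop} (h : ∀ σ, E σ → F σ) : Pr n E ≤ Pr n F :=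
  Ex_mono fun σ => by
    by_cases hE : E σ
    · simp [hE, h σ hE]
    · simp only [hE, if_false]; split_ifs <;> norm_num

lemma Pr_le_one (E : Env n → Prop) : Pr n E ≤ 1 := by
  rw [← Ex_const (n := n) 1]
  exact Ex_mono fun σ => by split_ifs <;> norm_num

lemma Pr_not (E : Env n → Prop) : Pr n (fun σ => ¬ E σ) = 1 - Pr n E := by
  have : Pr n (fun σ => ¬ E σ) + Pr n E = 1 := by
    rw [Pr_eq_Ex, Pr_eq_Ex, ← Ex_add, ← Ex_const (n := n) 1]
    congr 1; funext σ
    by_cases h : E σ <;> simp [h, Ex_const]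
  linarith

lemma Pr_or_le (E F : Env n → Prop) : Pr n (fun σ => E σ ∨ F σ) ≤ Pr n E + Pr n F := by
  rw [Pr_eq_Ex, Pr_eq_Ex, Pr_eq_Ex, ← Ex_add]
  refine Ex_mono fun σ => ?_
  by_cases h : E σ <;> by_cases h' : F σ <;> simp [h, h']

lemma Pr_exists_le {ι : Type*} [Fintype ι] (E : ι → Env n → Prop) :
    Pr n (fun σ => ∃ i, E i σ) ≤ ∑ i, Pr n (E i) := by
  simp only [Pr_eq_Ex]
  rw [← Ex_sum]
  refine Ex_mono fun σ => ?_
  by_cases h : ∃ i, E i σ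
  · obtain ⟨i, hi⟩ := h
    rw [if_pos ⟨i, hi⟩]
    have := Finset.single_le_sum (f := fun i => if E i σ then (1 : ℝ) else 0)
      (fun i _ => by positivity) (Finset.mem_univ i)
    simpa [hi] using this
  · rw [if_neg h]
    exact Finset.sum_nonneg fun i _ => by positivity

/-- Markov's inequality. -/
lemma Pr_le_Ex_div {f : Env n → ℝ} (hf : ∀ σ, 0 ≤ f σ) {a : ℝ} (ha : 0 < a) {E : Env n → Prop}
    (h : ∀ σ, E σ → a ≤ f σ) : Pr n E ≤ Ex f / a := by
  rw [le_div_iff₀ ha, mul_comm, Pr_eq_Ex, ← Ex_mul_left]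
  refine Ex_mono fun σ => ?_
  by_cases hE : E σ
  · simpa [hE] using h σ hE
  · simpa [hE] using hf σ

/-! ### Words and walks -/

/-- Words of length `T` over the alphabet `[n]`. -/
noncomputable def words (n : ℕ) : ℕ → Finset (List (Fin n))
  | 0 => {[]}
  | T + 1 => (Finset.univ ×ˢ words n T).image fun q => q.1 :: q.2

lemma mem_words {T : ℕ} {κ : List (Fin n)} : κ ∈ words n T ↔ κ.length = T := by
  induction T generalizing κ with
  | zero => simp [words]
  | succ T ih =>
    cases κ with
    | nil => simp [words]
    | cons k κ => simp [words, ih]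

lemma sum_words_zero {M : Type*} [AddCommMonoid M] (f : List (Fin n) → M) :
    ∑ κ ∈ words n 0, f κ = f [] := by simp [words]

lemma sum_words_succ {M : Type*} [AddCommMonoid M] (T : ℕ) (f : List (Fin n) → M) :
    ∑ κ ∈ words n (T + 1), f κ = ∑ k, ∑ κ ∈ words n T, f (k :: κ) := by
  rw [words, Finset.sum_image, Finset.sum_product]
  rintro ⟨a, b⟩ _ ⟨c, d⟩ _ h
  simpa using h

lemma sum_words_add {M : Type*} [AddCommMonoid M] (a b : ℕ) (f : List (Fin n) → M) :
    ∑ κ ∈ words n (a + b), f κ = ∑ κ ∈ words n a, ∑ κ' ∈ words n b, f (κ ++ κ') := by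
  induction a generalizing f with
  | zero => simp [sum_words_zero]
  | succ a ih =>
    rw [Nat.succ_add, sum_words_succ, sum_words_succ]
    refine Finset.sum_congr rfl fun k _ => ?_
    rw [ih]; rfl

/-- Endpoint of the walk from `x` reading the row entries `κ`. -/
def run (σ : Env n) : Fin n → List (Fin n) → Fin n
  | x, [] => x
  | x, k :: κ => run σ (σ x k) κ

/-- Weight of the walk from `x` reading the row entries `κ`. -/
def wt (p : Fin n → Fin n → ℝ) (σ : Env n) : Fin n → List (Fin n) → ℝ
  | _, [] => 1
  | x, k :: κ => p x k * wt p σ (σ x k) κ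

/-- Vertices from which the steps of the walk are taken. -/
def tails (σ : Env n) : Fin n → List (Fin n) → List (Fin n)
  | _, [] => []
  | x, k :: κ => x :: tails σ (σ x k) κ

@[simp] lemma run_nil (σ : Env n) (x : Fin n) : run σ x [] = x := rfl
@[simp] lemma run_cons (σ : Env n) (x k : Fin n) (κ : List (Fin n)) :
    run σ x (k :: κ) = run σ (σ x k) κ := rfl
@[simp] lemma wt_nil (p : Fin n → Fin n → ℝ) (σ : Env n) (x : Fin n) : wt p σ x [] = 1 := rfl
@[simp] lemma wt_cons (p : Fin n → Fin n → ℝ) (σ : Env n) (x k : Fin n) (κ : List (Fin n)) :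
    wt p σ x (k :: κ) = p x k * wt p σ (σ x k) κ := rfl
@[simp] lemma tails_nil (σ : Env n) (x : Fin n) : tails σ x [] = [] := rfl
@[simp] lemma tails_cons (σ : Env n) (x k : Fin n) (κ : List (Fin n)) :
    tails σ x (k :: κ) = x :: tails σ (σ x k) κ := rfl

lemma run_append (σ : Env n) (x : Fin n) (κ κ' : List (Fin n)) :
    run σ x (κ ++ κ') = run σ (run σ x κ) κ' := by
  induction κ generalizing x with
  | nil => rfl
  | cons k κ ih => simp [ih]

lemma wt_append (p : Fin n → Fin n → ℝ) (σ : Env n) (x : Fin n) (κ κ' : List (Fin n)) :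
    wt p σ x (κ ++ κ') = wt p σ x κ * wt p σ (run σ x κ) κ' := by
  induction κ generalizing x with
  | nil => simp
  | cons k κ ih => simp [ih, mul_assoc]

lemma tails_append (σ : Env n) (x : Fin n) (κ κ' : List (Fin n)) :
    tails σ x (κ ++ κ') = tails σ x κ ++ tails σ (run σ x κ) κ' := by
  induction κ generalizing x with
  | nil => simp
  | cons k κ ih => simp [ih]

lemma length_tails (σ : Env n) (x : Fin n) (κ : List (Fin n)) :
    (tails σ x κ).length = κ.length := by
  induction κ generalizing x with
  | nil => simp
  | cons k κ ih => simp [ih]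

/-- A vertex is a tail iff it is the endpoint of a proper prefix. -/
lemma mem_tails_iff (σ : Env n) (x y : Fin n) (κ : List (Fin n)) :
    y ∈ tails σ x κ ↔ ∃ κ₁ k κ₂, κ = κ₁ ++ k :: κ₂ ∧ run σ x κ₁ = y := by
  induction κ generalizing x with
  | nil => simp
  | cons k κ ih =>
    simp only [tails_cons, List.mem_cons, ih]
    constructor
    · rintro (rfl | ⟨κ₁, k', κ₂, rfl, h⟩)
      · exact ⟨[], k, κ, rfl, rfl⟩
      · exact ⟨k :: κ₁, k', κ₂, rfl, h⟩
    · rintro ⟨κ₁, k', κ₂, h, h'⟩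
      cases κ₁ with
      | nil => left; simpa using h'.symm
      | cons a κ₁ =>
        simp only [List.cons_append, List.cons.injEq] at h
        obtain ⟨rfl, rfl⟩ := h
        exact Or.inr ⟨κ₁, k', κ₂, rfl, h'⟩

lemma walk_congr {p p' : Fin n → Fin n → ℝ} {σ σ' : Env n} {x : Fin n} {κ : List (Fin n)}
    (h : ∀ y ∈ tails σ x κ, σ y = σ' y) (hp : ∀ y ∈ tails σ x κ, ∀ k, p y k = p' y k) :
    run σ' x κ = run σ x κ ∧ wt p' σ' x κ = wt p σ x κ ∧ tails σ' x κ = tails σ x κ := by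
  induction κ generalizing x with
  | nil => simp
  | cons k κ ih =>
    simp only [tails_cons, List.mem_cons, forall_eq_or_imp] at h hp
    obtain ⟨h1, h2, h3⟩ := ih h.2 hp.2
    simp [← h.1, hp.1, h1, h2, h3]

lemma wt_nonneg {p : Fin n → Fin n → ℝ} (hp : ∀ i j, 0 ≤ p i j) (σ : Env n) (x : Fin n)
    (κ : List (Fin n)) : 0 ≤ wt p σ x κ := by
  induction κ generalizing x with
  | nil => simp
  | cons k κ ih => exact mul_nonneg (hp _ _) (ih _)

lemma wt_mono {p p' : Fin n → Fin n → ℝ} (hp : ∀ i j, 0 ≤ p i j) (h : ∀ i j, p i j ≤ p' i j)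
    (σ : Env n) (x : Fin n) (κ : List (Fin n)) : wt p σ x κ ≤ wt p' σ x κ := by
  induction κ generalizing x with
  | nil => simp
  | cons k κ ih =>
    exact mul_le_mul (h _ _) (ih _) (wt_nonneg hp _ _ _) ((hp _ _).trans (h _ _))

lemma wt_le_one {p : Fin n → Fin n → ℝ} (hp : ∀ i j, 0 ≤ p i j) (h1 : ∀ i j, p i j ≤ 1)
    (σ : Env n) (x : Fin n) (κ : List (Fin n)) : wt p σ x κ ≤ 1 := by
  induction κ generalizing x with
  | nil => simp
  | cons k κ ih => exact mul_le_one₀ (h1 _ _) (wt_nonneg hp _ _ _) (ih _)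

lemma sum_wt_le_one {p : Fin n → Fin n → ℝ} (hp : ∀ i j, 0 ≤ p i j) (h1 : ∀ i, ∑ j, p i j ≤ 1)
    (σ : Env n) (x : Fin n) (T : ℕ) : ∑ κ ∈ words n T, wt p σ x κ ≤ 1 := by
  induction T generalizing x with
  | zero => simp [sum_words_zero]
  | succ T ih =>
    rw [sum_words_succ]
    simp only [wt_cons, ← Finset.mul_sum]
    refine (Finset.sum_le_sum fun k _ => mul_le_of_le_one_right (hp x k) (ih _)).trans (h1 x)

lemma sum_wt_eq_one {p : Fin n → Fin n → ℝ} (h1 : ∀ i, ∑ j, p i j = 1)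
    (σ : Env n) (x : Fin n) (T : ℕ) : ∑ κ ∈ words n T, wt p σ x κ = 1 := by
  induction T generalizing x with
  | zero => simp [sum_words_zero]
  | succ T ih =>
    rw [sum_words_succ]
    simp [← Finset.mul_sum, ih, h1]

/-- `T`-step transition kernel. -/
noncomputable def kern (p : Fin n → Fin n → ℝ) (σ : Env n) (T : ℕ) (x j : Fin n) : ℝ :=
  ∑ κ ∈ words n T, if run σ x κ = j then wt p σ x κ else 0

lemma kern_zero (p : Fin n → Fin n → ℝ) (σ : Env n) (x j : Fin n) :
    kern p σ 0 x j = if x = j then 1 else 0 := by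
  simp [kern, sum_words_zero]
  rfl

lemma kern_add (p : Fin n → Fin n → ℝ) (σ : Env n) (a b : ℕ) (x j : Fin n) :
    kern p σ (a + b) x j = ∑ κ ∈ words n a, wt p σ x κ * kern p σ b (run σ x κ) j := by
  simp only [kern, sum_words_add, run_append, wt_append, Finset.mul_sum, mul_ite, mul_zero]

lemma sum_wt_mul_run (p : Fin n → Fin n → ℝ) (σ : Env n) (T : ℕ) (x : Fin n) (f : Fin n → ℝ) :
    ∑ κ ∈ words n T, wt p σ x κ * f (run σ x κ) = ∑ j, kern p σ T x j * f j := by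
  simp only [kern, Finset.sum_mul]
  rw [Finset.sum_comm]
  refine Finset.sum_congr rfl fun κ _ => ?_
  simp [ite_mul]

lemma kern_add' (p : Fin n → Fin n → ℝ) (σ : Env n) (a b : ℕ) (x j : Fin n) :
    kern p σ (a + b) x j = ∑ y, kern p σ a x y * kern p σ b y j := by
  rw [kern_add, sum_wt_mul_run p σ a x (fun y => kern p σ b y j)]

lemma kern_succ (p : Fin n → Fin n → ℝ) (σ : Env n) (T : ℕ) (x j : Fin n) :
    kern p σ (T + 1) x j = ∑ k, p x k * kern p σ T (σ x k) j := by
  simp only [kern, sum_words_succ, run_cons, wt_cons, Finset.mul_sum, mul_ite, mul_zero]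
  rfl

lemma kern_nonneg {p : Fin n → Fin n → ℝ} (hp : ∀ i j, 0 ≤ p i j) (σ : Env n) (T : ℕ)
    (x j : Fin n) : 0 ≤ kern p σ T x j :=
  Finset.sum_nonneg fun κ _ => by split_ifs; exacts [wt_nonneg hp _ _ _, le_rfl]

lemma sum_kern (p : Fin n → Fin n → ℝ) (σ : Env n) (T : ℕ) (x : Fin n) :
    ∑ j, kern p σ T x j = ∑ κ ∈ words n T, wt p σ x κ := by
  have := sum_wt_mul_run p σ T x (fun _ => 1)
  simpa using this.symm

lemma kern_mono {p p' : Fin n → Fin n → ℝ} (hp : ∀ i j, 0 ≤ p i j) (h : ∀ i j, p i j ≤ p' i j)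
    (σ : Env n) (T : ℕ) (x j : Fin n) : kern p σ T x j ≤ kern p' σ T x j :=
  Finset.sum_le_sum fun κ _ => by split_ifs; exacts [wt_mono hp h _ _ _, le_rfl]

lemma matPow_eq_kern (p : Fin n → Fin n → ℝ) (σ : Env n) (T : ℕ) (i j : Fin n) :
    matPow n (Pmat n p σ) T i j = kern p σ T i j := by
  unfold matPow
  induction T generalizing i with
  | zero => simp [kern_zero, Matrix.one_apply]
  | succ T ih =>
    rw [pow_succ', Matrix.mul_apply, kern_succ]
    rw [← Equiv.sum_comp (σ i)]
    refine Finset.sum_congr rfl fun k _ => ?_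
    simp [Pmat, ih]

/-- The kernel obtained from `p` by killing the walk on `W`. -/
noncomputable def kill (W : Finset (Fin n)) (p : Fin n → Fin n → ℝ) (x k : Fin n) : ℝ :=
  if x ∈ W then 0 else p x k

lemma kill_nonneg {p : Fin n → Fin n → ℝ} (hp : ∀ i j, 0 ≤ p i j) (W : Finset (Fin n))
    (i j : Fin n) : 0 ≤ kill W p i j := by
  unfold kill; split_ifs; exacts [le_rfl, hp _ _]

lemma kill_le {p : Fin n → Fin n → ℝ} (hp : ∀ i j, 0 ≤ p i j) (W : Finset (Fin n))
    (i j : Fin n) : kill W p i j ≤ p i j := by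
  unfold kill; split_ifs; exacts [hp _ _, le_rfl]

lemma wt_kill (W : Finset (Fin n)) (p : Fin n → Fin n → ℝ) (σ : Env n) (x : Fin n)
    (κ : List (Fin n)) :
    wt (kill W p) σ x κ = if ∀ y ∈ tails σ x κ, y ∉ W then wt p σ x κ else 0 := by
  induction κ generalizing x with
  | nil => simp
  | cons k κ ih =>
    by_cases hx : x ∈ W
    · simp [kill, hx]
    · simp [kill, hx, ih]

lemma walk_kill_congr {W : Finset (Fin n)} {σ σ' : Env n} (h : ∀ y, y ∉ W → σ y = σ' y)
    (p : Fin n → Fin n → ℝ) (x : Fin n) (κ : List (Fin n)) :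
    wt (kill W p) σ' x κ = wt (kill W p) σ x κ ∧
      (wt (kill W p) σ x κ ≠ 0 → run σ' x κ = run σ x κ) := by
  induction κ generalizing x with
  | nil => simp
  | cons k κ ih =>
    by_cases hx : x ∈ W
    · simp [kill, hx]
    · have := ih (σ x k)
      rw [wt_cons, wt_cons, ← h x hx, this.1]
      refine ⟨rfl, fun h0 => ?_⟩
      rw [run_cons, run_cons, ← h x hx]
      exact this.2 (right_ne_zero_of_mul h0)

lemma kern_kill_congr {W : Finset (Fin n)} {σ σ' : Env n} (h : ∀ y, y ∉ W → σ y = σ' y)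
    (p : Fin n → Fin n → ℝ) (T : ℕ) (x j : Fin n) :
    kern (kill W p) σ' T x j = kern (kill W p) σ T x j := by
  refine Finset.sum_congr rfl fun κ _ => ?_
  obtain ⟨h1, h2⟩ := walk_kill_congr h p x κ
  rw [h1]
  by_cases h0 : wt (kill W p) σ x κ = 0
  · simp [h0]
  · rw [h2 h0]

/-- The mass lost by killing on `W` is at most the expected time spent in `W`. -/
lemma kill_loss {p : Fin n → Fin n → ℝ} (hp : ∀ i j, 0 ≤ p i j) (h1 : ∀ i, ∑ j, p i j = 1)
    (W : Finset (Fin n)) (σ : Env n) (T : ℕ) (x : Fin n) :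
    1 - ∑ κ ∈ words n T, wt (kill W p) σ x κ ≤
      ∑ s ∈ Finset.range T, ∑ w ∈ W, kern p σ s x w := by
  induction T generalizing x with
  | zero => simp [sum_words_zero]
  | succ T ih =>
    rw [Finset.sum_range_succ']
    simp only [kern_zero, kern_succ, sum_words_succ, wt_cons, ← Finset.mul_sum]
    by_cases hx : x ∈ W
    · have hz : ∀ k, kill W p x k = 0 := fun k => by simp [kill, hx]
      have h0 : (0 : ℝ) ≤ ∑ s ∈ Finset.range T, ∑ w ∈ W, ∑ k, p x k * kern p σ s (σ x k) w :=
        Finset.sum_nonneg fun s _ => Finset.sum_nonneg fun w _ => Finset.sum_nonneg fun k _ =>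
          mul_nonneg (hp _ _) (kern_nonneg hp _ _ _ _)
      simp [hz, hx, h0]
    · have hz : ∀ k, kill W p x k = p x k := fun k => by simp [kill, hx]
      have e0 : ∑ w ∈ W, (if x = w then (1 : ℝ) else 0) = 0 := by simp [hx]
      rw [e0, add_zero]
      simp only [hz]
      calc 1 - ∑ k, p x k * ∑ κ ∈ words n T, wt (kill W p) σ (σ x k) κ
          = ∑ k, p x k * (1 - ∑ κ ∈ words n T, wt (kill W p) σ (σ x k) κ) := by
            simp [mul_sub, h1]
        _ ≤ ∑ k, p x k * ∑ s ∈ Finset.range T, ∑ w ∈ W, kern p σ s (σ x k) w :=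
            Finset.sum_le_sum fun k _ => mul_le_mul_of_nonneg_left (ih _) (hp _ _)
        _ = _ := by
            simp only [Finset.mul_sum]
            rw [Finset.sum_comm]
            refine Finset.sum_congr rfl fun s _ => ?_
            rw [Finset.sum_comm]

/-! ### Sequential revealing of the environment -/

/-- A history: revealed triples `(x, k, v)` meaning `σ x k = v`. -/
abbrev Hist (n : ℕ) := List (Fin n × Fin n × Fin n)

/-- Append the triples read by a walk to a history. -/
def trip (σ : Env n) : Fin n → List (Fin n) → Hist n → Hist n
  | _, [], h => h
  | x, k :: κ, h => trip σ (σ x k) κ ((x, k, σ x k) :: h)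

@[simp] lemma trip_nil (σ : Env n) (x : Fin n) (h : Hist n) : trip σ x [] h = h := rfl
@[simp] lemma trip_cons (σ : Env n) (x k : Fin n) (κ : List (Fin n)) (h : Hist n) :
    trip σ x (k :: κ) h = trip σ (σ x k) κ ((x, k, σ x k) :: h) := rfl

/-- Environments compatible with a history. -/
noncomputable def Agree (h : Hist n) : Finset (Env n) :=
  Finset.univ.filter fun σ => ∀ e ∈ h, σ e.1 e.2.1 = e.2.2

lemma mem_Agree {h : Hist n} {σ : Env n} : σ ∈ Agree h ↔ ∀ e ∈ h, σ e.1 e.2.1 = e.2.2 := by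
  simp [Agree]

lemma mem_Agree_cons {h : Hist n} {σ : Env n} {x k v : Fin n} :
    σ ∈ Agree ((x, k, v) :: h) ↔ σ x k = v ∧ σ ∈ Agree h := by
  simp [mem_Agree]

lemma Agree_nil : Agree ([] : Hist n) = Finset.univ := by simp [Agree]

/-- Entry `k` of row `x` has not been revealed. -/
def Fresh (x k : Fin n) (h : Hist n) : Prop := ∀ v, (x, k, v) ∉ h

lemma card_Agree_cons_le {x k : Fin n} {h : Hist n} (hf : Fresh x k h) (v v' : Fin n)
    (hv' : ∀ k', (x, k', v') ∉ h) :
    (Agree ((x, k, v) :: h)).card ≤ (Agree ((x, k, v') :: h)).card := by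
  refine Finset.card_le_card_of_injOn
    (fun σ => Function.update σ x ((σ x).trans (Equiv.swap v v'))) ?_ ?_
  · intro σ hσ
    rw [Finset.mem_coe, mem_Agree_cons] at hσ ⊢
    refine ⟨by simp [hσ.1], ?_⟩
    rw [mem_Agree]
    rintro ⟨y, k', w⟩ he
    have h1 := mem_Agree.1 hσ.2 _ he
    simp only at h1 ⊢
    by_cases hy : y = x
    · subst hy
      rw [Function.update_self, Equiv.trans_apply, h1]
      apply Equiv.swap_apply_of_ne_of_ne
      · rintro rfl
        have : k' = k := (σ y).injective (h1.trans hσ.1.symm)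
        exact hf w (this ▸ he)
      · rintro rfl
        exact hv' k' he
    · rw [Function.update_of_ne hy]; exact h1
  · intro σ _ τ _ hστ
    funext y
    have := congrFun hστ y
    by_cases hy : y = x
    · subst hy
      simp only [Function.update_self] at this
      ext z
      have h2 := congrArg (fun e => e z) this
      simp only [Equiv.trans_apply] at h2
      exact congrArg Fin.val ((Equiv.swap v v').injective h2)
    · simpa [Function.update_of_ne hy] using this

lemma sum_card_Agree_cons (x k : Fin n) (h : Hist n) :
    ∑ v, ((Agree ((x, k, v) :: h)).card : ℝ) = (Agree h).card := by
  rw [← Nat.cast_sum, Finset.card_eq_sum_card_fiberwise (f := fun σ : Env n => σ x k)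
    (t := Finset.univ) (fun _ _ => Finset.mem_univ _)]
  congr 1
  refine Finset.sum_congr rfl fun v _ => ?_
  congr 1
  ext σ
  simp [mem_Agree_cons, and_comm]

lemma fresh_card {x k : Fin n} {h : Hist n} (hf : Fresh x k h) (v : Fin n) :
    ((n : ℝ) - h.length) * (Agree ((x, k, v) :: h)).card ≤ (Agree h).card := by
  set U : Finset (Fin n) := (h.map fun e => e.2.2).toFinset with hU
  have hUc : U.card ≤ h.length := by
    simpa using List.toFinset_card_le (h.map fun e => e.2.2)
  have h1 : ∀ v' ∈ Uᶜ, ((Agree ((x, k, v) :: h)).card : ℝ) ≤ (Agree ((x, k, v') :: h)).card := by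
    intro v' hv'
    refine Nat.cast_le.2 (card_Agree_cons_le hf v v' fun k' hk' => ?_)
    apply Finset.mem_compl.1 hv'
    simp only [hU, List.mem_toFinset, List.mem_map]
    exact ⟨_, hk', rfl⟩
  have h2 : ((n : ℝ) - h.length) ≤ (Uᶜ.card : ℝ) := by
    rw [Finset.card_compl, Fintype.card_fin]
    have : U.card ≤ n := by simpa using Finset.card_le_univ U
    rw [Nat.cast_sub this]
    have : (U.card : ℝ) ≤ h.length := by exact_mod_cast hUc
    linarith
  calc ((n : ℝ) - h.length) * (Agree ((x, k, v) :: h)).card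
      ≤ Uᶜ.card * (Agree ((x, k, v) :: h)).card := by gcongr
    _ = ∑ v' ∈ Uᶜ, ((Agree ((x, k, v) :: h)).card : ℝ) := by simp
    _ ≤ ∑ v' ∈ Uᶜ, ((Agree ((x, k, v') :: h)).card : ℝ) := Finset.sum_le_sum h1
    _ ≤ ∑ v', ((Agree ((x, k, v') :: h)).card : ℝ) :=
        Finset.sum_le_univ_sum_of_nonneg fun _ => by positivity
    _ = _ := sum_card_Agree_cons x k h

/-- Bounding an expectation over a walk by revealing the environment along the walk. -/
lemma annealed {p : Fin n → Fin n → ℝ} (hp : ∀ i j, 0 ≤ p i j) {Lmax : ℕ} (hL : Lmax ≤ n)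
    {Ψ : ℕ → Fin n → Hist n → ℝ} (hΨ : ∀ m x h, 0 ≤ Ψ m x h)
    {F : Env n → Fin n → Hist n → ℝ}
    (hF : ∀ x h, h.length ≤ Lmax → ∑ σ ∈ Agree h, F σ x h ≤ (Agree h).card * Ψ 0 x h)
    (hstep : ∀ m x h, h.length + m + 1 ≤ Lmax → ∃ c : Fin n → ℝ,
      (∀ k v, (x, k, v) ∈ h → Ψ m v ((x, k, v) :: h) ≤ c k) ∧
      (∀ k, Fresh x k h → ∑ v, Ψ m v ((x, k, v) :: h) ≤ ((n : ℝ) - h.length) * c k) ∧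
      ∑ k, p x k * c k ≤ Ψ (m + 1) x h) :
    ∀ T x h, h.length + T ≤ Lmax →
      ∑ σ ∈ Agree h, ∑ κ ∈ words n T, wt p σ x κ * F σ (run σ x κ) (trip σ x κ h) ≤
        (Agree h).card * Ψ T x h := by
  intro T
  induction T with
  | zero =>
    intro x h hl
    simpa [sum_words_zero] using hF x h hl
  | succ T ih =>
    intro x h hl
    obtain ⟨c, hc1, hc2, hc3⟩ := hstep T x h hl
    have hpos : (0 : ℝ) < (n : ℝ) - h.length := by
      have : h.length < n := by omega
      have : (h.length : ℝ) < n := by exact_mod_cast this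
      linarith
    have key : ∀ k, ∑ σ ∈ Agree h, ∑ κ ∈ words n T, wt p σ (σ x k) κ *
        F σ (run σ (σ x k) κ) (trip σ (σ x k) κ ((x, k, σ x k) :: h)) ≤
        (Agree h).card * c k := by
      intro k
      have e1 : ∑ σ ∈ Agree h, ∑ κ ∈ words n T, wt p σ (σ x k) κ *
          F σ (run σ (σ x k) κ) (trip σ (σ x k) κ ((x, k, σ x k) :: h)) =
          ∑ v, ∑ σ ∈ Agree ((x, k, v) :: h), ∑ κ ∈ words n T, wt p σ v κ *
          F σ (run σ v κ) (trip σ v κ ((x, k, v) :: h)) := by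
        rw [← Finset.sum_fiberwise_of_maps_to (s := Agree h) (t := Finset.univ)
          (g := fun σ : Env n => σ x k) (fun _ _ => Finset.mem_univ _)]
        refine Finset.sum_congr rfl fun v _ => ?_
        have e2 : (Agree h).filter (fun σ : Env n => σ x k = v) = Agree ((x, k, v) :: h) := by
          ext σ; simp [mem_Agree_cons, and_comm]
        rw [e2]
        refine Finset.sum_congr rfl fun σ hσ => ?_
        rw [(mem_Agree_cons.1 hσ).1]
      rw [e1]
      have e3 : ∀ v, ∑ σ ∈ Agree ((x, k, v) :: h), ∑ κ ∈ words n T, wt p σ v κ *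
          F σ (run σ v κ) (trip σ v κ ((x, k, v) :: h)) ≤
          (Agree ((x, k, v) :: h)).card * Ψ T v ((x, k, v) :: h) := fun v =>
        ih v _ (by simp only [List.length_cons]; omega)
      refine (Finset.sum_le_sum fun v _ => e3 v).trans ?_
      by_cases hf : Fresh x k h
      · have e4 : ∀ v, ((Agree ((x, k, v) :: h)).card : ℝ) * Ψ T v ((x, k, v) :: h) ≤
            (Agree h).card / ((n : ℝ) - h.length) * Ψ T v ((x, k, v) :: h) := fun v => by
          refine mul_le_mul_of_nonneg_right ?_ (hΨ _ _ _)
          rw [le_div_iff₀ hpos, mul_comm]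
          exact fresh_card hf v
        refine (Finset.sum_le_sum fun v _ => e4 v).trans ?_
        rw [← Finset.mul_sum, div_mul_eq_mul_div, div_le_iff₀ hpos, mul_assoc]
        refine mul_le_mul_of_nonneg_left ?_ (by positivity)
        rw [mul_comm (c k)]
        exact hc2 k hf
      · simp only [Fresh, not_forall, not_not] at hf
        obtain ⟨w, hw⟩ := hf
        have e5 : ∀ v, ((Agree ((x, k, v) :: h)).card : ℝ) * Ψ T v ((x, k, v) :: h) ≤
            (Agree ((x, k, v) :: h)).card * c k := fun v => by
          by_cases hv : v = w
          · subst hv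
            exact mul_le_mul_of_nonneg_left (hc1 k v hw) (by positivity)
          · have : Agree ((x, k, v) :: h) = ∅ := by
              ext σ
              simp only [mem_Agree_cons, Finset.notMem_empty, iff_false, not_and]
              intro h1 h2
              exact hv (h1.symm.trans (mem_Agree.1 h2 _ hw))
            simp [this]
        refine (Finset.sum_le_sum fun v _ => e5 v).trans ?_
        rw [← Finset.sum_mul, sum_card_Agree_cons]
    calc ∑ σ ∈ Agree h, ∑ κ ∈ words n (T + 1),
          wt p σ x κ * F σ (run σ x κ) (trip σ x κ h)
        = ∑ k, p x k * ∑ σ ∈ Agree h, ∑ κ ∈ words n T, wt p σ (σ x k) κ *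
            F σ (run σ (σ x k) κ) (trip σ (σ x k) κ ((x, k, σ x k) :: h)) := by
          simp only [sum_words_succ, Finset.mul_sum, run_cons, wt_cons, trip_cons, mul_assoc]
          rw [Finset.sum_comm]
      _ ≤ ∑ k, p x k * ((Agree h).card * c k) :=
          Finset.sum_le_sum fun k _ => mul_le_mul_of_nonneg_left (key k) (hp _ _)
      _ = (Agree h).card * ∑ k, p x k * c k := by
          rw [Finset.mul_sum]; exact Finset.sum_congr rfl fun k _ => by ring
      _ ≤ _ := mul_le_mul_of_nonneg_left hc3 (by positivity)

/-! ### Collisions -/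

/-- Vertices already seen: the roots and the heads of the history. -/
def seen (R : Finset (Fin n)) : Hist n → Finset (Fin n)
  | [] => R
  | e :: h => insert e.2.2 (seen R h)

/-- Number of fresh steps that landed on a vertex already seen. -/
noncomputable def coll (R : Finset (Fin n)) : Hist n → ℕ
  | [] => 0
  | e :: h => coll R h + if Fresh e.1 e.2.1 h ∧ e.2.2 ∈ seen R h then 1 else 0

/-- Multiplicative potential: a fresh step costs `z` when it collides and `g v` otherwise. -/
noncomputable def pot (R : Finset (Fin n)) (z : ℝ) (g : Fin n → ℝ) : Hist n → ℝ
  | [] => 1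
  | e :: h => pot R z g h *
      if Fresh e.1 e.2.1 h then (if e.2.2 ∈ seen R h then z else g e.2.2) else 1

lemma pot_nonneg {R : Finset (Fin n)} {z : ℝ} (hz : 0 ≤ z) {g : Fin n → ℝ} (hg : ∀ v, 0 ≤ g v)
    (h : Hist n) : 0 ≤ pot R z g h := by
  induction h with
  | nil => simp [pot]
  | cons e h ih =>
    refine mul_nonneg ih ?_
    split_ifs
    exacts [hz, hg _, zero_le_one]

lemma pot_one (R : Finset (Fin n)) (z : ℝ) (h : Hist n) :
    pot R z (fun _ => 1) h = z ^ coll R h := by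
  induction h with
  | nil => simp [pot, coll]
  | cons e h ih =>
    rw [pot, coll, ih, pow_add]
    by_cases h1 : Fresh e.1 e.2.1 h <;> by_cases h2 : e.2.2 ∈ seen R h <;> simp [h1, h2]

lemma card_seen (R : Finset (Fin n)) (h : Hist n) : (seen R h).card ≤ R.card + h.length := by
  induction h with
  | nil => simp [seen]
  | cons e h ih =>
    have := Finset.card_insert_le e.2.2 (seen R h)
    simp only [seen, List.length_cons]; omega

/-- `F` is bounded by `B` times the potential, given any history leaving `l` steps to reveal. -/
def PotBound (R : Finset (Fin n)) (z : ℝ) (g : Fin n → ℝ) (Lmax : ℕ) (l : ℕ) (B : ℝ)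
    (F : Env n → Hist n → ℝ) : Prop :=
  ∀ h, h.length + l ≤ Lmax → ∑ σ ∈ Agree h, F σ h ≤ (Agree h).card * (B * pot R z g h)

lemma PotBound.walk {R : Finset (Fin n)} {z : ℝ} (hz : 0 ≤ z) {g : Fin n → ℝ}
    (hg : ∀ v, 0 ≤ g v) {Lmax : ℕ} (hL : Lmax < n) {C : ℝ} (hC1 : 1 ≤ C)
    (hC : z * (R.card + Lmax) + ∑ v, g v ≤ ((n : ℝ) - Lmax) * C)
    {p : Fin n → Fin n → ℝ} (hp : ∀ i j, 0 ≤ p i j) (hp1 : ∀ i, ∑ j, p i j ≤ 1)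
    {l : ℕ} {B : ℝ} (hB : 0 ≤ B) {F : Env n → Hist n → ℝ} (hF : PotBound R z g Lmax l B F)
    (T : ℕ) (x : Fin n) :
    PotBound R z g Lmax (l + T) (C ^ T * B)
      (fun σ h => ∑ κ ∈ words n T, wt p σ x κ * F σ (trip σ x κ h)) := by
  intro h hl
  by_cases hlL : l ≤ Lmax
  swap
  · omega
  have h0 : ∀ h : Hist n, 0 ≤ pot R z g h := pot_nonneg hz hg
  refine (annealed hp (Lmax := Lmax - l) (by omega)
    (Ψ := fun m _ h => C ^ m * B * pot R z g h) (F := fun σ _ h => F σ h) ?_ ?_ ?_ T x h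
    (by omega))
  · intro m x h; have := h0 h; positivity
  · intro x h hl'
    simpa using hF h (by omega)
  · intro m x h hl'
    refine ⟨fun _ => C ^ (m + 1) * B * pot R z g h, ?_, ?_, ?_⟩
    · intro k v hv
      have : ¬ Fresh x k h := fun hf => hf v hv
      simp only [pot, this, if_false, mul_one]
      have := h0 h
      gcongr
      exact Nat.le_succ m
    · intro k hf
      simp only [pot, hf, if_true]
      have e1 : ∑ v, (if v ∈ seen R h then z else g v) ≤ z * (R.card + Lmax) + ∑ v, g v := by
        calc ∑ v, (if v ∈ seen R h then z else g v)
            ≤ ∑ v, ((if v ∈ seen R h then z else 0) + g v) := by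
              refine Finset.sum_le_sum fun v _ => ?_
              split_ifs
              · linarith [hg v]
              · linarith
          _ = z * (seen R h).card + ∑ v, g v := by
              rw [Finset.sum_add_distrib]; simp [mul_comm]
          _ ≤ _ := by
              have := card_seen R h
              have : ((seen R h).card : ℝ) ≤ R.card + Lmax := by
                have : (seen R h).card ≤ R.card + Lmax := by omega
                exact_mod_cast this
              gcongr
      have e2 : ((n : ℝ) - Lmax) * C ≤ ((n : ℝ) - h.length) * C := by
        have : (h.length : ℝ) ≤ Lmax := by
          have : h.length ≤ Lmax := by omega
          exact_mod_cast this
        gcongr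
      have h3 : 0 ≤ C ^ m * B * pot R z g h := by have := h0 h; positivity
      calc ∑ v, C ^ m * B * (pot R z g h * if v ∈ seen R h then z else g v)
          = C ^ m * B * pot R z g h * ∑ v, (if v ∈ seen R h then z else g v) := by
            rw [Finset.mul_sum]; exact Finset.sum_congr rfl fun v _ => by ring
        _ ≤ C ^ m * B * pot R z g h * (((n : ℝ) - h.length) * C) :=
            mul_le_mul_of_nonneg_left (e1.trans (hC.trans e2)) h3
        _ = _ := by ring
    · rw [← Finset.sum_mul]
      have := h0 h
      exact mul_le_of_le_one_left (by positivity) (hp1 x)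

lemma PotBound.Ex_le {R : Finset (Fin n)} {z : ℝ} {g : Fin n → ℝ} {Lmax l : ℕ} {B : ℝ}
    {F : Env n → Hist n → ℝ} (hF : PotBound R z g Lmax l B F) (hl : l ≤ Lmax) :
    Ex (fun σ => F σ []) ≤ B := by
  have := hF [] (by simpa using hl)
  rw [Agree_nil, Finset.card_univ] at this
  rw [Ex, div_le_iff₀ card_env_pos]
  simpa [pot, mul_comm] using this

/-- The parameters `z = n / (L+2)²` make the growth constant harmless. -/
lemma growth_le {L : ℕ} (hn : 2 * (L + 2) ^ 2 ≤ n) :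
    ((1 + 1 / ((L : ℝ) + 2)) * (n / ((n : ℝ) - L))) ^ L ≤ 6 := by
  have hnR : 2 * ((L : ℝ) + 2) ^ 2 ≤ n := by exact_mod_cast hn
  have hL0 : (0 : ℝ) ≤ L := by positivity
  have hn0 : (0 : ℝ) < n := by nlinarith
  have hnL : (0 : ℝ) < n - L := by nlinarith
  rw [mul_pow]
  have h1 : (1 + 1 / ((L : ℝ) + 2)) ^ L ≤ 3 := by
    have h := Real.add_one_le_exp (1 / ((L : ℝ) + 2))
    have : (1 + 1 / ((L : ℝ) + 2)) ^ L ≤ (Real.exp (1 / ((L : ℝ) + 2))) ^ L := by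
      gcongr; linarith
    rw [← Real.exp_nat_mul] at this
    have h2 : (L : ℝ) * (1 / ((L : ℝ) + 2)) ≤ 1 := by
      rw [mul_one_div, div_le_one (by positivity)]; linarith
    have := this.trans (Real.exp_le_exp.2 h2)
    linarith [Real.exp_one_lt_d9]
  have h2 : ((n : ℝ) / (n - L)) ^ L ≤ 2 := by
    have hb := one_add_mul_le_pow (a := -((L : ℝ) / n)) (by
      have : (L : ℝ) / n ≤ 1 := by rw [div_le_one hn0]; linarith
      linarith) L
    have e : (n : ℝ) / (n - L) = (1 + -((L : ℝ) / n))⁻¹ := by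
      rw [← sub_eq_add_neg, one_sub_div hn0.ne', inv_div]
    rw [e, inv_pow]
    apply inv_le_of_inv_le₀ (by norm_num)
    refine le_trans ?_ hb
    have : (L : ℝ) * (L / n) ≤ 1 / 2 := by
      rw [mul_div_assoc', div_le_iff₀ hn0]; nlinarith
    linarith
  calc _ ≤ (3 : ℝ) * 2 := by gcongr
    _ = 6 := by norm_num

/-! ### Ancestral words -/

/-- Every tail has been seen before the step is taken. -/
def Valid (R : Finset (Fin n)) : Hist n → Prop
  | [] => True
  | e :: h => e.1 ∈ seen R h ∧ Valid R h

/-- All triples read by the walk belong to `S`. -/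
def InH (σ : Env n) (S : Set (Fin n × Fin n × Fin n)) : Fin n → List (Fin n) → Prop
  | _, [] => True
  | x, k :: κ => (x, k, σ x k) ∈ S ∧ InH σ S (σ x k) κ

@[simp] lemma InH_nil (σ : Env n) (S : Set (Fin n × Fin n × Fin n)) (x : Fin n) :
    InH σ S x [] := trivial

@[simp] lemma InH_cons (σ : Env n) (S : Set (Fin n × Fin n × Fin n)) (x k : Fin n)
    (κ : List (Fin n)) : InH σ S x (k :: κ) ↔ (x, k, σ x k) ∈ S ∧ InH σ S (σ x k) κ := Iff.rfl

lemma InH.mono {σ : Env n} {S S' : Set (Fin n × Fin n × Fin n)} (h : S ⊆ S') {x : Fin n}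
    {κ : List (Fin n)} (hκ : InH σ S x κ) : InH σ S' x κ := by
  induction κ generalizing x with
  | nil => trivial
  | cons k κ ih => exact ⟨h hκ.1, ih hκ.2⟩

lemma InH_append {σ : Env n} {S : Set (Fin n × Fin n × Fin n)} {x : Fin n}
    {κ κ' : List (Fin n)} : InH σ S x (κ ++ κ') ↔ InH σ S x κ ∧ InH σ S (run σ x κ) κ' := by
  induction κ generalizing x with
  | nil => simp
  | cons k κ ih => simp [ih, and_assoc]

lemma subset_trip (σ : Env n) (x : Fin n) (κ : List (Fin n)) (h : Hist n) :
    ∀ e ∈ h, e ∈ trip σ x κ h := by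
  induction κ generalizing x h with
  | nil => simp
  | cons k κ ih => exact fun e he => ih _ _ e (List.mem_cons_of_mem _ he)

lemma InH_trip (σ : Env n) (x : Fin n) (κ : List (Fin n)) (h : Hist n) :
    InH σ {e | e ∈ trip σ x κ h} x κ := by
  induction κ generalizing x h with
  | nil => simp
  | cons k κ ih =>
    exact ⟨subset_trip σ _ κ _ _ (List.mem_cons_self ..), ih _ _⟩

lemma Agree_trip {σ : Env n} {x : Fin n} {κ : List (Fin n)} {h : Hist n} (hσ : σ ∈ Agree h) :
    σ ∈ Agree (trip σ x κ h) := by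
  induction κ generalizing x h with
  | nil => simpa
  | cons k κ ih => exact ih (mem_Agree_cons.2 ⟨rfl, hσ⟩)

lemma root_mem_seen {R : Finset (Fin n)} (h : Hist n) {x : Fin n} (hx : x ∈ R) :
    x ∈ seen R h := by
  induction h with
  | nil => simpa [seen]
  | cons e h ih => exact Finset.mem_insert_of_mem ih

lemma Valid_trip {R : Finset (Fin n)} {σ : Env n} {x : Fin n} {κ : List (Fin n)} {h : Hist n}
    (hx : x ∈ seen R h) (hv : Valid R h) : Valid R (trip σ x κ h) := by
  induction κ generalizing x h with
  | nil => simpa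
  | cons k κ ih => exact ih (Finset.mem_insert_self _ _) ⟨hx, hv⟩

lemma mem_seen_of_mem {R : Finset (Fin n)} {h : Hist n} (hv : Valid R h) :
    ∀ e ∈ h, e.1 ∈ seen R h ∧ e.2.2 ∈ seen R h := by
  induction h with
  | nil => simp
  | cons e h ih =>
    rintro f hf
    rcases List.mem_cons.1 hf with rfl | hf
    · exact ⟨Finset.mem_insert_of_mem hv.1, Finset.mem_insert_self _ _⟩
    · exact ⟨Finset.mem_insert_of_mem (ih hv.2 f hf).1, Finset.mem_insert_of_mem (ih hv.2 f hf).2⟩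

lemma mem_of_not_Fresh {σ : Env n} {e : Fin n × Fin n × Fin n} {h : Hist n}
    (hσ : σ ∈ Agree (e :: h)) (hf : ¬ Fresh e.1 e.2.1 h) : e ∈ h := by
  obtain ⟨x, k, v⟩ := e
  simp only [Fresh, not_forall, not_not] at hf
  obtain ⟨w, hw⟩ := hf
  have h1 := mem_Agree.1 hσ (x, k, v) (by simp)
  have h2 := mem_Agree.1 hσ (x, k, w) (by simp [hw])
  simp only at h1 h2
  rwa [← h1, h2]

/-- Without collisions the history is a forest rooted at `R`. -/
lemma exists_anc {R : Finset (Fin n)} {σ : Env n} {h : Hist n} (hv : Valid R h)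
    (hσ : σ ∈ Agree h) (hc : coll R h = 0) :
    ∃ anc : Fin n → Fin n × List (Fin n), (∀ r ∈ R, anc r = (r, [])) ∧
      ∀ e ∈ h, anc e.2.2 = ((anc e.1).1, e.2.1 :: (anc e.1).2) := by
  induction h with
  | nil => exact ⟨fun r => (r, []), by simp, by simp⟩
  | cons e h ih =>
    have hσ' : σ ∈ Agree h := mem_Agree.2 fun f hf => mem_Agree.1 hσ f (by simp [hf])
    simp only [coll, Nat.add_eq_zero_iff] at hc
    obtain ⟨anc, h1, h2⟩ := ih hv.2 hσ' hc.1
    by_cases hf : Fresh e.1 e.2.1 h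
    · have hns : e.2.2 ∉ seen R h := fun hs => by simp [hf, hs] at hc
      have hne : ∀ v ∈ seen R h, v ≠ e.2.2 := fun v hv' h' => hns (h' ▸ hv')
      refine ⟨Function.update anc e.2.2 ((anc e.1).1, e.2.1 :: (anc e.1).2), ?_, ?_⟩
      · intro r hr
        rw [Function.update_of_ne (hne r (root_mem_seen h hr)), h1 r hr]
      · intro f hf'
        rcases List.mem_cons.1 hf' with rfl | hf'
        · rw [Function.update_self, Function.update_of_ne (hne _ hv.1)]
        · have := mem_seen_of_mem hv.2 f hf'
          rw [Function.update_of_ne (hne _ this.1), Function.update_of_ne (hne _ this.2), h2 f hf']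
    · have hm := mem_of_not_Fresh hσ hf
      refine ⟨anc, h1, fun f hf' => ?_⟩
      rcases List.mem_cons.1 hf' with rfl | hf'
      · exact h2 _ hm
      · exact h2 _ hf'

lemma anc_run {σ : Env n} {S : Set (Fin n × Fin n × Fin n)} {anc : Fin n → Fin n × List (Fin n)}
    (ha : ∀ e ∈ S, anc e.2.2 = ((anc e.1).1, e.2.1 :: (anc e.1).2)) {x : Fin n}
    {κ : List (Fin n)} (hκ : InH σ S x κ) :
    anc (run σ x κ) = ((anc x).1, κ.reverse ++ (anc x).2) := by
  induction κ generalizing x with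
  | nil => simp
  | cons k κ ih =>
    have := ih hκ.2
    rw [run_cons, this, ha _ hκ.1]
    simp

/-- Without collisions, an endpoint determines the root and the word. -/
lemma word_unique {R : Finset (Fin n)} {σ : Env n} {h : Hist n} (hv : Valid R h)
    (hσ : σ ∈ Agree h) (hc : coll R h = 0) {x y : Fin n} (hx : x ∈ R) (hy : y ∈ R)
    {κ κ' : List (Fin n)} (hκ : InH σ {e | e ∈ h} x κ) (hκ' : InH σ {e | e ∈ h} y κ')
    (hr : run σ x κ = run σ y κ') : x = y ∧ κ = κ' := by
  obtain ⟨anc, h1, h2⟩ := exists_anc hv hσ hc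
  have e1 := anc_run h2 hκ
  have e2 := anc_run h2 hκ'
  rw [hr, e2, h1 x hx, h1 y hy] at e1
  simpa [eq_comm] using e1

/-- With at most one collision the history is a forest up to one exceptional edge. -/
lemma exists_anc_one {i : Fin n} {σ : Env n} {h : Hist n} (hv : Valid {i} h)
    (hσ : σ ∈ Agree h) (hc : coll {i} h ≤ 1) :
    ∃ (anc : Fin n → Fin n × List (Fin n)) (f : Fin n × Fin n × Fin n), anc i = (i, []) ∧
      ∀ e ∈ h, e = f ∨ anc e.2.2 = ((anc e.1).1, e.2.1 :: (anc e.1).2) := by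
  induction h with
  | nil => exact ⟨fun r => (r, []), (i, i, i), by simp, by simp⟩
  | cons e h ih =>
    have hσ' : σ ∈ Agree h := mem_Agree.2 fun f hf => mem_Agree.1 hσ f (by simp [hf])
    by_cases hcl : Fresh e.1 e.2.1 h ∧ e.2.2 ∈ seen {i} h
    · have hc0 : coll {i} h = 0 := by simp only [coll, hcl, and_self, if_true] at hc; omega
      obtain ⟨anc, h1, h2⟩ := exists_anc hv.2 hσ' hc0
      refine ⟨anc, e, h1 i (by simp), fun g hg => ?_⟩
      rcases List.mem_cons.1 hg with rfl | hg
      · exact Or.inl rfl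
      · exact Or.inr (h2 g hg)
    · have hc1 : coll {i} h ≤ 1 := by simp only [coll] at hc; omega
      obtain ⟨anc, g, h1, h2⟩ := ih hv.2 hσ' hc1
      by_cases hf : Fresh e.1 e.2.1 h
      · have hns : e.2.2 ∉ seen {i} h := fun hs => hcl ⟨hf, hs⟩
        have hne : ∀ v ∈ seen {i} h, v ≠ e.2.2 := fun v hv' h' => hns (h' ▸ hv')
        refine ⟨Function.update anc e.2.2 ((anc e.1).1, e.2.1 :: (anc e.1).2), g, ?_, ?_⟩
        · rw [Function.update_of_ne (hne i (root_mem_seen h (by simp))), h1]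
        · intro f hf'
          rcases List.mem_cons.1 hf' with rfl | hf'
          · right
            rw [Function.update_self, Function.update_of_ne (hne _ hv.1)]
          · have := mem_seen_of_mem hv.2 f hf'
            rw [Function.update_of_ne (hne _ this.1), Function.update_of_ne (hne _ this.2)]
            exact h2 f hf'
      · have hm := mem_of_not_Fresh hσ hf
        refine ⟨anc, g, h1, fun f hf' => ?_⟩
        rcases List.mem_cons.1 hf' with rfl | hf'
        · exact h2 _ hm
        · exact h2 _ hf'

/-- Decomposition of a walk at its last use of the exceptional edge. -/
lemma last_use {σ : Env n} {S : Set (Fin n × Fin n × Fin n)} {f : Fin n × Fin n × Fin n}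
    {x : Fin n} {κ : List (Fin n)} (h : InH σ (insert f S) x κ) (h' : ¬ InH σ S x κ) :
    ∃ κa κb, κ = κa ++ f.2.1 :: κb ∧ run σ x κa = f.1 ∧ InH σ (insert f S) x κa ∧
      InH σ S f.2.2 κb ∧ σ f.1 f.2.1 = f.2.2 := by
  induction κ generalizing x with
  | nil => simp at h'
  | cons k κ ih =>
    by_cases hκ : InH σ S (σ x k) κ
    · have hf : (x, k, σ x k) = f := by
        rcases h.1 with h1 | h1
        · exact h1
        · exact absurd ⟨h1, hκ⟩ h'
      subst hf
      exact ⟨[], κ, rfl, rfl, trivial, hκ, rfl⟩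
    · obtain ⟨κa, κb, h1, h2, h3, h4⟩ := ih h.2 hκ
      exact ⟨k :: κa, κb, by simp [h1], h2, ⟨h.1, h3⟩, h4⟩

section OneEdge

variable {σ : Env n} {S : Set (Fin n × Fin n × Fin n)} {f : Fin n × Fin n × Fin n}
  {anc : Fin n → Fin n × List (Fin n)} {i : Fin n}

lemma le_length_of_run (ha : ∀ e ∈ S, anc e.2.2 = ((anc e.1).1, e.2.1 :: (anc e.1).2))
    (hi : anc i = (i, [])) : ∀ (N : ℕ) (κ : List (Fin n)), κ.length ≤ N →
      InH σ (insert f S) i κ → run σ i κ = f.1 → (anc f.1).2.length ≤ κ.length := by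
  intro N
  induction N with
  | zero =>
    intro κ hl _ hr
    obtain rfl : κ = [] := List.eq_nil_of_length_eq_zero (by omega)
    have : f.1 = i := hr.symm
    simp [this, hi]
  | succ N ih =>
    intro κ hl hκ hr
    by_cases hS : InH σ S i κ
    · have := anc_run ha hS
      rw [hr, hi] at this
      simp [this]
    · obtain ⟨κa, κb, rfl, h2, h3, -⟩ := last_use hκ hS
      simp only [List.length_append, List.length_cons] at hl ⊢
      have := ih κa (by omega) h3 h2
      omega

lemma free_ne (ha : ∀ e ∈ S, anc e.2.2 = ((anc e.1).1, e.2.1 :: (anc e.1).2))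
    (hi : anc i = (i, [])) {κ κ' : List (Fin n)} (hl : κ.length = κ'.length)
    (hr : run σ i κ = f.1) (hr' : run σ i κ' = f.1) (h : InH σ S i κ)
    (h' : InH σ (insert f S) i κ') : InH σ S i κ' := by
  by_contra hS
  obtain ⟨κa, κb, rfl, h2, h3, h4, -⟩ := last_use h' hS
  have e1 := anc_run ha h
  have e2 := anc_run ha h4
  rw [hr, hi] at e1
  have h5 := le_length_of_run ha hi _ κa le_rfl h3 h2
  rw [run_append, run_cons] at hr'
  simp only [e1, List.append_nil, List.length_reverse, List.length_append, List.length_cons] at h5 hl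
  omega

lemma nonfree_unique (ha : ∀ e ∈ S, anc e.2.2 = ((anc e.1).1, e.2.1 :: (anc e.1).2))
    (hi : anc i = (i, [])) : ∀ (N : ℕ) (κ κ' : List (Fin n)), κ.length ≤ N →
      κ.length = κ'.length → run σ i κ = run σ i κ' →
      InH σ (insert f S) i κ → InH σ (insert f S) i κ' →
      ¬ InH σ S i κ → ¬ InH σ S i κ' → κ = κ' := by
  intro N
  induction N with
  | zero =>
    intro κ κ' hl _ _ _ _ h
    obtain rfl : κ = [] := List.eq_nil_of_length_eq_zero (by omega)
    simp at h
  | succ N ih =>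
    intro κ κ' hl hll hr hκ hκ' hS hS'
    obtain ⟨κa, κb, rfl, h2, h3, h4, h5⟩ := last_use hκ hS
    obtain ⟨κa', κb', rfl, h2', h3', h4', -⟩ := last_use hκ' hS'
    have e1 := anc_run ha h4
    have e2 := anc_run ha h4'
    rw [run_append, run_append, run_cons, run_cons, h2, h2', h5] at hr
    rw [hr, e2] at e1
    simp only [Prod.mk.injEq, true_and, List.append_cancel_right_eq, List.reverse_inj] at e1
    subst e1
    simp only [List.length_append, List.length_cons] at hl hll
    have hlen : κa.length = κa'.length := by omega
    have : κa = κa' := by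
      by_cases c1 : InH σ S i κa
      · have c2 := free_ne ha hi hlen h2 h2' c1 h3'
        have d1 := anc_run ha c1
        have d2 := anc_run ha c2
        rw [h2, hi] at d1
        rw [h2', hi, d1] at d2
        simpa using d2
      · have c2 : ¬ InH σ S i κa' := fun c2 => c1 (free_ne ha hi hlen.symm h2' h2 c2 h3)
        exact ih κa κa' (by omega) hlen (h2.trans h2'.symm) h3 h3' c1 c2
    rw [this]

end OneEdge

/-- With at most one collision, at most two words of a given length share an endpoint. -/
lemma three_words {i : Fin n} {σ : Env n} {h : Hist n} (hv : Valid {i} h)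
    (hσ : σ ∈ Agree h) (hc : coll {i} h ≤ 1) {κ : Fin 3 → List (Fin n)} {u : ℕ} {y : Fin n}
    (hl : ∀ a, (κ a).length = u) (hκ : ∀ a, InH σ {e | e ∈ h} i (κ a))
    (hr : ∀ a, run σ i (κ a) = y) : ∃ a b, a ≠ b ∧ κ a = κ b := by
  obtain ⟨anc, f, hi, ha⟩ := exists_anc_one hv hσ hc
  set S : Set (Fin n × Fin n × Fin n) :=
    {e | anc e.2.2 = ((anc e.1).1, e.2.1 :: (anc e.1).2)} with hS
  have haS : ∀ e ∈ S, anc e.2.2 = ((anc e.1).1, e.2.1 :: (anc e.1).2) := fun e he => he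
  have hsub : ∀ a, InH σ (insert f S) i (κ a) := fun a =>
    (hκ a).mono fun e he => ha e he
  obtain ⟨a, b, hab, hiff⟩ := Fintype.exists_ne_map_eq_of_card_lt
    (fun a : Fin 3 => (decide (InH σ S i (κ a)) : Bool)) (by simp)
  refine ⟨a, b, hab, ?_⟩
  simp only [decide_eq_decide] at hiff
  by_cases h1 : InH σ S i (κ a)
  · have d1 := anc_run haS h1
    have d2 := anc_run haS (hiff.1 h1)
    rw [hr a] at d1
    rw [hr b, d1] at d2
    simpa using d2
  · exact nonfree_unique haS hi _ _ _ le_rfl ((hl a).trans (hl b).symm)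
      ((hr a).trans (hr b).symm) (hsub a) (hsub b) h1 (fun h2 => h1 (hiff.2 h2))

/-! ### Collision estimates -/

section CollBounds

variable {p : Fin n → Fin n → ℝ}

/-- Indicator of a proposition. -/
noncomputable def ind (P : Prop) : ℝ := if P then 1 else 0

lemma ind_nonneg (P : Prop) : 0 ≤ ind P := by unfold ind; split_ifs <;> norm_num
lemma ind_le_one (P : Prop) : ind P ≤ 1 := by unfold ind; split_ifs <;> norm_num
lemma ind_mono {P Q : Prop} (h : P → Q) : ind P ≤ ind Q := by
  unfold ind
  by_cases hP : P
  · simp [hP, h hP]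
  · simp only [hP, if_false]; split_ifs <;> norm_num
lemma ind_of {P : Prop} (h : P) : ind P = 1 := by simp [ind, h]
lemma ind_not {P : Prop} (h : ¬ P) : ind P = 0 := by simp [ind, h]

lemma growth_hyps {R : Finset (Fin n)} (hR : R.card ≤ 2) {L : ℕ} (hn : 2 * (L + 2) ^ 2 ≤ n) :
    0 ≤ (n : ℝ) / ((L : ℝ) + 2) ^ 2 ∧ L < n ∧
    1 ≤ (1 + 1 / ((L : ℝ) + 2)) * (n / ((n : ℝ) - L)) ∧
    (n : ℝ) / ((L : ℝ) + 2) ^ 2 * (R.card + L) + ∑ _v : Fin n, (1 : ℝ) ≤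
      ((n : ℝ) - L) * ((1 + 1 / ((L : ℝ) + 2)) * (n / ((n : ℝ) - L))) := by
  have hnR : 2 * ((L : ℝ) + 2) ^ 2 ≤ n := by exact_mod_cast hn
  have hL0 : (0 : ℝ) ≤ L := by positivity
  have hn0 : (0 : ℝ) < n := by nlinarith
  have hnL : (0 : ℝ) < n - L := by nlinarith
  have hRR : (R.card : ℝ) ≤ 2 := by exact_mod_cast hR
  refine ⟨by positivity, by nlinarith, ?_, ?_⟩
  · have h1 : 1 ≤ (n : ℝ) / (n - L) := by rw [le_div_iff₀ hnL]; linarith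
    have h2 : 1 ≤ 1 + 1 / ((L : ℝ) + 2) := by
      have : 0 ≤ 1 / ((L : ℝ) + 2) := by positivity
      linarith
    nlinarith
  · have e : ((n : ℝ) - L) * ((1 + 1 / ((L : ℝ) + 2)) * (n / ((n : ℝ) - L))) =
        n + n / ((L : ℝ) + 2) := by field_simp
    rw [e]
    have : (n : ℝ) / ((L : ℝ) + 2) ^ 2 * (R.card + L) ≤ n / ((L : ℝ) + 2) := by
      rw [div_mul_eq_mul_div, div_le_div_iff₀ (by positivity) (by positivity)]
      have : (R.card : ℝ) + L ≤ L + 2 := by linarith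
      calc (n : ℝ) * (R.card + L) * (L + 2) ≤ n * (L + 2) * (L + 2) := by gcongr
        _ = _ := by ring
    simp only [Finset.sum_const, Finset.card_univ, Fintype.card_fin, nsmul_eq_mul, mul_one]
    linarith

lemma PotBound.coll {R : Finset (Fin n)} {z : ℝ} (hz : 1 ≤ z) (L a : ℕ) :
    PotBound R z (fun _ => 1) L 0 ((z ^ a)⁻¹) (fun _ h => ind (a ≤ coll R h)) := by
  intro h _
  rw [Finset.sum_const, nsmul_eq_mul, pot_one]
  refine mul_le_mul_of_nonneg_left ?_ (by positivity)
  by_cases hc : a ≤ Cutoff.coll R h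
  · rw [ind_of hc, inv_mul_eq_div, le_div_iff₀ (by positivity), one_mul]
    exact pow_le_pow_right₀ hz hc
  · rw [ind_not hc]; positivity

lemma coll_bound_one (hp : ∀ i j, 0 ≤ p i j) (hp1 : ∀ i, ∑ j, p i j ≤ 1)
    {R : Finset (Fin n)} (hR : R.card ≤ 2) (T a : ℕ)
    (hn : 2 * (T + 2) ^ 2 ≤ n) (x : Fin n) :
    Ex (fun σ => ∑ κ ∈ words n T, wt p σ x κ * ind (a ≤ coll R (trip σ x κ []))) ≤
      6 * (((T : ℝ) + 2) ^ 2 / n) ^ a := by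
  obtain ⟨h0, h1, h2, h3⟩ := growth_hyps hR hn
  have hnR : 2 * ((T : ℝ) + 2) ^ 2 ≤ n := by exact_mod_cast hn
  have hz : 1 ≤ (n : ℝ) / ((T : ℝ) + 2) ^ 2 := by
    rw [le_div_iff₀ (by positivity)]; nlinarith [sq_nonneg ((T : ℝ) + 2)]
  have hF := ((PotBound.coll (R := R) hz T a).walk h0 (fun _ => zero_le_one) h1 h2 h3 hp hp1
    (by positivity) T x).Ex_le (by omega)
  refine hF.trans ?_
  rw [← inv_pow, inv_div]
  gcongr
  exact growth_le hn

lemma coll_bound_two (hp : ∀ i j, 0 ≤ p i j) (hp1 : ∀ i, ∑ j, p i j ≤ 1)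
    {R : Finset (Fin n)} (hR : R.card ≤ 2) (T₁ T₂ a : ℕ)
    (hn : 2 * (T₁ + T₂ + 2) ^ 2 ≤ n) (x y : Fin n) :
    Ex (fun σ => ∑ κ ∈ words n T₁, wt p σ x κ * ∑ κ' ∈ words n T₂, wt p σ y κ' *
      ind (a ≤ coll R (trip σ y κ' (trip σ x κ [])))) ≤
      6 * (((T₁ : ℝ) + T₂ + 2) ^ 2 / n) ^ a := by
  obtain ⟨h0, h1, h2, h3⟩ := growth_hyps hR hn
  have hnR : 2 * (((T₁ + T₂ : ℕ) : ℝ) + 2) ^ 2 ≤ n := by exact_mod_cast hn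
  have hz : 1 ≤ (n : ℝ) / (((T₁ + T₂ : ℕ) : ℝ) + 2) ^ 2 := by
    rw [le_div_iff₀ (by positivity)]; nlinarith [sq_nonneg (((T₁ + T₂ : ℕ) : ℝ) + 2)]
  have hF := (((PotBound.coll (R := R) hz (T₁ + T₂) a).walk h0 (fun _ => zero_le_one) h1 h2 h3
    hp hp1 (by positivity) T₂ y).walk h0 (fun _ => zero_le_one) h1 h2 h3
    hp hp1 (by positivity) T₁ x).Ex_le (by omega)
  refine hF.trans ?_
  rw [← inv_pow, inv_div, ← mul_assoc, ← pow_add]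
  push_cast
  gcongr
  have := growth_le hn
  push_cast at this
  exact this

lemma coll_bound_three (hp : ∀ i j, 0 ≤ p i j) (hp1 : ∀ i, ∑ j, p i j ≤ 1)
    {R : Finset (Fin n)} (hR : R.card ≤ 2) (T a : ℕ)
    (hn : 2 * (3 * T + 2) ^ 2 ≤ n) (x : Fin n) :
    Ex (fun σ => ∑ κ ∈ words n T, wt p σ x κ * ∑ κ' ∈ words n T, wt p σ x κ' *
      ∑ κ'' ∈ words n T, wt p σ x κ'' *
      ind (a ≤ coll R (trip σ x κ'' (trip σ x κ' (trip σ x κ []))))) ≤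
      6 * ((3 * (T : ℝ) + 2) ^ 2 / n) ^ a := by
  obtain ⟨h0, h1, h2, h3⟩ := growth_hyps hR hn
  have hnR : 2 * (((3 * T : ℕ) : ℝ) + 2) ^ 2 ≤ n := by exact_mod_cast hn
  have hz : 1 ≤ (n : ℝ) / (((3 * T : ℕ) : ℝ) + 2) ^ 2 := by
    rw [le_div_iff₀ (by positivity)]; nlinarith [sq_nonneg (((3 * T : ℕ) : ℝ) + 2)]
  have hF := ((((PotBound.coll (R := R) hz (3 * T) a).walk h0 (fun _ => zero_le_one) h1 h2 h3
    hp hp1 (by positivity) T x).walk h0 (fun _ => zero_le_one) h1 h2 h3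
    hp hp1 (by positivity) T x).walk h0 (fun _ => zero_le_one) h1 h2 h3
    hp hp1 (by positivity) T x).Ex_le (by omega)
  refine hF.trans ?_
  rw [← inv_pow, inv_div, ← mul_assoc, ← mul_assoc, ← pow_add, ← pow_add]
  have := growth_le hn
  rw [show T + T + T = 3 * T by ring]
  push_cast at this ⊢
  gcongr

/-- Two distinct rooted words rarely share an endpoint. -/
lemma two_words_bound (hp : ∀ i j, 0 ≤ p i j) (hp1 : ∀ i, ∑ j, p i j ≤ 1)
    (T₁ T₂ : ℕ) (hn : 2 * (T₁ + T₂ + 2) ^ 2 ≤ n) (x y : Fin n) :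
    Ex (fun σ => ∑ κ ∈ words n T₁, wt p σ x κ * ∑ κ' ∈ words n T₂, wt p σ y κ' *
      ind (run σ x κ = run σ y κ' ∧ ¬ (x = y ∧ κ = κ'))) ≤
      6 * (((T₁ : ℝ) + T₂ + 2) ^ 2 / n) := by
  have := coll_bound_two hp hp1 (R := {x, y}) Finset.card_le_two T₁ T₂ 1 hn x y
  rw [pow_one] at this
  refine le_trans (Ex_mono fun σ => ?_) this
  gcongr with κ _ κ' _
  · exact wt_nonneg hp _ _ _
  · exact wt_nonneg hp _ _ _
  refine ind_mono fun ⟨h1, h2⟩ => ?_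
  by_contra hc
  refine h2 (word_unique (R := {x, y}) (h := trip σ y κ' (trip σ x κ []))
    (Valid_trip (root_mem_seen _ (by simp)) (Valid_trip (root_mem_seen _ (by simp)) trivial))
    (Agree_trip (Agree_trip (by simp [Agree_nil]))) (by omega) (by simp) (by simp)
    ((InH_trip σ x κ []).mono (subset_trip σ y κ' _)) (InH_trip σ y κ' _) h1)

/-- The walk is typically self-avoiding. -/
lemma not_nodup_bound (hp : ∀ i j, 0 ≤ p i j) (hp1 : ∀ i, ∑ j, p i j ≤ 1)
    (T : ℕ) (hn : 2 * (T + 2) ^ 2 ≤ n) (x : Fin n) :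
    Ex (fun σ => ∑ κ ∈ words n T, wt p σ x κ * ind (¬ (tails σ x κ).Nodup)) ≤
      6 * (((T : ℝ) + 2) ^ 2 / n) := by
  have := coll_bound_one hp hp1 (R := {x}) (by simp) T 1 hn x
  rw [pow_one] at this
  refine le_trans (Ex_mono fun σ => ?_) this
  gcongr with κ _
  · exact wt_nonneg hp _ _ _
  refine ind_mono fun h1 => ?_
  by_contra hc
  apply h1
  have hu : ∀ κ₁ κ₁' r r', κ = κ₁ ++ r → κ = κ₁' ++ r' → run σ x κ₁ = run σ x κ₁' →
      κ₁ = κ₁' := by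
    intro κ₁ κ₁' r r' e e' hr
    have hI := InH_trip σ x κ []
    have h1 := hI
    have h2 := hI
    nth_rw 2 [e] at h1
    nth_rw 2 [e'] at h2
    exact (word_unique (R := {x}) (Valid_trip (h := []) (root_mem_seen _ (by simp)) trivial)
      (Agree_trip (by simp [Agree_nil])) (by omega) (by simp) (by simp)
      (InH_append.1 h1).1 (InH_append.1 h2).1 hr).2
  clear hc h1 this
  have gen : ∀ (pre κ₀ : List (Fin n)), κ = pre ++ κ₀ → (tails σ (run σ x pre) κ₀).Nodup := by
    intro pre κ₀
    induction κ₀ generalizing pre with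
    | nil => simp
    | cons k κ₀ ih =>
      intro e
      rw [tails_cons, List.nodup_cons]
      constructor
      · intro hm
        rw [mem_tails_iff] at hm
        obtain ⟨κ₁, k', κ₂, h1, h2⟩ := hm
        have h3 := hu (pre ++ k :: κ₁) pre (k' :: κ₂) (k :: κ₀) (by rw [e, h1]; simp) e
          (by rw [run_append, run_cons]; exact h2)
        simp at h3
      · have := ih (pre ++ [k]) (by rw [e]; simp)
        rwa [run_append] at this
  exact gen [] κ rfl

/-- Three distinct words of the same length rarely share an endpoint. -/
lemma three_words_bound (hp : ∀ i j, 0 ≤ p i j) (hp1 : ∀ i, ∑ j, p i j ≤ 1)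
    (T : ℕ) (hn : 2 * (3 * T + 2) ^ 2 ≤ n) (x : Fin n) :
    Ex (fun σ => ∑ κ ∈ words n T, wt p σ x κ * ∑ κ' ∈ words n T, wt p σ x κ' *
      ∑ κ'' ∈ words n T, wt p σ x κ'' *
      ind (run σ x κ = run σ x κ' ∧ run σ x κ = run σ x κ'' ∧ κ ≠ κ' ∧ κ ≠ κ'' ∧ κ' ≠ κ'')) ≤
      6 * ((3 * (T : ℝ) + 2) ^ 2 / n) ^ 2 := by
  have := coll_bound_three hp hp1 (R := {x}) (by simp) T 2 hn x
  refine le_trans (Ex_mono fun σ => ?_) this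
  gcongr with κ hκ κ' hκ' κ'' hκ''
  · exact wt_nonneg hp _ _ _
  · exact wt_nonneg hp _ _ _
  · exact wt_nonneg hp _ _ _
  refine ind_mono fun ⟨h1, h2, h3, h4, h5⟩ => ?_
  by_contra hc
  rw [mem_words] at hκ hκ' hκ''
  obtain ⟨a, b, hab, he⟩ := three_words (i := x) (σ := σ)
    (h := trip σ x κ'' (trip σ x κ' (trip σ x κ [])))
    (Valid_trip (root_mem_seen _ (by simp)) (Valid_trip (root_mem_seen _ (by simp))
      (Valid_trip (root_mem_seen _ (by simp)) trivial)))
    (Agree_trip (Agree_trip (Agree_trip (by simp [Agree_nil])))) (by omega)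
    (κ := ![κ, κ', κ'']) (u := T) (y := run σ x κ)
    (by intro a; fin_cases a <;> simp [hκ, hκ', hκ''])
    (by
      intro a
      fin_cases a
      · exact (InH_trip σ x κ []).mono fun e he =>
          subset_trip σ x κ'' _ _ (subset_trip σ x κ' _ _ he)
      · exact (InH_trip σ x κ' _).mono fun e he => subset_trip σ x κ'' _ _ he
      · exact InH_trip σ x κ'' _)
    (by intro a; fin_cases a <;> simp [← h1, ← h2])
  fin_cases a <;> fin_cases b <;> simp_all

end CollBounds

/-! ### Self-avoiding walks -/

lemma map_fst_trip (σ : Env n) (x : Fin n) (κ : List (Fin n)) (h : Hist n) :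
    (trip σ x κ h).map Prod.fst = (tails σ x κ).reverse ++ h.map Prod.fst := by
  induction κ generalizing x h with
  | nil => simp
  | cons k κ ih => simp [ih]

/-- Annealed weight of self-avoiding words from `x`, tested against `f` at the endpoint. -/
lemma sa_annealed {p : Fin n → Fin n → ℝ} (hp : ∀ i j, 0 ≤ p i j) {f : Fin n → ℝ}
    (hf : ∀ v, 0 ≤ f v) {T : ℕ} (hT : T + 1 < n) (x : Fin n) :
    Ex (fun σ => ∑ κ ∈ words n (T + 1), wt p σ x κ *
      (ind (tails σ x κ).Nodup * f (run σ x κ))) ≤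
    (∑ k, p x k) * (((∑ y, ∑ k, p y k) / n) * (n / ((n : ℝ) - (T + 1)))) ^ T *
      (n / ((n : ℝ) - (T + 1))) * ((∑ v, f v) / n) := by
  set C : ℝ := n / ((n : ℝ) - (T + 1)) with hC
  set a : ℝ := (∑ y, ∑ k, p y k) / n with ha
  set fb : ℝ := (∑ v, f v) / n with hfb
  have hTR : (T : ℝ) + 1 < n := by exact_mod_cast hT
  have hn0 : (0 : ℝ) < n := by have : (0 : ℝ) ≤ T := by positivity
                               linarith
  have hC0 : 0 ≤ C := div_nonneg hn0.le (by linarith)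
  have ha0 : 0 ≤ a := div_nonneg
    (Finset.sum_nonneg fun y _ => Finset.sum_nonneg fun k _ => hp y k) hn0.le
  have hfb0 : 0 ≤ fb := div_nonneg (Finset.sum_nonneg fun v _ => hf v) hn0.le
  have hrow : ∀ y, 0 ≤ ∑ k, p y k := fun y => Finset.sum_nonneg fun k _ => hp y k
  have key := annealed hp (Lmax := T + 1) hT.le
    (Ψ := fun m x h => match m with
      | 0 => ind (h.map Prod.fst).Nodup * f x
      | m + 1 => ind (x :: h.map Prod.fst).Nodup * ((∑ k, p x k) * (a * C) ^ m * C * fb))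
    (by
      rintro (_ | m) x h
      · exact mul_nonneg (ind_nonneg _) (hf _)
      · have := hrow x
        exact mul_nonneg (ind_nonneg _) (by positivity))
    (F := fun _ x h => ind (h.map Prod.fst).Nodup * f x)
    (by intro x h _; simp)
    (by
      intro m x h hl
      refine ⟨fun _ => ind (x :: h.map Prod.fst).Nodup * ((a * C) ^ m * C * fb), ?_, ?_, ?_⟩
      · intro k v hv
        have hx : x ∈ h.map Prod.fst := List.mem_map.2 ⟨_, hv, rfl⟩
        have h1 : ¬ (x :: h.map Prod.fst).Nodup := fun hn => (List.nodup_cons.1 hn).1 hx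
        rcases m with _ | m
        · simp only [List.map_cons]; rw [ind_not h1]; simp
        · have h2 : ¬ (v :: x :: h.map Prod.fst).Nodup := fun hn => h1 (List.nodup_cons.1 hn).2
          simp only [List.map_cons]; rw [ind_not h1, ind_not h2]; simp
      · intro k _
        have hle : (n : ℝ) ≤ ((n : ℝ) - h.length) * C := by
          have : (h.length : ℝ) ≤ T := by
            have : h.length ≤ T := by omega
            exact_mod_cast this
          rw [hC, mul_div_assoc', le_div_iff₀ (by linarith)]
          nlinarith
        rcases m with _ | m
        · simp only [List.map_cons, ← Finset.mul_sum, pow_zero, one_mul]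
          have e : ∑ v, f v = n * fb := by rw [hfb]; field_simp
          rw [e]
          calc ind (x :: h.map Prod.fst).Nodup * (n * fb)
              ≤ ind (x :: h.map Prod.fst).Nodup * ((((n : ℝ) - h.length) * C) * fb) := by
                have := ind_nonneg (x :: h.map Prod.fst).Nodup
                gcongr
            _ = _ := by ring
        · simp only [List.map_cons]
          calc ∑ v, ind (v :: x :: h.map Prod.fst).Nodup *
                ((∑ k, p v k) * (a * C) ^ m * C * fb)
              ≤ ∑ v, ind (x :: h.map Prod.fst).Nodup *
                ((∑ k, p v k) * (a * C) ^ m * C * fb) := by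
                refine Finset.sum_le_sum fun v _ => ?_
                have := hrow v
                exact mul_le_mul_of_nonneg_right
                  (ind_mono fun hn => (List.nodup_cons.1 hn).2) (by positivity)
            _ = ind (x :: h.map Prod.fst).Nodup * (n * (a * (a * C) ^ m * C * fb)) := by
                rw [← Finset.mul_sum]
                congr 1
                simp only [mul_assoc]
                rw [← Finset.sum_mul]
                have : ∑ y, ∑ k, p y k = n * a := by rw [ha]; field_simp
                rw [this]; ring
            _ ≤ ind (x :: h.map Prod.fst).Nodup *
                ((((n : ℝ) - h.length) * C) * (a * (a * C) ^ m * C * fb)) := by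
                have := ind_nonneg (x :: h.map Prod.fst).Nodup
                gcongr
            _ = _ := by ring
      · rw [← Finset.sum_mul]
        apply le_of_eq; ring)
    (T + 1) x [] (by simp)
  rw [Agree_nil, Finset.card_univ] at key
  rw [Ex, div_le_iff₀ card_env_pos]
  simp only [map_fst_trip, List.map_nil, List.append_nil, List.nodup_reverse] at key
  refine key.trans (le_of_eq ?_)
  rw [ind_of (by simp)]
  ring

lemma sa_product {p : Fin n → Fin n → ℝ} (hp : ∀ i j, 0 ≤ p i j) {T : ℕ} (hT : T < n) :
    Ex (fun σ => (∑ x, ∑ κ ∈ words n T, wt p σ x κ * ind (tails σ x κ).Nodup) / n) ≤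
    (((∑ y, ∑ k, p y k) / n) * (n / ((n : ℝ) - T))) ^ T := by
  have hn0 : (0 : ℝ) < n := by exact_mod_cast (by omega : 0 < n)
  rcases T with _ | T
  · have : ∀ σ : Env n, (∑ x, ∑ κ ∈ words n 0, wt p σ x κ * ind (tails σ x κ).Nodup) / (n : ℝ)
        = 1 := fun σ => by
      simp [sum_words_zero, ind_of, hn0.ne']
    simp [this, Ex_const]
  · simp only [div_eq_mul_inv _ (n : ℝ)]
    simp only [mul_comm _ (n : ℝ)⁻¹]
    rw [Ex_mul_left, Ex_sum]
    have := fun x => sa_annealed hp (f := fun _ => 1) (fun _ => zero_le_one) hT x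
    simp only [mul_one] at this
    refine (mul_le_mul_of_nonneg_left (Finset.sum_le_sum fun x _ => this x)
      (by positivity)).trans (le_of_eq ?_)
    rw [← Finset.sum_mul, ← Finset.sum_mul, ← Finset.sum_mul]
    simp only [Finset.sum_const, Finset.card_univ, Fintype.card_fin, nsmul_eq_mul, mul_one]
    push_cast
    rw [div_self hn0.ne', pow_succ]
    ring

lemma ratio_pow_le {L : ℕ} (hn : 2 * (L + 2) ^ 2 ≤ n) :
    ((n : ℝ) / ((n : ℝ) - L)) ^ L ≤ 6 := by
  refine le_trans ?_ (growth_le hn)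
  have hnR : 2 * ((L : ℝ) + 2) ^ 2 ≤ n := by exact_mod_cast hn
  have hL0 : (0 : ℝ) ≤ L := by positivity
  have hnL : (0 : ℝ) < n - L := by nlinarith
  have h1 : 0 ≤ (n : ℝ) / (n - L) := by positivity
  apply pow_le_pow_left₀ h1
  have : 0 ≤ 1 / ((L : ℝ) + 2) := by positivity
  nlinarith

/-- Annealed average over a uniform starting point, via self-avoiding words. -/
lemma avg_le_product {p p' : Fin n → Fin n → ℝ} (hp : ∀ i j, 0 ≤ p i j)
    (hp1 : ∀ i, ∑ j, p i j ≤ 1) (hp' : ∀ i j, 0 ≤ p' i j) {T : ℕ} (hn : 2 * (T + 2) ^ 2 ≤ n)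
    {f : Env n → Fin n → List (Fin n) → ℝ} {c : ℝ} (hc : 0 ≤ c)
    (h1 : ∀ σ x κ, f σ x κ ≤ wt p σ x κ)
    (h2 : ∀ σ x κ, κ.length = T → f σ x κ ≤ c * wt p' σ x κ) :
    Ex (fun σ => (∑ x, ∑ κ ∈ words n T, f σ x κ) / n) ≤
      6 * (((T : ℝ) + 2) ^ 2 / n) + 6 * c * ((∑ y, ∑ k, p' y k) / n) ^ T := by
  have hTn : T < n := by nlinarith
  have hn0 : (0 : ℝ) < n := by exact_mod_cast (by omega : 0 < n)
  have A := sa_product hp' hTn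
  have B : Ex (fun σ => (∑ x, ∑ κ ∈ words n T, wt p σ x κ * ind (¬ (tails σ x κ).Nodup)) / n) ≤
      6 * (((T : ℝ) + 2) ^ 2 / n) := by
    simp only [div_eq_mul_inv _ (n : ℝ)]
    simp only [mul_comm _ (n : ℝ)⁻¹]
    rw [Ex_mul_left, Ex_sum]
    refine (mul_le_mul_of_nonneg_left (Finset.sum_le_sum fun x _ =>
      not_nodup_bound hp hp1 T hn x) (by positivity)).trans (le_of_eq ?_)
    simp only [Finset.sum_const, Finset.card_univ, Fintype.card_fin, nsmul_eq_mul]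
    field_simp
  have hpt : ∀ σ : Env n, (∑ x, ∑ κ ∈ words n T, f σ x κ) / (n : ℝ) ≤
      (∑ x, ∑ κ ∈ words n T, wt p σ x κ * ind (¬ (tails σ x κ).Nodup)) / n +
      c * ((∑ x, ∑ κ ∈ words n T, wt p' σ x κ * ind (tails σ x κ).Nodup) / n) := by
    intro σ
    rw [mul_div_assoc', ← add_div, Finset.mul_sum, ← Finset.sum_add_distrib]
    refine div_le_div_of_nonneg_right (Finset.sum_le_sum fun x _ => ?_) hn0.le
    rw [Finset.mul_sum, ← Finset.sum_add_distrib]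
    refine Finset.sum_le_sum fun κ hκ => ?_
    by_cases hd : (tails σ x κ).Nodup
    · rw [ind_of hd, ind_not (not_not.2 hd)]
      simpa using h2 σ x κ (mem_words.1 hκ)
    · rw [ind_not hd, ind_of hd]
      simpa using h1 σ x κ
  refine (Ex_mono hpt).trans ?_
  rw [Ex_add, Ex_mul_left]
  refine add_le_add B ((mul_le_mul_of_nonneg_left A hc).trans ?_)
  rw [mul_pow]
  have h3 : 0 ≤ (∑ y, ∑ k, p' y k) / (n : ℝ) := div_nonneg
    (Finset.sum_nonneg fun y _ => Finset.sum_nonneg fun k _ => hp' y k) hn0.le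
  have h4 := ratio_pow_le hn
  calc c * (((∑ y, ∑ k, p' y k) / (n : ℝ)) ^ T * (n / ((n : ℝ) - T)) ^ T)
      ≤ c * (((∑ y, ∑ k, p' y k) / (n : ℝ)) ^ T * 6) := by gcongr
    _ = _ := by ring

/-! ### Truncation of small entries -/

/-- Kernel with the entries below `τ` removed. -/
noncomputable def trunc (τ : ℝ) (p : Fin n → Fin n → ℝ) (x k : Fin n) : ℝ :=
  if p x k < τ then 0 else p x k

lemma trunc_nonneg {p : Fin n → Fin n → ℝ} (hp : ∀ i j, 0 ≤ p i j) (τ : ℝ) (i j : Fin n) :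
    0 ≤ trunc τ p i j := by
  unfold trunc; split_ifs; exacts [le_rfl, hp _ _]

lemma trunc_le {p : Fin n → Fin n → ℝ} (hp : ∀ i j, 0 ≤ p i j) (τ : ℝ) (i j : Fin n) :
    trunc τ p i j ≤ p i j := by
  unfold trunc; split_ifs; exacts [hp _ _, le_rfl]

lemma wt_trunc (τ : ℝ) (p : Fin n → Fin n → ℝ) (σ : Env n) (x : Fin n) (κ : List (Fin n)) :
    wt (trunc τ p) σ x κ = 0 ∨ wt (trunc τ p) σ x κ = wt p σ x κ := by
  induction κ generalizing x with
  | nil => simp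
  | cons k κ ih =>
    simp only [wt_cons]
    by_cases h : p x k < τ
    · simp [trunc, h]
    · rcases ih (σ x k) with h' | h'
      · simp [h']
      · right; rw [h']; simp [trunc, h]

lemma le_sum_wt {p : Fin n → Fin n → ℝ} (hp : ∀ i j, 0 ≤ p i j) {γ : ℝ}
    (hγ1 : γ ≤ 1) (hγ : ∀ x, 1 - γ ≤ ∑ k, p x k) (σ : Env n) (x : Fin n)
    (T : ℕ) : (1 - γ) ^ T ≤ ∑ κ ∈ words n T, wt p σ x κ := by
  induction T generalizing x with
  | zero => simp [sum_words_zero]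
  | succ T ih =>
    rw [sum_words_succ]
    simp only [wt_cons, ← Finset.mul_sum]
    calc (1 - γ) ^ (T + 1) = (1 - γ) * (1 - γ) ^ T := by ring
      _ ≤ (∑ k, p x k) * (1 - γ) ^ T := by
          have : 0 ≤ 1 - γ := by linarith
          have := hγ x
          gcongr
      _ ≤ _ := by
          rw [Finset.sum_mul]
          exact Finset.sum_le_sum fun k _ => mul_le_mul_of_nonneg_left (ih _) (hp _ _)

/-- The walk makes no small step except with small probability. -/
lemma trunc_loss {p : Fin n → Fin n → ℝ} (hp : ∀ i j, 0 ≤ p i j) {γ τ : ℝ}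
    (hγ1 : γ ≤ 1) (hγ : ∀ x, 1 - γ ≤ ∑ k, trunc τ p x k) (σ : Env n) (x : Fin n)
    (T : ℕ) : 1 - T * γ ≤ ∑ κ ∈ words n T, wt (trunc τ p) σ x κ := by
  refine le_trans ?_ (le_sum_wt (trunc_nonneg hp τ) hγ1 hγ σ x T)
  have := one_add_mul_le_pow (a := -γ) (by linarith) T
  rw [← sub_eq_add_neg] at this
  linarith

/-! ### Second moments -/

lemma wt_sq (p : Fin n → Fin n → ℝ) (σ : Env n) (x : Fin n) (κ : List (Fin n)) :
    wt (fun i j => p i j ^ 2) σ x κ = wt p σ x κ ^ 2 := by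
  induction κ generalizing x with
  | nil => simp
  | cons k κ ih => simp [ih, mul_pow]

lemma kern_mul_kern (p : Fin n → Fin n → ℝ) (σ : Env n) (T : ℕ) (x y : Fin n) :
    ∑ j, kern p σ T x j * kern p σ T y j =
      ∑ κ ∈ words n T, wt p σ x κ * ∑ κ' ∈ words n T, wt p σ y κ' *
        ind (run σ x κ = run σ y κ') := by
  have : ∀ κ, ∑ κ' ∈ words n T, wt p σ y κ' * ind (run σ x κ = run σ y κ') =
      kern p σ T y (run σ x κ) := by
    intro κ
    unfold kern ind
    refine Finset.sum_congr rfl fun κ' _ => ?_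
    simp only [mul_ite, mul_one, mul_zero, eq_comm]
  simp only [this]
  rw [sum_wt_mul_run p σ T x (fun j => kern p σ T y j)]

/-- Annealed return estimate from a uniform starting point. -/
lemma kern_sq_bound {p : Fin n → Fin n → ℝ} (hp : ∀ i j, 0 ≤ p i j)
    (hp1 : ∀ i, ∑ j, p i j ≤ 1) {h : ℕ} (hn : 2 * (h + h + 2) ^ 2 ≤ n) :
    Ex (fun σ => (∑ y, ∑ j, kern p σ h y j ^ 2) / n) ≤
      12 * (((h : ℝ) + h + 2) ^ 2 / n) + 6 * ((∑ y, ∑ k, p y k ^ 2) / n) ^ h := by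
  have hn0 : (0 : ℝ) < n := by exact_mod_cast lt_of_lt_of_le (by positivity) hn
  have hn' : 2 * (h + 2) ^ 2 ≤ n := le_trans (by gcongr; omega) hn
  have hle1 : ∀ i j, p i j ≤ 1 := fun i j =>
    (Finset.single_le_sum (fun j _ => hp i j) (Finset.mem_univ j)).trans (hp1 i)
  have A := avg_le_product (f := fun σ x κ => wt p σ x κ ^ 2) (c := 1) hp hp1
    (fun i j => sq_nonneg (p i j)) hn' zero_le_one
    (fun σ x κ => by
      have h0 := wt_nonneg hp σ x κ
      have h1 := wt_le_one hp hle1 σ x κ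
      nlinarith)
    (fun σ x κ _ => by rw [wt_sq, one_mul])
  have B : Ex (fun σ => (n : ℝ)⁻¹ * ∑ y, ∑ κ ∈ words n h, wt p σ y κ *
      ∑ κ' ∈ words n h, wt p σ y κ' * ind (run σ y κ = run σ y κ' ∧ ¬ (y = y ∧ κ = κ'))) ≤
      6 * (((h : ℝ) + h + 2) ^ 2 / n) := by
    rw [Ex_mul_left, Ex_sum]
    refine (mul_le_mul_of_nonneg_left (Finset.sum_le_sum fun x _ =>
      two_words_bound hp hp1 h h hn x x) (by positivity)).trans (le_of_eq ?_)
    simp only [Finset.sum_const, Finset.card_univ, Fintype.card_fin, nsmul_eq_mul]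
    field_simp
  have hpt : ∀ σ : Env n, (∑ y, ∑ j, kern p σ h y j ^ 2) / (n : ℝ) ≤
      (∑ y, ∑ κ ∈ words n h, wt p σ y κ ^ 2) / n + (n : ℝ)⁻¹ * ∑ y, ∑ κ ∈ words n h, wt p σ y κ *
      ∑ κ' ∈ words n h, wt p σ y κ' * ind (run σ y κ = run σ y κ' ∧ ¬ (y = y ∧ κ = κ')) := by
    intro σ
    rw [inv_mul_eq_div, ← add_div, ← Finset.sum_add_distrib]
    refine div_le_div_of_nonneg_right (Finset.sum_le_sum fun y _ => ?_) hn0.le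
    simp only [sq]
    rw [kern_mul_kern, ← Finset.sum_add_distrib]
    refine Finset.sum_le_sum fun κ hκ => ?_
    rw [← mul_add]
    refine mul_le_mul_of_nonneg_left ?_ (wt_nonneg hp _ _ _)
    rw [← Finset.add_sum_erase _ _ hκ]
    refine add_le_add ?_ ?_
    · exact mul_le_of_le_one_right (wt_nonneg hp _ _ _) (ind_le_one _)
    · refine le_trans (Finset.sum_le_sum fun κ' hκ' => ?_)
        (Finset.sum_le_sum_of_subset_of_nonneg (Finset.erase_subset κ _) fun κ' _ _ =>
          mul_nonneg (wt_nonneg hp _ _ _) (ind_nonneg _))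
      refine mul_le_mul_of_nonneg_left (ind_mono fun hr => ⟨hr, fun hh => ?_⟩) (wt_nonneg hp _ _ _)
      exact (Finset.mem_erase.1 hκ').1 hh.2.symm
  refine (Ex_mono hpt).trans ?_
  rw [Ex_add]
  have hh : 6 * (((h : ℝ) + 2) ^ 2 / n) ≤ 6 * (((h : ℝ) + h + 2) ^ 2 / n) := by
    gcongr; linarith [Nat.cast_nonneg (α := ℝ) h]
  linarith

/-- Law at time `s` from the uniform distribution. -/
noncomputable def unif (p : Fin n → Fin n → ℝ) (σ : Env n) (s : ℕ) (j : Fin n) : ℝ :=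
  (∑ y, kern p σ s y j) / n

lemma unif_nonneg {p : Fin n → Fin n → ℝ} (hp : ∀ i j, 0 ≤ p i j) (σ : Env n) (s : ℕ)
    (j : Fin n) : 0 ≤ unif p σ s j :=
  div_nonneg (Finset.sum_nonneg fun y _ => kern_nonneg hp σ s y j) (by positivity)

lemma unif_sq_bound {p : Fin n → Fin n → ℝ} (hp : ∀ i j, 0 ≤ p i j)
    (hp1 : ∀ i, ∑ j, p i j ≤ 1) {s : ℕ} (hn : 2 * (s + s + 2) ^ 2 ≤ n) :
    Ex (fun σ => ∑ j, unif p σ s j ^ 2) ≤ 6 * (((s : ℝ) + s + 2) ^ 2 / n) + 1 / n := by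
  have hn0 : (0 : ℝ) < n := by exact_mod_cast lt_of_lt_of_le (by positivity) hn
  set b : ℝ := 6 * (((s : ℝ) + s + 2) ^ 2 / n) with hb
  have hb0 : 0 ≤ b := by positivity
  have e : ∀ σ : Env n, ∑ j, unif p σ s j ^ 2 =
      ((n : ℝ) ^ 2)⁻¹ * ∑ x, ∑ y, ∑ j, kern p σ s x j * kern p σ s y j := by
    intro σ
    simp only [unif, div_pow, sq (∑ y, kern p σ s y _), Finset.sum_mul_sum]
    rw [← Finset.sum_div, div_eq_inv_mul, Finset.sum_comm]
    congr 1
    exact Finset.sum_congr rfl fun x _ => Finset.sum_comm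
  simp only [e]
  rw [Ex_mul_left, Ex_sum]
  have h1 : ∀ x y, Ex (fun σ => ∑ j, kern p σ s x j * kern p σ s y j) ≤
      b + if x = y then 1 else 0 := by
    intro x y
    by_cases hxy : x = y
    · subst hxy
      rw [if_pos rfl]
      refine le_trans (Ex_mono (g := fun _ => 1) fun σ => ?_) ?_
      · rw [kern_mul_kern]
        refine le_trans (Finset.sum_le_sum fun κ _ => mul_le_of_le_one_right
          (wt_nonneg hp _ _ _) ?_) (sum_wt_le_one hp hp1 σ x s)
        exact le_trans (Finset.sum_le_sum fun κ' _ => mul_le_of_le_one_right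
          (wt_nonneg hp _ _ _) (ind_le_one _)) (sum_wt_le_one hp hp1 σ x s)
      · rw [Ex_const]; linarith
    · rw [if_neg hxy, add_zero]
      refine le_trans (Ex_mono fun σ => ?_) (two_words_bound hp hp1 s s hn x y)
      rw [kern_mul_kern]
      gcongr with κ _ κ' _
      · exact wt_nonneg hp _ _ _
      · exact wt_nonneg hp _ _ _
      · exact ind_mono fun hr => ⟨hr, fun hh => hxy hh.1⟩
  calc ((n : ℝ) ^ 2)⁻¹ * ∑ x, Ex (fun σ => ∑ y, ∑ j, kern p σ s x j * kern p σ s y j)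
      ≤ ((n : ℝ) ^ 2)⁻¹ * ∑ x : Fin n, ∑ y : Fin n, (b + if x = y then 1 else 0) := by
        gcongr with x _
        rw [Ex_sum]
        exact Finset.sum_le_sum fun y _ => h1 x y
    _ = b + 1 / n := by
        simp [Finset.sum_add_distrib]
        field_simp

/-- Second moment of the endpoint distribution of light words. -/
lemma light_sq_bound {p : Fin n → Fin n → ℝ} (hp : ∀ i j, 0 ≤ p i j)
    (hp1 : ∀ i, ∑ j, p i j ≤ 1) {s : ℕ} (hn : 2 * (s + s + 2) ^ 2 ≤ n) {θ : ℝ} (hθ : 0 ≤ θ)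
    (x : Fin n) :
    Ex (fun σ => ∑ j, (∑ κ ∈ words n s, if run σ x κ = j ∧ wt p σ x κ ≤ θ
      then wt p σ x κ else 0) ^ 2) ≤ 6 * (((s : ℝ) + s + 2) ^ 2 / n) + θ := by
  have hpt : ∀ σ : Env n, ∑ j, (∑ κ ∈ words n s, if run σ x κ = j ∧ wt p σ x κ ≤ θ
      then wt p σ x κ else 0) ^ 2 ≤ (∑ κ ∈ words n s, wt p σ x κ *
      ∑ κ' ∈ words n s, wt p σ x κ' * ind (run σ x κ = run σ x κ' ∧ ¬ (x = x ∧ κ = κ'))) + θ := by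
    intro σ
    have e : ∑ j, (∑ κ ∈ words n s, if run σ x κ = j ∧ wt p σ x κ ≤ θ
        then wt p σ x κ else 0) ^ 2 = ∑ κ ∈ words n s, ∑ κ' ∈ words n s,
        ∑ j, (if run σ x κ = j ∧ wt p σ x κ ≤ θ then wt p σ x κ else 0) *
          (if run σ x κ' = j ∧ wt p σ x κ' ≤ θ then wt p σ x κ' else 0) := by
      simp only [sq, Finset.sum_mul_sum]
      rw [Finset.sum_comm]
      exact Finset.sum_congr rfl fun κ _ => Finset.sum_comm
    have e2 : ∀ κ κ', ∑ j, (if run σ x κ = j ∧ wt p σ x κ ≤ θ then wt p σ x κ else 0) *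
          (if run σ x κ' = j ∧ wt p σ x κ' ≤ θ then wt p σ x κ' else 0) =
          if run σ x κ = run σ x κ' ∧ wt p σ x κ ≤ θ ∧ wt p σ x κ' ≤ θ
          then wt p σ x κ * wt p σ x κ' else 0 := by
      intro κ κ'
      rw [Finset.sum_eq_single (run σ x κ)]
      · by_cases h1 : wt p σ x κ ≤ θ <;> by_cases h2 : wt p σ x κ' ≤ θ <;>
          by_cases h3 : run σ x κ = run σ x κ' <;> simp [h1, h2, h3, eq_comm]
      · intro j _ hj
        simp [Ne.symm hj]
      · simp
    rw [e, Finset.sum_congr rfl fun κ _ => Finset.sum_congr rfl fun κ' _ => e2 κ κ']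
    calc ∑ κ ∈ words n s, ∑ κ' ∈ words n s,
          (if run σ x κ = run σ x κ' ∧ wt p σ x κ ≤ θ ∧ wt p σ x κ' ≤ θ
          then wt p σ x κ * wt p σ x κ' else 0)
        ≤ ∑ κ ∈ words n s, (wt p σ x κ * (∑ κ' ∈ words n s, wt p σ x κ' *
          ind (run σ x κ = run σ x κ' ∧ ¬ (x = x ∧ κ = κ'))) + wt p σ x κ * θ) := by
          refine Finset.sum_le_sum fun κ hκ => ?_
          have h0 := wt_nonneg hp σ x κ
          rw [← Finset.add_sum_erase _ _ hκ, add_comm]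
          refine add_le_add ?_ ?_
          · rw [Finset.mul_sum]
            refine le_trans (Finset.sum_le_sum fun κ' hκ' => ?_)
              (Finset.sum_le_sum_of_subset_of_nonneg (Finset.erase_subset κ _) fun κ' _ _ =>
                mul_nonneg h0 (mul_nonneg (wt_nonneg hp _ _ _) (ind_nonneg _)))
            have hne : κ ≠ κ' := (Finset.mem_erase.1 hκ').1.symm
            have h0' := wt_nonneg hp σ x κ'
            split_ifs with hc
            · rw [ind_of ⟨hc.1, fun hh => hne hh.2⟩, mul_one]
            · exact mul_nonneg h0 (mul_nonneg h0' (ind_nonneg _))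
          · split_ifs with hc
            · exact mul_le_mul_of_nonneg_left hc.2.1 h0
            · positivity
      _ ≤ _ := by
          rw [Finset.sum_add_distrib, ← Finset.sum_mul]
          have := sum_wt_le_one hp hp1 σ x s
          exact add_le_add le_rfl (mul_le_of_le_one_left hθ this)
  refine (Ex_mono hpt).trans ?_
  rw [Ex_add, Ex_const]
  have := two_words_bound hp hp1 s s hn x x
  linarith

/-! ### Exponential tilting and concentration of log-weights -/

/-- Exponentially tilted kernel. -/
noncomputable def tilt (α : ℝ) (p : Fin n → Fin n → ℝ) (x k : Fin n) : ℝ :=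
  p x k * Real.exp (α * Real.log (p x k))

lemma tilt_nonneg {p : Fin n → Fin n → ℝ} (hp : ∀ i j, 0 ≤ p i j) (α : ℝ) (i j : Fin n) :
    0 ≤ tilt α p i j := mul_nonneg (hp _ _) (Real.exp_pos _).le

lemma wt_tilt (α : ℝ) (p : Fin n → Fin n → ℝ) (σ : Env n) (x : Fin n) (κ : List (Fin n)) :
    wt (tilt α p) σ x κ = wt p σ x κ * Real.exp (α * Real.log (wt p σ x κ)) := by
  induction κ generalizing x with
  | nil => simp
  | cons k κ ih =>
    simp only [wt_cons, ih, tilt]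
    by_cases h1 : p x k = 0
    · simp [h1]
    by_cases h2 : wt p σ (σ x k) κ = 0
    · simp [h2]
    rw [Real.log_mul h1 h2, mul_add, Real.exp_add]
    ring

lemma exp_neg_le_quadratic {u : ℝ} (hu : 0 ≤ u) : Real.exp (-u) ≤ 1 - u + u ^ 2 := by
  have h1 : 1 + u ≤ Real.exp u := by linarith [Real.add_one_le_exp u]
  rw [Real.exp_neg]
  refine (inv_anti₀ (by linarith) h1).trans ?_
  rw [inv_le_iff_one_le_mul₀ (by linarith)]
  nlinarith [pow_nonneg hu 3]

lemma exp_le_quadratic {u : ℝ} (hu : |u| ≤ 1) : Real.exp u ≤ 1 + u + u ^ 2 := by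
  have := (abs_le.1 (Real.abs_exp_sub_one_sub_id_le hu)).2
  linarith

lemma entropy_avg (p : Fin n → Fin n → ℝ) :
    (∑ x, ∑ k, p x k * Real.log (p x k)) / n = - avgEntropy n p := by
  unfold avgEntropy; ring

lemma log_nonpos_of {p : Fin n → Fin n → ℝ} (hp : ∀ i j, 0 ≤ p i j)
    (hp1 : ∀ i, ∑ j, p i j ≤ 1) (i j : Fin n) : Real.log (p i j) ≤ 0 :=
  Real.log_nonpos (hp i j) ((Finset.single_le_sum (fun j _ => hp i j)
    (Finset.mem_univ j)).trans (hp1 i))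

/-- A quadratic bound on the entries of a tilted kernel bounds its mean row sum. -/
lemma avg_tilt_le {p p' : Fin n → Fin n → ℝ} (hn : 0 < n) (hp1 : ∀ i, ∑ j, p i j ≤ 1)
    {α Q : ℝ} (hQ : ∀ i, ∑ j, p i j * Real.log (p i j) ^ 2 ≤ Q)
    (h : ∀ x k, p' x k ≤ p x k * (1 + α * Real.log (p x k) + (α * Real.log (p x k)) ^ 2)) :
    (∑ x, ∑ k, p' x k) / n ≤ Real.exp (-α * avgEntropy n p + α ^ 2 * Q) := by
  have hn0 : (0 : ℝ) < n := by exact_mod_cast hn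
  have h1 : ∑ x, ∑ k, p' x k ≤ ∑ x : Fin n, (1 + α * ∑ k, p x k * Real.log (p x k) + α ^ 2 * Q) := by
    refine Finset.sum_le_sum fun x _ => (Finset.sum_le_sum fun k _ => h x k).trans ?_
    have e : ∑ k, p x k * (1 + α * Real.log (p x k) + (α * Real.log (p x k)) ^ 2) =
        ∑ k, p x k + α * ∑ k, p x k * Real.log (p x k) +
        α ^ 2 * ∑ k, p x k * Real.log (p x k) ^ 2 := by
      rw [Finset.mul_sum, Finset.mul_sum, ← Finset.sum_add_distrib, ← Finset.sum_add_distrib]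
      exact Finset.sum_congr rfl fun k _ => by ring
    rw [e]
    have := mul_le_mul_of_nonneg_left (hQ x) (sq_nonneg α)
    linarith [hp1 x]
  have h2 : ∑ x : Fin n, (1 + α * ∑ k, p x k * Real.log (p x k) + α ^ 2 * Q) =
      n * (1 + -α * avgEntropy n p + α ^ 2 * Q) := by
    rw [Finset.sum_add_distrib, Finset.sum_add_distrib, ← Finset.mul_sum]
    simp only [Finset.sum_const, Finset.card_univ, Fintype.card_fin, nsmul_eq_mul, mul_one]
    have := entropy_avg p
    rw [div_eq_iff hn0.ne'] at this
    rw [this]; ring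
  rw [div_le_iff₀ hn0]
  rw [h2] at h1
  refine h1.trans ?_
  rw [mul_comm]
  have := Real.add_one_le_exp (-α * avgEntropy n p + α ^ 2 * Q)
  exact mul_le_mul_of_nonneg_right (by linarith) hn0.le

/-- Mass of the words of length `T` whose weight is below `θ`. -/
noncomputable def lightMass (p : Fin n → Fin n → ℝ) (θ : ℝ) (T : ℕ) (σ : Env n) (x : Fin n) : ℝ :=
  ∑ κ ∈ words n T, if wt p σ x κ < θ then wt p σ x κ else 0

/-- Mass of the words of length `T` whose weight is at least `θ`. -/
noncomputable def heavyMass (p : Fin n → Fin n → ℝ) (θ : ℝ) (T : ℕ) (σ : Env n) (x : Fin n) : ℝ :=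
  ∑ κ ∈ words n T, if θ ≤ wt p σ x κ then wt p σ x κ else 0

lemma lightMass_nonneg {p : Fin n → Fin n → ℝ} (hp : ∀ i j, 0 ≤ p i j) (θ : ℝ) (T : ℕ)
    (σ : Env n) (x : Fin n) : 0 ≤ lightMass p θ T σ x :=
  Finset.sum_nonneg fun κ _ => by split_ifs; exacts [wt_nonneg hp _ _ _, le_rfl]

lemma heavyMass_nonneg {p : Fin n → Fin n → ℝ} (hp : ∀ i j, 0 ≤ p i j) (θ : ℝ) (T : ℕ)
    (σ : Env n) (x : Fin n) : 0 ≤ heavyMass p θ T σ x :=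
  Finset.sum_nonneg fun κ _ => by split_ifs; exacts [wt_nonneg hp _ _ _, le_rfl]

lemma heavyMass_add_lightMass (p : Fin n → Fin n → ℝ) (θ : ℝ) (T : ℕ)
    (σ : Env n) (x : Fin n) :
    heavyMass p θ T σ x + lightMass p θ T σ x = ∑ κ ∈ words n T, wt p σ x κ := by
  unfold heavyMass lightMass
  rw [← Finset.sum_add_distrib]
  refine Finset.sum_congr rfl fun κ _ => ?_
  by_cases h : θ ≤ wt p σ x κ
  · simp [h, not_lt.2 h]
  · simp [h, not_le.1 h]

/-- Heavy mass decreases with the length. -/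
lemma heavyMass_add_le {p : Fin n → Fin n → ℝ} (hp : ∀ i j, 0 ≤ p i j)
    (hp1 : ∀ i, ∑ j, p i j ≤ 1) (θ : ℝ) (T U : ℕ) (σ : Env n) (x : Fin n) :
    heavyMass p θ (T + U) σ x ≤ heavyMass p θ T σ x := by
  have hle1 : ∀ i j, p i j ≤ 1 := fun i j =>
    (Finset.single_le_sum (fun j _ => hp i j) (Finset.mem_univ j)).trans (hp1 i)
  unfold heavyMass
  rw [sum_words_add]
  refine Finset.sum_le_sum fun κ _ => ?_
  by_cases h : θ ≤ wt p σ x κ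
  · rw [if_pos h]
    calc _ ≤ ∑ κ' ∈ words n U, wt p σ x κ * wt p σ (run σ x κ) κ' := by
          refine Finset.sum_le_sum fun κ' _ => ?_
          rw [wt_append]
          split_ifs
          exacts [le_rfl, mul_nonneg (wt_nonneg hp _ _ _) (wt_nonneg hp _ _ _)]
      _ ≤ _ := by
          rw [← Finset.mul_sum]
          exact mul_le_of_le_one_right (wt_nonneg hp _ _ _) (sum_wt_le_one hp hp1 _ _ _)
  · rw [if_neg h]
    refine (Finset.sum_eq_zero fun κ' _ => if_neg fun h' => h (h'.trans ?_)).le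
    rw [wt_append]
    exact mul_le_of_le_one_right (wt_nonneg hp _ _ _) (wt_le_one hp hle1 _ _ _)

lemma lln_heavy {p : Fin n → Fin n → ℝ} (hp : ∀ i j, 0 ≤ p i j)
    (hp1 : ∀ i, ∑ j, p i j ≤ 1) {T : ℕ} (hn : 2 * (T + 2) ^ 2 ≤ n) {α Q θ : ℝ}
    (hα : 0 ≤ α) (hθ : 0 < θ) (hQ : ∀ i, ∑ j, p i j * Real.log (p i j) ^ 2 ≤ Q) :
    Ex (fun σ => (∑ x, heavyMass p θ T σ x) / n) ≤
      6 * (((T : ℝ) + 2) ^ 2 / n) +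
      6 * Real.exp (-α * Real.log θ + T * (-α * avgEntropy n p + α ^ 2 * Q)) := by
  have hn0 : 0 < n := lt_of_lt_of_le (by positivity) hn
  refine (avg_le_product (p' := tilt α p) (c := Real.exp (-α * Real.log θ)) hp hp1
    (tilt_nonneg hp α) hn (Real.exp_pos _).le (fun σ x κ => ?_) fun σ x κ _ => ?_).trans ?_
  · split_ifs
    exacts [le_rfl, wt_nonneg hp _ _ _]
  · rw [wt_tilt]
    have h0 := wt_nonneg hp σ x κ
    split_ifs with h
    · have hl := Real.log_le_log hθ h
      have : 1 ≤ Real.exp (-α * Real.log θ) * Real.exp (α * Real.log (wt p σ x κ)) := by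
        rw [← Real.exp_add]
        exact Real.one_le_exp (by nlinarith)
      nlinarith
    · positivity
  · have h1 : (∑ y, ∑ k, tilt α p y k) / n ≤ Real.exp (-α * avgEntropy n p + α ^ 2 * Q) := by
      refine avg_tilt_le hn0 hp1 hQ fun x k => ?_
      refine mul_le_mul_of_nonneg_left ?_ (hp x k)
      have h2 := log_nonpos_of hp hp1 x k
      have := exp_neg_le_quadratic (u := -(α * Real.log (p x k))) (by nlinarith)
      simpa using this
    have h3 : 0 ≤ (∑ y, ∑ k, tilt α p y k) / n := div_nonneg
      (Finset.sum_nonneg fun y _ => Finset.sum_nonneg fun k _ => tilt_nonneg hp α y k)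
      (by positivity)
    rw [Real.exp_add, Real.exp_nat_mul, ← mul_assoc]
    gcongr

/-- Mass of the entries below `exp (-1/α)` in a row. -/
lemma row_trunc_loss {p : Fin n → Fin n → ℝ} (hp : ∀ i j, 0 ≤ p i j) {τ : ℝ} (hτ : 0 < τ)
    (hτ1 : τ < 1) {Q : ℝ} (x : Fin n) (hrow : ∑ j, p x j = 1)
    (hQ : ∑ j, p x j * Real.log (p x j) ^ 2 ≤ Q) :
    1 - Q / Real.log τ ^ 2 ≤ ∑ k, trunc τ p x k := by
  have hl : Real.log τ < 0 := Real.log_neg hτ hτ1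
  have h1 : ∑ k, (p x k - trunc τ p x k) ≤ ∑ k, p x k * Real.log (p x k) ^ 2 / Real.log τ ^ 2 := by
    refine Finset.sum_le_sum fun k _ => ?_
    have h0 := hp x k
    unfold trunc
    split_ifs with h
    · rw [sub_zero, le_div_iff₀ (sq_pos_of_neg hl)]
      rcases h0.eq_or_lt with h' | h'
      · simp [← h']
      have := Real.log_lt_log h' h
      exact mul_le_mul_of_nonneg_left (by nlinarith) h0
    · rw [sub_self]; positivity
  rw [Finset.sum_sub_distrib, hrow, ← Finset.sum_div] at h1
  have : (∑ k, p x k * Real.log (p x k) ^ 2) / Real.log τ ^ 2 ≤ Q / Real.log τ ^ 2 := by gcongr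
  linarith

lemma lln_light {p : Fin n → Fin n → ℝ} (hp : ∀ i j, 0 ≤ p i j)
    (hrow : ∀ i, ∑ j, p i j = 1) {T : ℕ} (hn : 2 * (T + 2) ^ 2 ≤ n) {α Q θ : ℝ}
    (hα : 0 < α) (hQ : ∀ i, ∑ j, p i j * Real.log (p i j) ^ 2 ≤ Q)
    (hQ1 : α ^ 2 * Q ≤ 1) :
    Ex (fun σ => (∑ x, lightMass p θ T σ x) / n) ≤
      6 * (((T : ℝ) + 2) ^ 2 / n) +
      6 * Real.exp (α * Real.log θ + T * (α * avgEntropy n p + α ^ 2 * Q)) +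
      T * (α ^ 2 * Q) := by
  have hn0 : 0 < n := lt_of_lt_of_le (by positivity) hn
  have hnR : (0 : ℝ) < n := by exact_mod_cast hn0
  have hp1 : ∀ i, ∑ j, p i j ≤ 1 := fun i => (hrow i).le
  have hle1 : ∀ i j, p i j ≤ 1 := fun i j =>
    (Finset.single_le_sum (fun j _ => hp i j) (Finset.mem_univ j)).trans (hp1 i)
  set τ : ℝ := Real.exp (-α⁻¹) with hτ
  have hlτ : Real.log τ = -α⁻¹ := Real.log_exp _
  have hτ0 : 0 < τ := Real.exp_pos _
  have hτ1 : τ < 1 := Real.exp_lt_one_iff.2 (by have := inv_pos.2 hα; linarith)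
  have hp't := trunc_nonneg hp τ
  have hloss := fun σ x => trunc_loss (γ := α ^ 2 * Q) (τ := τ) hp hQ1 (fun x => by
    have := row_trunc_loss hp hτ0 hτ1 x (hrow x) (hQ x)
    rw [hlτ] at this
    convert this using 2
    field_simp) σ x T
  set f : Env n → Fin n → List (Fin n) → ℝ := fun σ x κ =>
    if wt p σ x κ < θ then wt (trunc τ p) σ x κ else 0 with hf
  have key := avg_le_product (f := f) (p' := tilt (-α) (trunc τ p))
    (c := Real.exp (α * Real.log θ)) hp hp1
    (tilt_nonneg hp't _) hn (Real.exp_pos _).le (fun σ x κ => by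
      simp only [hf]
      split_ifs
      · exact wt_mono hp't (trunc_le hp τ) σ x κ
      · exact wt_nonneg hp _ _ _) (fun σ x κ _ => by
      rw [wt_tilt]
      have h0 := wt_nonneg hp't σ x κ
      simp only [hf]
      split_ifs with h
      · rcases h0.eq_or_lt with h' | h'
        · simp [← h']
        have he : wt (trunc τ p) σ x κ = wt p σ x κ := by
          rcases wt_trunc τ p σ x κ with h'' | h''
          · linarith
          · exact h''
        have hl := Real.log_lt_log (he ▸ h') h
        have : 1 ≤ Real.exp (α * Real.log θ) * Real.exp (-α * Real.log (wt (trunc τ p) σ x κ)) := by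
          rw [← Real.exp_add, he]
          exact Real.one_le_exp (by nlinarith)
        nlinarith
      · positivity)
  have h1 : (∑ y, ∑ k, tilt (-α) (trunc τ p) y k) / n ≤
      Real.exp (-(-α) * avgEntropy n p + (-α) ^ 2 * Q) := by
    refine avg_tilt_le hn0 hp1 hQ fun x k => ?_
    unfold tilt trunc
    have h0 := hp x k
    have h2 := log_nonpos_of hp hp1 x k
    split_ifs with h
    · rw [zero_mul]
      refine mul_nonneg h0 ?_
      nlinarith [sq_nonneg (-α * Real.log (p x k))]
    · refine mul_le_mul_of_nonneg_left (exp_le_quadratic ?_) h0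
      have h3 := Real.log_le_log hτ0 (not_lt.1 h)
      rw [hlτ] at h3
      rw [abs_le]
      have h4 : α * α⁻¹ = 1 := mul_inv_cancel₀ hα.ne'
      constructor <;> nlinarith
  have h3 : 0 ≤ (∑ y, ∑ k, tilt (-α) (trunc τ p) y k) / n := div_nonneg
      (Finset.sum_nonneg fun y _ => Finset.sum_nonneg fun k _ => tilt_nonneg hp't _ y k)
      (by positivity)
  have hpt : ∀ σ : Env n, (∑ x, lightMass p θ T σ x) / n ≤
      (∑ x, ∑ κ ∈ words n T, f σ x κ) / n + T * (α ^ 2 * Q) := by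
    intro σ
    rw [div_add' _ _ _ hnR.ne']
    refine div_le_div_of_nonneg_right ?_ hnR.le
    have : ((T : ℝ) * (α ^ 2 * Q)) * n = ∑ x : Fin n, (T : ℝ) * (α ^ 2 * Q) := by
      simp [mul_comm]
    rw [this, ← Finset.sum_add_distrib]
    refine Finset.sum_le_sum fun x _ => ?_
    have h4 := hloss σ x
    have h5 := sum_wt_eq_one hrow σ x T
    have h6 : lightMass p θ T σ x ≤ ∑ κ ∈ words n T, f σ x κ +
        ∑ κ ∈ words n T, (wt p σ x κ - wt (trunc τ p) σ x κ) := by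
      unfold lightMass
      rw [← Finset.sum_add_distrib]
      refine Finset.sum_le_sum fun κ _ => ?_
      have := wt_mono hp't (trunc_le hp τ) σ x κ
      simp only [hf]
      split_ifs <;> linarith
    rw [Finset.sum_sub_distrib, h5] at h6
    linarith
  refine (Ex_mono hpt).trans ?_
  rw [Ex_add, Ex_const]
  refine add_le_add (key.trans (add_le_add le_rfl ?_)) le_rfl
  rw [Real.exp_add, Real.exp_nat_mul, ← mul_assoc]
  rw [neg_neg, neg_sq] at h1
  gcongr

/-! ### Returns to the explored neighbourhood -/

/-- Mass of the words of length `T` ending at a vertex that is reached earlier by a word of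
weight at least `θ`. -/
lemma revisit_bound {p : Fin n → Fin n → ℝ} (hp : ∀ i j, 0 ≤ p i j)
    (hp1 : ∀ i, ∑ j, p i j ≤ 1) {T : ℕ} (hn : 2 * (T + T + 2) ^ 2 ≤ n) {θ : ℝ} (hθ : 0 < θ)
    (x : Fin n) :
    Ex (fun σ => ∑ κ ∈ words n T, wt p σ x κ *
      ind (∃ κ' : List (Fin n), κ'.length < T ∧ θ ≤ wt p σ x κ' ∧ run σ x κ' = run σ x κ)) ≤
      T * (6 * (((T : ℝ) + T + 2) ^ 2 / n)) / θ := by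
  have hpt : ∀ σ : Env n, ∑ κ ∈ words n T, wt p σ x κ *
      ind (∃ κ' : List (Fin n), κ'.length < T ∧ θ ≤ wt p σ x κ' ∧ run σ x κ' = run σ x κ) ≤
      θ⁻¹ * ∑ b ∈ Finset.range T, ∑ κ ∈ words n T, wt p σ x κ * ∑ κ' ∈ words n b, wt p σ x κ' *
        ind (run σ x κ = run σ x κ' ∧ ¬ (x = x ∧ κ = κ')) := by
    intro σ
    rw [Finset.sum_comm, Finset.mul_sum]
    refine Finset.sum_le_sum fun κ hκ => ?_
    rw [← Finset.mul_sum, mul_left_comm]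
    refine mul_le_mul_of_nonneg_left ?_ (wt_nonneg hp _ _ _)
    by_cases h : ∃ κ' : List (Fin n), κ'.length < T ∧ θ ≤ wt p σ x κ' ∧ run σ x κ' = run σ x κ
    · rw [ind_of h]
      obtain ⟨κ', h1, h2, h3⟩ := h
      rw [inv_mul_eq_div, one_le_div hθ]
      have nn : ∀ κ', 0 ≤ wt p σ x κ' * ind (run σ x κ = run σ x κ' ∧ ¬ (x = x ∧ κ = κ')) :=
        fun κ' => mul_nonneg (wt_nonneg hp _ _ _) (ind_nonneg _)
      refine le_trans ?_ (Finset.single_le_sum (fun b _ => Finset.sum_nonneg fun κ' _ => nn κ')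
        (Finset.mem_range.2 h1))
      refine le_trans ?_ (Finset.single_le_sum (fun κ' _ => nn κ') (mem_words.2 rfl))
      have hne : ¬ (x = x ∧ κ = κ') := fun hh => by
        rw [mem_words, hh.2] at hκ; omega
      rw [ind_of ⟨h3.symm, hne⟩, mul_one]
      exact h2
    · rw [ind_not h]
      exact mul_nonneg (by positivity) (Finset.sum_nonneg fun b _ => Finset.sum_nonneg fun κ' _ =>
        mul_nonneg (wt_nonneg hp _ _ _) (ind_nonneg _))
  refine (Ex_mono hpt).trans ?_
  rw [Ex_mul_left, Ex_sum, inv_mul_eq_div]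
  refine div_le_div_of_nonneg_right ?_ hθ.le
  calc _ ≤ ∑ b ∈ Finset.range T, 6 * (((T : ℝ) + T + 2) ^ 2 / n) := by
        refine Finset.sum_le_sum fun b hb => ?_
        have hb' : b ≤ T := (Finset.mem_range.1 hb).le
        refine (two_words_bound hp hp1 T b (le_trans (by gcongr) hn) x x).trans ?_
        have : (b : ℝ) ≤ T := by exact_mod_cast hb'
        gcongr
    _ = _ := by simp

/-! ### Nearly deterministic steps -/

/-- Number of steps along entries that are at most `1 - e`. -/
noncomputable def ng (p : Fin n → Fin n → ℝ) (e : ℝ) (σ : Env n) : Fin n → List (Fin n) → ℕ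
  | _, [] => 0
  | x, k :: κ => (if 1 - e < p x k then 0 else 1) + ng p e σ (σ x k) κ

@[simp] lemma ng_nil (p : Fin n → Fin n → ℝ) (e : ℝ) (σ : Env n) (x : Fin n) :
    ng p e σ x [] = 0 := rfl

@[simp] lemma ng_cons (p : Fin n → Fin n → ℝ) (e : ℝ) (σ : Env n) (x k : Fin n)
    (κ : List (Fin n)) :
    ng p e σ x (k :: κ) = (if 1 - e < p x k then 0 else 1) + ng p e σ (σ x k) κ := rfl

lemma ng_append (p : Fin n → Fin n → ℝ) (e : ℝ) (σ : Env n) (x : Fin n) (κ κ' : List (Fin n)) :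
    ng p e σ x (κ ++ κ') = ng p e σ x κ + ng p e σ (run σ x κ) κ' := by
  induction κ generalizing x with
  | nil => simp
  | cons k κ ih => simp [ih, add_assoc]

lemma wt_le_pow_ng {p : Fin n → Fin n → ℝ} (hp : ∀ i j, 0 ≤ p i j)
    (hle1 : ∀ i j, p i j ≤ 1) {e : ℝ} (he : e ≤ 1) (σ : Env n) (x : Fin n)
    (κ : List (Fin n)) : wt p σ x κ ≤ (1 - e) ^ ng p e σ x κ := by
  induction κ generalizing x with
  | nil => simp
  | cons k κ ih =>
    have h1 := ih (σ x k)
    have h0 := wt_nonneg hp σ (σ x k) κ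
    have he' : 0 ≤ 1 - e := by linarith
    rw [wt_cons, ng_cons]
    split_ifs with h
    · rw [zero_add]
      exact (mul_le_of_le_one_left h0 (hle1 x k)).trans h1
    · rw [pow_add, pow_one]
      exact mul_le_mul (not_lt.1 h) h1 h0 he'

/-- Indicator kernel of the nearly deterministic entries. -/
noncomputable def gk (p : Fin n → Fin n → ℝ) (e : ℝ) (x k : Fin n) : ℝ :=
  if 1 - e < p x k then 1 else 0

lemma gk_nonneg (p : Fin n → Fin n → ℝ) (e : ℝ) (x k : Fin n) : 0 ≤ gk p e x k := by
  unfold gk; split_ifs <;> norm_num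

lemma wt_gk {p : Fin n → Fin n → ℝ} {e : ℝ} {σ : Env n} {x : Fin n} {κ : List (Fin n)}
    (h : ng p e σ x κ = 0) : wt (gk p e) σ x κ = 1 := by
  induction κ generalizing x with
  | nil => rfl
  | cons k κ ih =>
    rw [ng_cons] at h
    have h1 : 1 - e < p x k := by
      by_contra hc
      rw [if_neg hc] at h; omega
    rw [wt_cons, ih (by omega), gk, if_pos h1, one_mul]

lemma exists_loop {σ : Env n} {x : Fin n} {κ : List (Fin n)} (h : ¬ (tails σ x κ).Nodup) :
    ∃ a b c, κ = a ++ (b ++ c) ∧ b ≠ [] ∧ c ≠ [] ∧ run σ (run σ x a) b = run σ x a := by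
  induction κ generalizing x with
  | nil => simp at h
  | cons k κ ih =>
    rw [tails_cons, List.nodup_cons, not_and_or, not_not] at h
    rcases h with h | h
    · obtain ⟨κ₁, k', κ₂, rfl, h2⟩ := (mem_tails_iff _ _ _ _).1 h
      exact ⟨[], k :: κ₁, k' :: κ₂, by simp, by simp, by simp, by simpa using h2⟩
    · obtain ⟨a, b, c, rfl, hb, hc, hr⟩ := ih h
      exact ⟨k :: a, b, c, by simp, hb, hc, by simpa using hr⟩

/-- No short cycle of nearly deterministic steps. -/
def NoShortCycle (p : Fin n → Fin n → ℝ) (e : ℝ) (M : ℕ) (σ : Env n) : Prop :=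
  ∀ x κ, κ ≠ [] → κ.length ≤ M → ng p e σ x κ = 0 → run σ x κ ≠ x

lemma exists_simple_cycle {p : Fin n → Fin n → ℝ} {e : ℝ} {M : ℕ} {σ : Env n}
    (h : ¬ NoShortCycle p e M σ) :
    ∃ x κ, κ ≠ [] ∧ κ.length ≤ M ∧ ng p e σ x κ = 0 ∧ run σ x κ = x ∧ (tails σ x κ).Nodup := by
  have key : ∀ m x κ, κ.length = m → κ ≠ [] → κ.length ≤ M → ng p e σ x κ = 0 → run σ x κ = x →
      ∃ x κ, κ ≠ [] ∧ κ.length ≤ M ∧ ng p e σ x κ = 0 ∧ run σ x κ = x ∧ (tails σ x κ).Nodup := by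
    intro m
    induction m using Nat.strong_induction_on with
    | _ m ih =>
      intro x κ hm h1 h2 h3 h4
      by_cases hd : (tails σ x κ).Nodup
      · exact ⟨x, κ, h1, h2, h3, h4, hd⟩
      obtain ⟨a, b, c, rfl, hb, hc, hr⟩ := exists_loop hd
      have hc' := List.length_pos_iff.2 hc
      simp only [List.length_append] at hm h2
      rw [ng_append, ng_append] at h3
      exact ih b.length (by omega) _ b rfl hb (by omega) (by omega) hr
  unfold NoShortCycle at h
  push Not at h
  obtain ⟨x, κ, h1, h2, h3, h4⟩ := h
  exact key _ x κ rfl h1 h2 h3 h4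

lemma Pr_shortCycle_le {p : Fin n → Fin n → ℝ} {e β : ℝ} {M : ℕ}
    (hβ : β ≤ 1 / 4) (hβ0 : 0 ≤ β) (hM : 2 * M < n) (h : (∑ x, ∑ k, gk p e x k) / n ≤ β) :
    Pr n (fun σ => ¬ NoShortCycle p e M σ) ≤ 4 * β := by
  have hn0 : (0 : ℝ) < n := by exact_mod_cast (by omega : 0 < n)
  have nn : ∀ (σ : Env n) x κ, 0 ≤ wt (gk p e) σ x κ *
      (ind (tails σ x κ).Nodup * (if run σ x κ = x then (1 : ℝ) else 0)) := fun σ x κ =>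
    mul_nonneg (wt_nonneg (gk_nonneg p e) _ _ _) (mul_nonneg (ind_nonneg _) (by positivity))
  have hE := Pr_le_Ex_div (f := fun σ : Env n => ∑ l ∈ Finset.range M, ∑ x, ∑ κ ∈ words n (l + 1),
      wt (gk p e) σ x κ * (ind (tails σ x κ).Nodup * (if run σ x κ = x then (1 : ℝ) else 0)))
    (fun σ => Finset.sum_nonneg fun l _ => Finset.sum_nonneg fun x _ =>
      Finset.sum_nonneg fun κ _ => nn σ x κ) one_pos
    (E := fun σ => ¬ NoShortCycle p e M σ) (fun σ hσ => by
      obtain ⟨x, κ, h1, h2, h3, h4, h5⟩ := exists_simple_cycle hσ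
      have h1' := List.length_pos_iff.2 h1
      refine le_trans ?_ (Finset.single_le_sum (fun l _ => Finset.sum_nonneg fun x _ =>
        Finset.sum_nonneg fun κ _ => nn σ x κ) (Finset.mem_range.2 (by omega : κ.length - 1 < M)))
      refine le_trans ?_ (Finset.single_le_sum (fun x _ =>
        Finset.sum_nonneg fun κ _ => nn σ x κ) (Finset.mem_univ x))
      refine le_trans ?_ (Finset.single_le_sum (fun κ _ => nn σ x κ)
        (mem_words.2 (by omega) : κ ∈ words n (κ.length - 1 + 1)))
      rw [wt_gk h3, ind_of h5, if_pos h4]; norm_num)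
  rw [div_one] at hE
  refine hE.trans ?_
  rw [Ex_sum]
  have hl : ∀ l ∈ Finset.range M, Ex (fun σ : Env n => ∑ x, ∑ κ ∈ words n (l + 1),
      wt (gk p e) σ x κ * (ind (tails σ x κ).Nodup * (if run σ x κ = x then (1 : ℝ) else 0))) ≤
      (2 * β) ^ (l + 1) := by
    intro l hl
    have hlM := Finset.mem_range.1 hl
    have hlR : 2 * ((l : ℝ) + 1) ≤ n := by exact_mod_cast (by omega : 2 * (l + 1) ≤ n)
    rw [Ex_sum]
    set C : ℝ := n / ((n : ℝ) - (l + 1)) with hC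
    set a : ℝ := (∑ x, ∑ k, gk p e x k) / n with ha
    have ha0 : 0 ≤ a := div_nonneg (Finset.sum_nonneg fun y _ =>
      Finset.sum_nonneg fun k _ => gk_nonneg p e y k) hn0.le
    have hC2 : C ≤ 2 := by
      rw [hC, div_le_iff₀ (by linarith)]; linarith
    have hC0 : 0 ≤ C := div_nonneg hn0.le (by linarith)
    calc _ ≤ ∑ x : Fin n, (∑ k, gk p e x k) * (a * C) ^ l * C * (1 / n) := by
          refine Finset.sum_le_sum fun x _ => ?_
          have h1 := sa_annealed (gk_nonneg p e) (f := fun v => if v = x then 1 else 0)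
            (fun v => by positivity) (by omega : l + 1 < n) x
          simpa using h1
      _ = (a * C) ^ (l + 1) := by
          rw [← Finset.sum_mul, ← Finset.sum_mul, ← Finset.sum_mul]
          have : ∑ x, ∑ k, gk p e x k = n * a := by rw [ha]; field_simp
          rw [this]; field_simp; ring
      _ ≤ _ := by
          apply pow_le_pow_left₀ (by positivity)
          nlinarith
  refine (Finset.sum_le_sum hl).trans ?_
  have h2 : ∀ M : ℕ, ∑ l ∈ Finset.range M, (2 * β) ^ (l + 1) ≤ 4 * β - 4 * β * (2 * β) ^ M := by
    intro M
    induction M with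
    | zero => simp
    | succ M ih =>
      rw [Finset.sum_range_succ, pow_succ (2 * β) M]
      have : 0 ≤ (2 * β) ^ M := by positivity
      nlinarith [mul_nonneg hβ0 this]
  have := h2 M
  have : 0 ≤ 4 * β * (2 * β) ^ M := by positivity
  linarith [h2 M]

/-- Among many steps, few of them large, there is a long run of nearly deterministic steps. -/
lemma exists_block {p : Fin n → Fin n → ℝ} {e : ℝ} {σ : Env n} {M : ℕ} (J : ℕ) {x : Fin n}
    {κ : List (Fin n)} (h1 : ng p e σ x κ ≤ J) (h2 : (J + 1) * M ≤ κ.length) :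
    ∃ a b c, κ = a ++ (b ++ c) ∧ b.length = M ∧ ng p e σ (run σ x a) b = 0 := by
  induction J generalizing x κ with
  | zero =>
    refine ⟨[], κ.take M, κ.drop M, by simp, by simp; omega, ?_⟩
    rw [← List.take_append_drop M κ, ng_append] at h1
    rw [run_nil]; omega
  | succ J ih =>
    have hM : M ≤ κ.length := le_trans (by nlinarith) h2
    by_cases h : ng p e σ x (κ.take M) = 0
    · exact ⟨[], κ.take M, κ.drop M, by simp, by simp [hM], h⟩
    have h3 := h1
    rw [← List.take_append_drop M κ, ng_append] at h3
    obtain ⟨a, b, c, h4, h5, h6⟩ := ih (x := run σ x (κ.take M)) (κ := κ.drop M) (by omega) (by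
      rw [List.length_drop]
      have : (J + 1 + 1) * M = (J + 1) * M + M := by ring
      omega)
    refine ⟨κ.take M ++ a, b, c, ?_, h5, by rwa [run_append]⟩
    rw [List.append_assoc, ← h4, List.take_append_drop]

lemma le_card_tails {p : Fin n → Fin n → ℝ} {e : ℝ} {σ : Env n} {M J : ℕ} {x : Fin n}
    {κ : List (Fin n)} (h1 : ng p e σ x κ ≤ J) (h2 : (J + 1) * M ≤ κ.length)
    (hc : NoShortCycle p e M σ) : M ≤ (tails σ x κ).toFinset.card := by
  obtain ⟨a, b, c, rfl, h5, h6⟩ := exists_block J h1 h2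
  have hd : (tails σ (run σ x a) b).Nodup := by
    by_contra hd
    obtain ⟨a', b', c', rfl, hb, hc', hr⟩ := exists_loop hd
    rw [ng_append, ng_append] at h6
    simp only [List.length_append] at h5
    exact hc _ b' hb (by omega) (by omega) hr
  have h7 := List.toFinset_card_of_nodup hd
  rw [length_tails, h5] at h7
  rw [← h7]
  apply Finset.card_le_card
  intro v hv
  rw [tails_append, tails_append]
  simp only [List.mem_toFinset, List.mem_append] at hv ⊢
  exact Or.inr (Or.inl hv)

/-- Vertices having a nearly deterministic entry. -/
noncomputable def detSet (p : Fin n → Fin n → ℝ) (e : ℝ) : Finset (Fin n) :=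
  Finset.univ.filter fun x => ∃ k, 1 - e < p x k

lemma card_detSet_le (p : Fin n → Fin n → ℝ) (e : ℝ) :
    ((detSet p e).card : ℝ) ≤ ∑ x, ∑ k, gk p e x k := by
  rw [detSet, Finset.card_filter]
  push_cast
  refine Finset.sum_le_sum fun x _ => ?_
  split_ifs with h
  · obtain ⟨k, hk⟩ := h
    refine le_trans ?_ (Finset.single_le_sum (fun k _ => gk_nonneg p e x k) (Finset.mem_univ k))
    rw [gk, if_pos hk]
  · exact Finset.sum_nonneg fun k _ => gk_nonneg p e x k

lemma card_tails_sdiff_le (p : Fin n → Fin n → ℝ) (e : ℝ) (σ : Env n) (x : Fin n)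
    (κ : List (Fin n)) :
    ((tails σ x κ).toFinset \ detSet p e).card ≤ ng p e σ x κ := by
  induction κ generalizing x with
  | nil => simp
  | cons k κ ih =>
    rw [tails_cons, List.toFinset_cons, ng_cons]
    have := ih (σ x k)
    split_ifs with h
    · have hx : x ∈ detSet p e := by simp only [detSet, Finset.mem_filter_univ]; exact ⟨k, h⟩
      rw [Finset.insert_sdiff_of_mem _ hx]; omega
    · refine (Finset.card_le_card (t := insert x ((tails σ (σ x k) κ).toFinset \ detSet p e))
        (fun v hv => ?_)).trans ((Finset.card_insert_le _ _).trans ?_)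
      · simp only [Finset.mem_insert, Finset.mem_sdiff] at hv ⊢
        tauto
      omega

lemma seen_trip {R : Finset (Fin n)} (σ : Env n) {x : Fin n} (κ : List (Fin n)) {h : Hist n}
    (hx : x ∈ seen R h) :
    seen R (trip σ x κ h) = insert (run σ x κ) ((tails σ x κ).toFinset ∪ seen R h) := by
  induction κ generalizing x h with
  | nil => simp [hx]
  | cons k κ ih =>
    rw [trip_cons, ih (Finset.mem_insert_self _ _), run_cons, tails_cons, List.toFinset_cons]
    have h2 : σ x k ∈ insert (run σ (σ x k) κ) (tails σ (σ x k) κ).toFinset := by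
      cases κ <;> simp
    ext v
    simp only [seen, Finset.mem_insert, Finset.mem_union] at h2 ⊢
    constructor
    · rintro (h | h | h | h)
      · exact Or.inl h
      · exact Or.inr (Or.inl (Or.inr h))
      · subst h; rcases h2 with h2 | h2
        · exact Or.inl h2
        · exact Or.inr (Or.inl (Or.inr h2))
      · exact Or.inr (Or.inr h)
    · rintro (h | (h | h) | h)
      · exact Or.inl h
      · subst h; exact Or.inr (Or.inr (Or.inr hx))
      · exact Or.inr (Or.inl h)
      · exact Or.inr (Or.inr (Or.inr h))

lemma subset_seen (R : Finset (Fin n)) (h : Hist n) : R ⊆ seen R h :=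
  fun _ hx => root_mem_seen h hx

lemma pot_eq {R : Finset (Fin n)} (z : ℝ) (g : Fin n → ℝ) {σ : Env n} {h : Hist n}
    (hv : Valid R h) (hσ : σ ∈ Agree h) :
    pot R z g h = z ^ coll R h * ∏ v ∈ seen R h \ R, g v := by
  induction h with
  | nil => simp [pot, coll, seen]
  | cons e h ih =>
    have hσ' : σ ∈ Agree h := mem_Agree.2 fun f hf => mem_Agree.1 hσ f (List.mem_cons_of_mem _ hf)
    rw [pot, coll, ih hv.2 hσ', seen]
    by_cases hf : Fresh e.1 e.2.1 h
    · by_cases hs : e.2.2 ∈ seen R h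
      · rw [if_pos hf, if_pos hs, if_pos ⟨hf, hs⟩, Finset.insert_eq_of_mem hs]
        ring
      · rw [if_pos hf, if_neg hs, if_neg (fun hh => hs hh.2), add_zero,
          Finset.insert_sdiff_of_notMem _ (fun hh => hs (subset_seen R h hh)),
          Finset.prod_insert (fun hh => hs (Finset.mem_sdiff.1 hh).1)]
        ring
    · have hm := (mem_seen_of_mem hv.2 _ (mem_of_not_Fresh hσ hf)).2
      rw [if_neg hf, if_neg (fun hh => hf hh.1), Finset.insert_eq_of_mem hm]
      ring

lemma pow_le_pot {p : Fin n → Fin n → ℝ} {e y z : ℝ} (hy : 2 ≤ y) (hz : 0 ≤ z) {σ : Env n}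
    {x : Fin n} {κ : List (Fin n)} {J m : ℕ} (h1 : ng p e σ x κ ≤ J)
    (h2 : m + 2 * (J + 1) + 1 ≤ (tails σ x κ).toFinset.card) :
    z ^ coll {x} (trip σ x κ []) * y ^ m ≤
      pot {x} z (fun v => if v ∈ detSet p e then y else 1 / 2) (trip σ x κ []) := by
  have hv : Valid {x} (trip σ x κ []) :=
    Valid_trip (h := []) (root_mem_seen _ (by simp)) trivial
  rw [pot_eq z _ hv (Agree_trip (σ := σ) (by simp [Agree_nil]))]
  refine mul_le_mul_of_nonneg_left ?_ (pow_nonneg hz _)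
  set S := seen {x} (trip σ x κ []) \ {x} with hS
  have hseen := seen_trip (R := {x}) (h := []) (x := x) σ κ (root_mem_seen _ (by simp))
  have hc1 : (tails σ x κ).toFinset.card ≤ S.card + 1 := by
    have : (tails σ x κ).toFinset ⊆ insert x S := by
      intro v hv
      rw [Finset.mem_insert, hS, Finset.mem_sdiff, hseen]
      by_cases hvx : v = x
      · exact Or.inl hvx
      · refine Or.inr ⟨?_, by simpa using hvx⟩
        exact Finset.mem_insert_of_mem (Finset.mem_union_left _ hv)
    exact (Finset.card_le_card this).trans (Finset.card_insert_le _ _)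
  have hc2 : (S \ detSet p e).card ≤ J + 1 := by
    have : S \ detSet p e ⊆ insert (run σ x κ) ((tails σ x κ).toFinset \ detSet p e) := by
      intro v hv
      rw [hS, hseen] at hv
      simp only [seen, Finset.mem_sdiff, Finset.mem_insert, Finset.mem_union,
        Finset.mem_singleton] at hv ⊢
      tauto
    refine (Finset.card_le_card this).trans ((Finset.card_insert_le _ _).trans ?_)
    have := card_tails_sdiff_le p e σ x κ
    omega
  have hc3 := Finset.card_inter_add_card_sdiff S (detSet p e)
  rw [← Finset.prod_inter_mul_prod_sdiff S (detSet p e)]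
  rw [Finset.prod_congr rfl (fun v hv => if_pos (Finset.mem_inter.1 hv).2),
    Finset.prod_congr rfl (g := fun _ => (1 : ℝ) / 2)
      (fun v hv => if_neg (Finset.mem_sdiff.1 hv).2),
    Finset.prod_const, Finset.prod_const]
  have h3 : m + (J + 1) ≤ (S ∩ detSet p e).card := by omega
  calc y ^ m ≤ y ^ m * (y ^ (J + 1) * (1 / 2) ^ (J + 1)) := by
        rw [← mul_pow]
        exact le_mul_of_one_le_right (by positivity) (one_le_pow₀ (by linarith))
    _ = y ^ (m + (J + 1)) * (1 / 2) ^ (J + 1) := by rw [pow_add]; ring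
    _ ≤ _ := by
        have h4 : y ^ (m + (J + 1)) ≤ y ^ (S ∩ detSet p e).card :=
          pow_le_pow_right₀ (by linarith) h3
        have h5 : ((1 : ℝ) / 2) ^ (J + 1) ≤ (1 / 2) ^ (S \ detSet p e).card :=
          pow_le_pow_of_le_one (by norm_num) (by norm_num) hc2
        gcongr

lemma nodup_tails_of_coll {σ : Env n} {x : Fin n} {κ : List (Fin n)}
    (hc : coll {x} (trip σ x κ []) = 0) : (tails σ x κ).Nodup := by
  by_contra hd
  obtain ⟨a, b, c, rfl, hb, -, hr⟩ := exists_loop hd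
  have hI := InH_trip σ x (a ++ (b ++ c)) []
  have hI1 := (InH_append.1 hI).1
  have hI2 := (InH_append.1 (show InH σ {e | e ∈ trip σ x (a ++ (b ++ c)) []} x ((a ++ b) ++ c) by
    rwa [List.append_assoc])).1
  have := (word_unique (R := {x}) (Valid_trip (h := []) (root_mem_seen _ (by simp)) trivial)
      (Agree_trip (by simp [Agree_nil])) hc (by simp) (by simp) hI1 hI2
      (by rw [run_append, hr])).2
  exact hb (by simpa using this)

/-- A walk rarely makes few large steps without closing a short nearly deterministic cycle. -/
lemma few_large_steps_bound {p : Fin n → Fin n → ℝ} (hp : ∀ i j, 0 ≤ p i j)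
    (hp1 : ∀ i, ∑ j, p i j ≤ 1) {s : ℕ} (hn : 2 * (s + 2) ^ 2 ≤ n) {e y : ℝ} (hy : 2 ≤ y)
    (hD : (∑ x, ∑ k, gk p e x k) * y ≤ n / 2) {J M J' : ℕ} (hM : (J + 1) * M ≤ s)
    (hM' : J' + 2 * (J + 1) + 1 ≤ M) (hs : 2 * (J + 1) + 1 ≤ s)
    (hns : n * y ^ J' ≤ y ^ (s - (2 * (J + 1) + 1))) (x : Fin n) :
    Ex (fun σ => ∑ κ ∈ words n s, wt p σ x κ * ind (ng p e σ x κ ≤ J ∧ NoShortCycle p e M σ)) ≤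
      6 * (((s : ℝ) + 2) ^ 2 / n) / y ^ J' := by
  obtain ⟨h0, h1, h2, h3⟩ := growth_hyps (R := {x}) (by simp) hn
  set z : ℝ := (n : ℝ) / ((s : ℝ) + 2) ^ 2 with hzdef
  set g : Fin n → ℝ := fun v => if v ∈ detSet p e then y else 1 / 2 with hg
  have hnR : 2 * ((s : ℝ) + 2) ^ 2 ≤ n := by exact_mod_cast hn
  have hz1 : 1 ≤ z := by
    rw [hzdef, le_div_iff₀ (by positivity)]; nlinarith [sq_nonneg ((s : ℝ) + 2)]
  have hzn : z ≤ n := div_le_self (by positivity) (by nlinarith)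
  have hg0 : ∀ v, 0 ≤ g v := fun v => by simp only [hg]; split_ifs <;> linarith
  have hgs : ∑ v, g v ≤ ∑ _v : Fin n, (1 : ℝ) := by
    have : ∀ v, g v ≤ 1 / 2 + y * (if v ∈ detSet p e then 1 else 0) := fun v => by
      simp only [hg]; split_ifs <;> linarith
    refine (Finset.sum_le_sum fun v _ => this v).trans ?_
    rw [Finset.sum_add_distrib, ← Finset.mul_sum, Finset.sum_ite_mem]
    simp only [Finset.sum_const, Finset.card_univ, Fintype.card_fin, nsmul_eq_mul, mul_one,
      Finset.univ_inter]
    have := mul_le_mul_of_nonneg_right (card_detSet_le p e) (by linarith : 0 ≤ y)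
    linarith
  have hzy : 0 < z * y ^ J' := mul_pos (by linarith) (pow_pos (by linarith) _)
  have hF : PotBound {x} z g s 0 (z * y ^ J')⁻¹
      (fun _ h => ind (z * y ^ J' ≤ pot {x} z g h)) := by
    intro h _
    rw [Finset.sum_const, nsmul_eq_mul]
    refine mul_le_mul_of_nonneg_left ?_ (by positivity)
    by_cases hh : z * y ^ J' ≤ pot {x} z g h
    · rw [ind_of hh, inv_mul_eq_div, le_div_iff₀ hzy, one_mul]; exact hh
    · rw [ind_not hh]
      exact mul_nonneg (inv_nonneg.2 hzy.le) (pot_nonneg h0 hg0 h)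
  have hE := (hF.walk h0 hg0 h1 h2 (le_trans (by gcongr) h3) hp hp1
    (inv_nonneg.2 hzy.le) s x).Ex_le (by omega)
  refine le_trans (Ex_mono fun σ => ?_) (hE.trans ?_)
  · refine Finset.sum_le_sum fun κ hκ => mul_le_mul_of_nonneg_left
      (ind_mono fun ⟨h4, h5⟩ => ?_) (wt_nonneg hp _ _ _)
    have hκs := mem_words.1 hκ
    rcases Nat.eq_zero_or_pos (coll {x} (trip σ x κ [])) with hc | hc
    · have h6 := List.toFinset_card_of_nodup (nodup_tails_of_coll hc)
      rw [length_tails, hκs] at h6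
      refine le_trans ?_ (pow_le_pot (m := s - (2 * (J + 1) + 1)) hy h0 h4 (by omega))
      rw [hc, pow_zero, one_mul]
      refine le_trans ?_ hns
      have : 0 ≤ y ^ J' := by positivity
      gcongr
    · have h6 := le_card_tails h4 (by omega) h5
      refine le_trans ?_ (pow_le_pot (m := J') hy h0 h4 (by omega))
      have h7 : z ≤ z ^ coll {x} (trip σ x κ []) := le_self_pow₀ hz1 (by omega)
      have : 0 ≤ y ^ J' := by positivity
      gcongr
  · have h4 := growth_le hn
    have e1 : 6 * (((s : ℝ) + 2) ^ 2 / n) / y ^ J' = 6 * (z * y ^ J')⁻¹ := by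
      rw [hzdef, mul_inv, inv_div]; ring
    rw [e1]
    have := inv_nonneg.2 hzy.le
    gcongr

/-- From every starting point the walk typically has small weight. -/
lemma Pr_heavy_le {p : Fin n → Fin n → ℝ} (hp : ∀ i j, 0 ≤ p i j)
    (hp1 : ∀ i, ∑ j, p i j ≤ 1) {s : ℕ} (hn : 2 * (s + 2) ^ 2 ≤ n) {e y θ δ β : ℝ} (hy : 2 ≤ y)
    (he1 : e ≤ 1) (he0 : 0 ≤ e) (hδ : 0 < δ) (hβ : β ≤ 1 / 4) (hβ0 : 0 ≤ β)
    (hD : (∑ x, ∑ k, gk p e x k) / n ≤ β) (hβy : β * y ≤ 1 / 2)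
    {J M J' : ℕ} (hM : (J + 1) * M ≤ s)
    (hM' : J' + 2 * (J + 1) + 1 ≤ M) (hs : 2 * (J + 1) + 1 ≤ s)
    (hns : n * y ^ J' ≤ y ^ (s - (2 * (J + 1) + 1))) (hθ : (1 - e) ^ (J + 1) < θ) :
    Pr n (fun σ => ∃ x, δ < heavyMass p θ s σ x) ≤
      6 * ((s : ℝ) + 2) ^ 2 / y ^ J' / δ + 4 * β := by
  have hn0 : (0 : ℝ) < n := by exact_mod_cast lt_of_lt_of_le (by positivity) hn
  have hle1 : ∀ i j, p i j ≤ 1 := fun i j =>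
    (Finset.single_le_sum (fun j _ => hp i j) (Finset.mem_univ j)).trans (hp1 i)
  have hMs : M ≤ s := le_trans (Nat.le_mul_of_pos_left M (by omega)) hM
  have hMn : 2 * M < n := by nlinarith
  have hD' : (∑ x, ∑ k, gk p e x k) * y ≤ n / 2 := by
    rw [div_le_iff₀ hn0] at hD
    nlinarith
  set F : Env n → Fin n → ℝ := fun σ x => ∑ κ ∈ words n s, wt p σ x κ *
    ind (ng p e σ x κ ≤ J ∧ NoShortCycle p e M σ) with hF
  have hle : ∀ σ, NoShortCycle p e M σ → ∀ x, heavyMass p θ s σ x ≤ F σ x := by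
    intro σ hσ x
    refine Finset.sum_le_sum fun κ _ => ?_
    split_ifs with h
    · have hng : ng p e σ x κ ≤ J := by
        by_contra hc
        have h1 := wt_le_pow_ng hp hle1 he1 σ x κ
        have h2 : (1 - e) ^ ng p e σ x κ ≤ (1 - e) ^ (J + 1) :=
          pow_le_pow_of_le_one (by linarith) (by linarith) (by omega)
        linarith
      rw [ind_of ⟨hng, hσ⟩, mul_one]
    · exact mul_nonneg (wt_nonneg hp _ _ _) (ind_nonneg _)
  have hF0 : ∀ σ x, 0 ≤ F σ x := fun σ x => Finset.sum_nonneg fun κ _ =>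
    mul_nonneg (wt_nonneg hp _ _ _) (ind_nonneg _)
  refine (Pr_mono (F := fun σ => (∃ x, δ < F σ x) ∨ ¬ NoShortCycle p e M σ) fun σ hσ => ?_).trans
    ((Pr_or_le _ _).trans (add_le_add ?_ (Pr_shortCycle_le hβ hβ0 hMn hD)))
  · by_cases hc : NoShortCycle p e M σ
    · obtain ⟨x, hx⟩ := hσ
      exact Or.inl ⟨x, hx.trans_le (hle σ hc x)⟩
    · exact Or.inr hc
  · refine (Pr_exists_le _).trans ((Finset.sum_le_sum fun x _ =>
      (Pr_le_Ex_div (f := fun σ => F σ x) (fun σ => hF0 σ x) hδ fun σ h => h.le).trans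
      (div_le_div_of_nonneg_right
        (few_large_steps_bound hp hp1 hn hy hD' hM hM' hs hns x) hδ.le)).trans (le_of_eq ?_))
    simp only [Finset.sum_const, Finset.card_univ, Fintype.card_fin, nsmul_eq_mul]
    field_simp

/-! ### Resampling the rows outside a stopping set -/

/-- The environment that agrees with `σ` on `S` and with `σ'` off `S`. -/
noncomputable def mix (S : Finset (Fin n)) (σ σ' : Env n) : Env n :=
  fun x => if x ∈ S then σ x else σ' x

lemma mix_apply_of_mem {S : Finset (Fin n)} {x : Fin n} (hx : x ∈ S) (σ σ' : Env n) :
    mix S σ σ' x = σ x := by simp [mix, hx]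

lemma mix_apply_of_notMem {S : Finset (Fin n)} {x : Fin n} (hx : x ∉ S) (σ σ' : Env n) :
    mix S σ σ' x = σ' x := by simp [mix, hx]

/-- Resampling the rows outside a set that is determined by the rows inside it. -/
lemma Ex_eq_Ex_mix (S : Env n → Finset (Fin n))
    (hS : ∀ σ σ' : Env n, (∀ x ∈ S σ, σ x = σ' x) → S σ' = S σ) (F : Env n → ℝ) :
    Ex F = Ex (fun σ => Ex (fun σ' => F (mix (S σ) σ σ'))) := by
  have hmix : ∀ σ σ' : Env n, S (mix (S σ) σ σ') = S σ := fun σ σ' =>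
    hS σ _ fun x hx => (mix_apply_of_mem hx σ σ').symm
  let Φ : Env n × Env n → Env n × Env n := fun q => (mix (S q.1) q.1 q.2, mix (S q.1) q.2 q.1)
  have hΦ : Function.Involutive Φ := by
    rintro ⟨σ, σ'⟩
    simp only [Φ, hmix]
    ext x : 2 <;> (by_cases hx : x ∈ S σ <;> simp [mix, hx])
  have h1 : ∑ q : Env n × Env n, F (Φ q).1 = ∑ q : Env n × Env n, F q.1 :=
    Equiv.sum_comp (hΦ.toPerm Φ) (fun q : Env n × Env n => F q.1)
  rw [Fintype.sum_prod_type, Fintype.sum_prod_type] at h1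
  simp only [Finset.sum_const, Finset.card_univ, nsmul_eq_mul] at h1
  rw [← Finset.mul_sum] at h1
  have hc := card_env_pos (n := n)
  simp only [Ex]
  rw [← Finset.sum_div]
  simp only [Φ] at h1
  rw [h1]
  field_simp

lemma Ex_le_Ex_of_mix (S : Env n → Finset (Fin n))
    (hS : ∀ σ σ' : Env n, (∀ x ∈ S σ, σ x = σ' x) → S σ' = S σ) {F G : Env n → ℝ}
    (h : ∀ σ, Ex (fun σ' => F (mix (S σ) σ σ')) ≤ G σ) : Ex F ≤ Ex G := by
  rw [Ex_eq_Ex_mix S hS F]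
  exact Ex_mono h

/-! ### Independence of the rows -/

/-- The average over a uniform permutation. -/
noncomputable def permEx (f : Equiv.Perm (Fin n) → ℝ) : ℝ :=
  (∑ τ, f τ) / (Fintype.card (Equiv.Perm (Fin n)) : ℝ)

lemma card_perm_pos : (0 : ℝ) < (Fintype.card (Equiv.Perm (Fin n)) : ℝ) := by
  exact_mod_cast Fintype.card_pos

lemma permEx_mono {f g : Equiv.Perm (Fin n) → ℝ} (h : ∀ τ, f τ ≤ g τ) : permEx f ≤ permEx g :=
  div_le_div_of_nonneg_right (Finset.sum_le_sum fun τ _ => h τ) card_perm_pos.le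

lemma permEx_const (c : ℝ) : permEx (fun _ : Equiv.Perm (Fin n) => c) = c := by
  have := card_perm_pos (n := n)
  simp only [permEx, Finset.sum_const, Finset.card_univ, nsmul_eq_mul]
  field_simp

lemma permEx_add (f g : Equiv.Perm (Fin n) → ℝ) :
    permEx (fun τ => f τ + g τ) = permEx f + permEx g := by
  simp only [permEx, Finset.sum_add_distrib, add_div]

lemma permEx_mul_left (c : ℝ) (f : Equiv.Perm (Fin n) → ℝ) :
    permEx (fun τ => c * f τ) = c * permEx f := by
  simp only [permEx, ← Finset.mul_sum, mul_div_assoc]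

lemma permEx_sum {ι : Type*} (s : Finset ι) (f : ι → Equiv.Perm (Fin n) → ℝ) :
    permEx (fun τ => ∑ i ∈ s, f i τ) = ∑ i ∈ s, permEx (f i) := by
  simp only [permEx]
  rw [Finset.sum_comm, Finset.sum_div]

lemma permEx_nonneg {f : Equiv.Perm (Fin n) → ℝ} (h : ∀ τ, 0 ≤ f τ) : 0 ≤ permEx f :=
  div_nonneg (Finset.sum_nonneg fun τ _ => h τ) card_perm_pos.le

/-- The image of a point under a uniform permutation is uniform. -/
lemma permEx_apply (f : Fin n → ℝ) (k : Fin n) :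
    permEx (fun τ => f (τ k)) = (∑ j, f j) / n := by
  have hn : (0 : ℝ) < n := by exact_mod_cast k.pos
  have h1 : ∀ i, permEx (fun τ : Equiv.Perm (Fin n) => f (τ i)) =
      permEx (fun τ : Equiv.Perm (Fin n) => f (τ k)) := by
    intro i
    unfold permEx
    congr 1
    refine Fintype.sum_equiv (Equiv.mulRight (Equiv.swap i k)) _ _ fun τ => ?_
    simp
  have h2 : ∑ i : Fin n, permEx (fun τ : Equiv.Perm (Fin n) => f (τ i)) = ∑ j, f j := by
    rw [← permEx_sum]
    simp only [fun τ : Equiv.Perm (Fin n) => Equiv.sum_comp τ f]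
    exact permEx_const _
  simp only [h1, Finset.sum_const, Finset.card_univ, Fintype.card_fin, nsmul_eq_mul] at h2
  rw [← h2]
  field_simp

lemma Ex_prod (f : Fin n → Equiv.Perm (Fin n) → ℝ) :
    Ex (fun σ => ∏ x, f x (σ x)) = ∏ x, permEx (f x) := by
  unfold Ex permEx
  rw [Finset.prod_div_distrib, Finset.prod_univ_sum]
  simp only [Fintype.piFinset_univ, Finset.prod_const, Finset.card_univ, Fintype.card_fin]
  congr 1
  rw [Fintype.card_fun, Fintype.card_fin]
  push_cast
  rfl

lemma Ex_row (x : Fin n) (f : Equiv.Perm (Fin n) → ℝ) : Ex (fun σ => f (σ x)) = permEx f := by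
  have := Ex_prod (fun y τ => if y = x then f τ else 1)
  rw [Finset.prod_eq_single x] at this
  · simpa using this
  · intro y _ hy; simp only [hy, if_false]; exact permEx_const 1
  · simp

lemma Ex_row_mul {x y : Fin n} (hxy : x ≠ y) (f g : Equiv.Perm (Fin n) → ℝ) :
    Ex (fun σ => f (σ x) * g (σ y)) = permEx f * permEx g := by
  have := Ex_prod (fun z τ => if z = x then f τ else if z = y then g τ else 1)
  rw [← Finset.mul_prod_erase Finset.univ _ (Finset.mem_univ x),
    ← Finset.mul_prod_erase _ _ (Finset.mem_erase.2 ⟨hxy.symm, Finset.mem_univ y⟩)] at this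
  rw [Finset.prod_eq_one] at this
  · simp only [if_true, hxy.symm, if_false, mul_one] at this
    rw [← this]
    refine congrArg Ex (funext fun σ => ?_)
    rw [← Finset.mul_prod_erase Finset.univ _ (Finset.mem_univ x),
      ← Finset.mul_prod_erase _ _ (Finset.mem_erase.2 ⟨hxy.symm, Finset.mem_univ y⟩),
      Finset.prod_eq_one]
    · simp [hxy.symm]
    · intro z hz; simp only [Finset.mem_erase] at hz; simp [hz.1, hz.2.1]
  · intro z hz
    simp only [Finset.mem_erase] at hz
    simp only [hz.1, hz.2.1, if_false]
    exact permEx_const 1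

/-- Second moment of a sum of centred functions of independent rows. -/
lemma Ex_sum_row_sq_le (L : Finset (Fin n)) (f : Fin n → Equiv.Perm (Fin n) → ℝ)
    (h0 : ∀ x ∈ L, permEx (f x) = 0) :
    Ex (fun σ => (∑ x ∈ L, f x (σ x)) ^ 2) = ∑ x ∈ L, permEx (fun τ => f x τ ^ 2) := by
  have e : ∀ σ : Env n, (∑ x ∈ L, f x (σ x)) ^ 2 =
      ∑ x ∈ L, ∑ y ∈ L, f x (σ x) * f y (σ y) := fun σ => by
    rw [sq, Finset.sum_mul_sum]
  simp only [e, Ex_sum]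
  refine Finset.sum_congr rfl fun x hx => ?_
  rw [Finset.sum_eq_single x]
  · rw [← Ex_row x]; simp only [sq]
  · intro y hy hyx
    rw [Ex_row_mul hyx.symm, h0 x hx, zero_mul]
  · exact fun h => absurd hx h

/-- Variance bound for a weighted sum of values of `g` seen from independent rows. -/
lemma Ex_sum_row_abs_le {p : Fin n → Fin n → ℝ} (hp : ∀ i j, 0 ≤ p i j)
    (hrow : ∀ i, ∑ j, p i j = 1) (L : Finset (Fin n)) (m g : Fin n → ℝ) :
    Ex (fun σ => |∑ x ∈ L, m x * (∑ k, p x k * g (σ x k) - (∑ z, g z) / n)|) ≤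
      Real.sqrt ((∑ x ∈ L, m x ^ 2) * ((∑ z, g z ^ 2) / n)) := by
  refine (Ex_abs_le_sqrt _).trans (Real.sqrt_le_sqrt ?_)
  have hmean : ∀ x, permEx (fun τ : Equiv.Perm (Fin n) => ∑ k, p x k * g (τ k)) =
      (∑ z, g z) / n := fun x => by
    rw [permEx_sum]
    simp only [permEx_mul_left, permEx_apply]
    rw [← Finset.sum_mul, hrow, one_mul]
  rw [Ex_sum_row_sq_le L (fun x τ => m x * (∑ k, p x k * g (τ k) - (∑ z, g z) / n))]
  · rw [Finset.sum_mul]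
    refine Finset.sum_le_sum fun x _ => ?_
    simp only [mul_pow]
    rw [permEx_mul_left]
    refine mul_le_mul_of_nonneg_left ?_ (sq_nonneg _)
    set c := (∑ z, g z) / n with hc
    have e : ∀ τ : Equiv.Perm (Fin n), (∑ k, p x k * g (τ k) - c) ^ 2 =
        (∑ k, p x k * g (τ k)) ^ 2 + ((-2 * c) * (∑ k, p x k * g (τ k)) + c ^ 2) := fun τ => by
      ring
    simp only [e]
    rw [permEx_add, permEx_add, permEx_mul_left, permEx_const, hmean]
    have h2 : permEx (fun τ : Equiv.Perm (Fin n) => (∑ k, p x k * g (τ k)) ^ 2) ≤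
        (∑ z, g z ^ 2) / n := by
      calc permEx (fun τ : Equiv.Perm (Fin n) => (∑ k, p x k * g (τ k)) ^ 2)
          ≤ permEx (fun τ : Equiv.Perm (Fin n) => ∑ k, p x k * (g (τ k)) ^ 2) :=
            permEx_mono fun τ =>
              ((even_two.convexOn_pow (𝕜 := ℝ)).map_sum_le (t := Finset.univ) (w := p x) (p := fun k => g (τ k))
                (fun k _ => hp x k) (hrow x) (fun k _ => Set.mem_univ _))
        _ = _ := by
            rw [permEx_sum]
            simp only [permEx_mul_left, permEx_apply (fun z => g z ^ 2)]
            rw [← Finset.sum_mul, hrow, one_mul]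
    nlinarith [sq_nonneg c]
  · intro x _
    rw [permEx_mul_left]
    simp only [sub_eq_add_neg]
    rw [permEx_add, permEx_const, hmean]
    ring

/-- Exponential moment bound for a weighted sum over independent rows of the probability of
hitting `B`. -/
lemma Ex_exp_row_le {p : Fin n → Fin n → ℝ} (hp : ∀ i j, 0 ≤ p i j)
    (hrow : ∀ i, ∑ j, p i j = 1) (L B : Finset (Fin n)) {m : Fin n → ℝ} (hm : ∀ x ∈ L, 0 ≤ m x)
    {a η : ℝ} (ha : 0 ≤ a) (ham : ∀ x ∈ L, a * m x ≤ 1) (hB : (B.card : ℝ) ≤ η * n) :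
    Ex (fun σ => Real.exp (a * ∑ x ∈ L, m x * ∑ k, p x k * if σ x k ∈ B then 1 else 0)) ≤
      Real.exp (2 * a * η * ∑ x ∈ L, m x) := by
  set q : Fin n → Equiv.Perm (Fin n) → ℝ := fun x τ => ∑ k, p x k * if τ k ∈ B then 1 else 0
    with hq
  have hq0 : ∀ x τ, 0 ≤ q x τ := fun x τ => Finset.sum_nonneg fun k _ =>
    mul_nonneg (hp _ _) (by split_ifs <;> norm_num)
  have hq1 : ∀ x τ, q x τ ≤ 1 := fun x τ => by
    rw [← hrow x]
    refine Finset.sum_le_sum fun k _ => mul_le_of_le_one_right (hp _ _) (by split_ifs <;> norm_num)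
  have e : ∀ σ : Env n, Real.exp (a * ∑ x ∈ L, m x * q x (σ x)) =
      ∏ x, (fun x τ => if x ∈ L then Real.exp (a * (m x * q x τ)) else 1) x (σ x) := fun σ => by
    rw [Finset.mul_sum, Real.exp_sum, Finset.prod_ite_mem, Finset.univ_inter]
  rw [show (fun σ : Env n => Real.exp (a * ∑ x ∈ L, m x * ∑ k, p x k * if σ x k ∈ B then 1 else 0))
    = fun σ => ∏ x, (fun x τ => if x ∈ L then Real.exp (a * (m x * q x τ)) else 1) x (σ x) from
    funext e, Ex_prod (fun x τ => if x ∈ L then Real.exp (a * (m x * q x τ)) else 1)]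
  have hb : ∀ x, permEx (fun τ => if x ∈ L then Real.exp (a * (m x * q x τ)) else 1) ≤
      if x ∈ L then Real.exp (2 * a * η * m x) else 1 := by
    intro x
    by_cases hx : x ∈ L
    · simp only [hx, if_true]
      have hn0 : (0 : ℝ) < n := by exact_mod_cast x.pos
      have hqm : permEx (q x) = B.card / n := by
        rw [hq, permEx_sum]
        simp only [permEx_mul_left, permEx_apply (fun z => if z ∈ B then (1 : ℝ) else 0)]
        rw [← Finset.sum_mul, hrow, one_mul]
        simp
      have hpt : ∀ τ, Real.exp (a * (m x * q x τ)) ≤ 1 + (2 * a * m x) * q x τ := fun τ => by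
        have h0 : 0 ≤ a * m x := mul_nonneg ha (hm x hx)
        have hu0 : 0 ≤ a * m x * q x τ := mul_nonneg h0 (hq0 x τ)
        have hu1 : a * m x * q x τ ≤ 1 := mul_le_one₀ (ham x hx) (hq0 _ _) (hq1 _ _)
        have := (abs_le.1 (Real.abs_exp_sub_one_sub_id_le (x := a * m x * q x τ)
          (abs_le.2 ⟨by linarith, hu1⟩))).2
        rw [← mul_assoc]
        nlinarith
      refine (permEx_mono hpt).trans ?_
      rw [permEx_add, permEx_const, permEx_mul_left, hqm]
      have hBn : (B.card : ℝ) / n ≤ η := by rwa [div_le_iff₀ hn0]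
      have := Real.add_one_le_exp (2 * a * η * m x)
      have h3 : 2 * a * m x * ((B.card : ℝ) / n) ≤ 2 * a * m x * η :=
        mul_le_mul_of_nonneg_left hBn (by have := hm x hx; positivity)
      linarith
    · simp only [hx, if_false]
      exact (permEx_const 1).le
  refine (Finset.prod_le_prod (fun x _ => permEx_nonneg fun τ => ?_) fun x _ => hb x).trans
    (le_of_eq ?_)
  · split_ifs <;> positivity
  · rw [Finset.mul_sum, Real.exp_sum, Finset.prod_ite_mem, Finset.univ_inter]

/-! ### Exploration from a vertex and the exit words -/

/-- Words of length less than `T`. -/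
noncomputable def wordsLT (n T : ℕ) : Finset (List (Fin n)) := (Finset.range T).biUnion (words n)

lemma mem_wordsLT {T : ℕ} {κ : List (Fin n)} : κ ∈ wordsLT n T ↔ κ.length < T := by
  simp [wordsLT, mem_words]

lemma sum_wordsLT {M : Type*} [AddCommMonoid M] (T : ℕ) (f : List (Fin n) → M) :
    ∑ κ ∈ wordsLT n T, f κ = ∑ u ∈ Finset.range T, ∑ κ ∈ words n u, f κ := by
  refine Finset.sum_biUnion fun a _ b _ hab => ?_
  rw [Function.onFun, Finset.disjoint_left]
  intro κ ha hb
  exact hab ((mem_words.1 ha).symm.trans (mem_words.1 hb))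

/-- The vertices reached from `x` by words of length less than `T` and weight at least `θ`. -/
noncomputable def explore (p : Fin n → Fin n → ℝ) (T : ℕ) (θ : ℝ) (σ : Env n) (x : Fin n) :
    Finset (Fin n) :=
  ((wordsLT n T).filter fun κ => θ ≤ wt p σ x κ).image (run σ x)

/-- The words, of length less than `N` and satisfying `Q`, that leave the explored set at their
endpoint for the first time. -/
noncomputable def exits (p : Fin n → Fin n → ℝ) (T : ℕ) (θ : ℝ) (N : ℕ) (Q : ℕ → ℝ → Prop)
    (σ : Env n) (x : Fin n) : Finset (List (Fin n)) :=
  (wordsLT n N).filter fun κ => (∀ y ∈ tails σ x κ, y ∈ explore p T θ σ x) ∧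
    run σ x κ ∉ explore p T θ σ x ∧ Q κ.length (wt p σ x κ)

/-- The endpoints of the exit words. -/
noncomputable def frontier (p : Fin n → Fin n → ℝ) (T : ℕ) (θ : ℝ) (N : ℕ) (Q : ℕ → ℝ → Prop)
    (σ : Env n) (x : Fin n) : Finset (Fin n) :=
  (exits p T θ N Q σ x).image (run σ x)

lemma mem_explore {p : Fin n → Fin n → ℝ} {T : ℕ} {θ : ℝ} {σ : Env n} {x v : Fin n} :
    v ∈ explore p T θ σ x ↔ ∃ κ : List (Fin n), κ.length < T ∧ θ ≤ wt p σ x κ ∧ run σ x κ = v := by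
  simp [explore, mem_wordsLT, and_assoc]

lemma mem_exits {p : Fin n → Fin n → ℝ} {T : ℕ} {θ : ℝ} {N : ℕ} {Q : ℕ → ℝ → Prop} {σ : Env n}
    {x : Fin n} {κ : List (Fin n)} :
    κ ∈ exits p T θ N Q σ x ↔ κ.length < N ∧ (∀ y ∈ tails σ x κ, y ∈ explore p T θ σ x) ∧
      run σ x κ ∉ explore p T θ σ x ∧ Q κ.length (wt p σ x κ) := by
  simp [exits, mem_wordsLT]

lemma frontier_disjoint {p : Fin n → Fin n → ℝ} {T : ℕ} {θ : ℝ} {N : ℕ} {Q : ℕ → ℝ → Prop}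
    {σ : Env n} {x v : Fin n} (hv : v ∈ explore p T θ σ x) : v ∉ frontier p T θ N Q σ x := by
  simp only [frontier, Finset.mem_image, not_exists, not_and]
  rintro κ hκ rfl
  exact (mem_exits.1 hκ).2.2.1 hv

lemma wt_append_le {p : Fin n → Fin n → ℝ} (hp : ∀ i j, 0 ≤ p i j) (h1 : ∀ i j, p i j ≤ 1)
    (σ : Env n) (x : Fin n) (κ κ' : List (Fin n)) : wt p σ x (κ ++ κ') ≤ wt p σ x κ := by
  rw [wt_append]
  exact mul_le_of_le_one_right (wt_nonneg hp _ _ _) (wt_le_one hp h1 _ _ _)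

lemma tails_subset_explore {p : Fin n → Fin n → ℝ} (hp : ∀ i j, 0 ≤ p i j)
    (h1 : ∀ i j, p i j ≤ 1) {T : ℕ} {θ : ℝ} {σ : Env n} {x : Fin n} {κ : List (Fin n)}
    (hT : κ.length ≤ T) (hθ : θ ≤ wt p σ x κ) :
    ∀ y ∈ tails σ x κ, y ∈ explore p T θ σ x := by
  intro y hy
  obtain ⟨κ₁, k, κ₂, rfl, h⟩ := (mem_tails_iff _ _ _ _).1 hy
  refine mem_explore.2 ⟨κ₁, ?_, hθ.trans (wt_append_le hp h1 _ _ _ _), h⟩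
  simp at hT; omega

/-- Changing the rows of the frontier changes neither the explored set nor the exit words. -/
lemma explore_congr {p : Fin n → Fin n → ℝ} (hp : ∀ i j, 0 ≤ p i j) (h1 : ∀ i j, p i j ≤ 1)
    {T : ℕ} {θ : ℝ} {σ σ' : Env n} {x : Fin n}
    (h : ∀ y ∈ explore p T θ σ x, σ y = σ' y) : explore p T θ σ' x = explore p T θ σ x := by
  have key : ∀ κ : List (Fin n), κ.length < T → θ ≤ wt p σ' x κ →
      run σ' x κ = run σ x κ ∧ wt p σ' x κ = wt p σ x κ := by
    intro κ
    induction κ using List.reverseRecOn with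
    | nil => simp
    | append_singleton κ k ih =>
      intro hl hw
      simp only [List.length_append, List.length_singleton] at hl
      have hw' := hw.trans (wt_append_le hp h1 _ _ _ _)
      obtain ⟨e1, e2⟩ := ih (by omega) hw'
      have hv : run σ x κ ∈ explore p T θ σ x := mem_explore.2 ⟨κ, by omega, e2 ▸ hw', rfl⟩
      rw [run_append, run_append, wt_append, wt_append, e1, e2]
      simp [h _ hv]
  ext v
  constructor
  · intro hv
    obtain ⟨κ, hl, hw, rfl⟩ := mem_explore.1 hv
    obtain ⟨e1, e2⟩ := key κ hl hw
    exact mem_explore.2 ⟨κ, hl, e2 ▸ hw, e1.symm⟩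
  · intro hv
    obtain ⟨κ, hl, hw, rfl⟩ := mem_explore.1 hv
    obtain ⟨e1, e2, -⟩ := walk_congr (p := p) (p' := p)
      (fun y hy => h y (tails_subset_explore hp h1 hl.le hw y hy)) (fun _ _ _ => rfl)
    exact mem_explore.2 ⟨κ, hl, e2 ▸ hw, e1⟩

lemma walk_congr_of_exits {p : Fin n → Fin n → ℝ} {T : ℕ} {θ : ℝ} {N : ℕ} {Q : ℕ → ℝ → Prop}
    {σ σ' : Env n} {x : Fin n} (h : ∀ y ∈ explore p T θ σ x, σ y = σ' y) {κ : List (Fin n)}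
    (hκ : κ ∈ exits p T θ N Q σ x) :
    run σ' x κ = run σ x κ ∧ wt p σ' x κ = wt p σ x κ ∧ tails σ' x κ = tails σ x κ :=
  walk_congr (fun y hy => h y ((mem_exits.1 hκ).2.1 y hy)) (fun _ _ _ => rfl)

lemma exits_congr {p : Fin n → Fin n → ℝ} (hp : ∀ i j, 0 ≤ p i j) (h1 : ∀ i j, p i j ≤ 1)
    {T : ℕ} {θ : ℝ} {N : ℕ} {Q : ℕ → ℝ → Prop} {σ σ' : Env n} {x : Fin n}
    (h : ∀ y ∈ explore p T θ σ x, σ y = σ' y) : exits p T θ N Q σ' x = exits p T θ N Q σ x := by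
  have he := explore_congr hp h1 h
  have h' : ∀ y ∈ explore p T θ σ' x, σ' y = σ y := fun y hy => (h y (he ▸ hy)).symm
  ext κ
  constructor
  · intro hκ
    obtain ⟨e1, e2, e3⟩ := walk_congr_of_exits h' hκ
    have := mem_exits.1 hκ
    rw [mem_exits, e1, e2, e3, ← he]
    exact this
  · intro hκ
    obtain ⟨e1, e2, e3⟩ := walk_congr_of_exits h hκ
    have := mem_exits.1 hκ
    rw [mem_exits, e1, e2, e3, he]
    exact this

lemma frontier_congr {p : Fin n → Fin n → ℝ} (hp : ∀ i j, 0 ≤ p i j) (h1 : ∀ i j, p i j ≤ 1)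
    {T : ℕ} {θ : ℝ} {N : ℕ} {Q : ℕ → ℝ → Prop} {σ σ' : Env n} {x : Fin n}
    (h : ∀ y ∈ explore p T θ σ x, σ y = σ' y) :
    frontier p T θ N Q σ' x = frontier p T θ N Q σ x := by
  unfold frontier
  rw [exits_congr hp h1 h]
  exact Finset.image_congr fun κ hκ => (walk_congr_of_exits h hκ).1

/-- Mass of the exit words with a given endpoint. -/
noncomputable def exitMass (p : Fin n → Fin n → ℝ) (T : ℕ) (θ : ℝ) (N : ℕ) (Q : ℕ → ℝ → Prop)
    (σ : Env n) (x v : Fin n) : ℝ :=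
  ∑ κ ∈ exits p T θ N Q σ x, if run σ x κ = v then wt p σ x κ else 0

lemma exitMass_nonneg {p : Fin n → Fin n → ℝ} (hp : ∀ i j, 0 ≤ p i j) (T : ℕ) (θ : ℝ) (N : ℕ)
    (Q : ℕ → ℝ → Prop) (σ : Env n) (x v : Fin n) : 0 ≤ exitMass p T θ N Q σ x v :=
  Finset.sum_nonneg fun κ _ => by split_ifs; exacts [wt_nonneg hp _ _ _, le_rfl]

lemma exitMass_congr {p : Fin n → Fin n → ℝ} (hp : ∀ i j, 0 ≤ p i j) (h1 : ∀ i j, p i j ≤ 1)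
    {T : ℕ} {θ : ℝ} {N : ℕ} {Q : ℕ → ℝ → Prop} {σ σ' : Env n} {x : Fin n}
    (h : ∀ y ∈ explore p T θ σ x, σ y = σ' y) (v : Fin n) :
    exitMass p T θ N Q σ' x v = exitMass p T θ N Q σ x v := by
  unfold exitMass
  rw [exits_congr hp h1 h]
  refine Finset.sum_congr rfl fun κ hκ => ?_
  obtain ⟨e1, e2, -⟩ := walk_congr_of_exits h hκ
  rw [e1, e2]

lemma sum_exits_eq (p : Fin n → Fin n → ℝ) (T : ℕ) (θ : ℝ) (N : ℕ) (Q : ℕ → ℝ → Prop)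
    (σ : Env n) (x : Fin n) (f : Fin n → ℝ) :
    ∑ κ ∈ exits p T θ N Q σ x, wt p σ x κ * f (run σ x κ) =
      ∑ v ∈ frontier p T θ N Q σ x, exitMass p T θ N Q σ x v * f v := by
  simp only [exitMass, Finset.sum_mul]
  rw [Finset.sum_comm]
  refine Finset.sum_congr rfl fun κ hκ => ?_
  rw [Finset.sum_eq_single (run σ x κ)]
  · simp
  · intro v _ hv; simp [hv.symm]
  · intro h; exact absurd (Finset.mem_image_of_mem _ hκ) h

/-- A word has at most one prefix in a prefix-free family. -/
def PrefixFree (A : Finset (List (Fin n))) : Prop :=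
  ∀ κ ∈ A, ∀ κ' ∈ A, κ <+: κ' → κ = κ'

lemma exits_prefixFree (p : Fin n → Fin n → ℝ) (T : ℕ) (θ : ℝ) (N : ℕ) (Q : ℕ → ℝ → Prop)
    (σ : Env n) (x : Fin n) : PrefixFree (exits p T θ N Q σ x) := by
  rintro κ hκ κ' hκ' ⟨ρ, rfl⟩
  cases ρ with
  | nil => simp
  | cons k ρ =>
    refine absurd ((mem_exits.1 hκ').2.1 (run σ x κ) ?_) (mem_exits.1 hκ).2.2.1
    exact (mem_tails_iff _ _ _ _).2 ⟨κ, k, ρ, rfl, rfl⟩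

/-- Summing over the extensions of a prefix-free family. -/
lemma sum_prefixFree_le {A : Finset (List (Fin n))} (hA : PrefixFree A) {T : ℕ}
    (hT : ∀ κ ∈ A, κ.length ≤ T) {f : List (Fin n) → ℝ} (hf : ∀ κ, 0 ≤ f κ) :
    ∑ κ ∈ A, ∑ κ' ∈ words n (T - κ.length), f (κ ++ κ') ≤ ∑ κ ∈ words n T, f κ := by
  rw [← Finset.sum_sigma A (fun κ => words n (T - κ.length)) (fun q => f (q.1 ++ q.2))]
  rw [← Finset.sum_image (s := A.sigma fun κ => words n (T - κ.length))
    (g := fun q => q.1 ++ q.2) (f := f)]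
  · refine Finset.sum_le_sum_of_subset_of_nonneg ?_ fun κ _ _ => hf κ
    intro ρ hρ
    simp only [Finset.mem_image, Finset.mem_sigma, mem_words] at hρ ⊢
    obtain ⟨⟨κ, κ'⟩, ⟨h1, h2⟩, rfl⟩ := hρ
    have := hT κ h1
    simp only [List.length_append] at h2 ⊢
    omega
  · rintro ⟨κ, κ'⟩ hq ⟨ρ, ρ'⟩ hr h
    simp only [Finset.coe_sigma, Set.mem_sigma_iff, Finset.mem_coe] at hq hr
    simp only at h
    have hκρ : κ = ρ := by
      have h1 : κ <+: κ ++ κ' := List.prefix_append _ _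
      have h2 : ρ <+: κ ++ κ' := h ▸ List.prefix_append _ _
      rcases List.prefix_or_prefix_of_prefix h1 h2 with h3 | h3
      · exact hA _ hq.1 _ hr.1 h3
      · exact (hA _ hr.1 _ hq.1 h3).symm
    subst hκρ
    simpa using h

/-- Number of words of a given length and weight at least `θ`. -/
lemma card_heavy_words_le {p : Fin n → Fin n → ℝ} (hp : ∀ i j, 0 ≤ p i j)
    (hp1 : ∀ i, ∑ j, p i j ≤ 1) {θ : ℝ} (hθ : 0 < θ) (σ : Env n) (x : Fin n) (T : ℕ) :
    (((words n T).filter fun κ => θ ≤ wt p σ x κ).card : ℝ) ≤ 1 / θ := by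
  rw [le_div_iff₀ hθ]
  calc _ = ∑ κ ∈ (words n T).filter (fun κ => θ ≤ wt p σ x κ), θ := by simp
    _ ≤ ∑ κ ∈ (words n T).filter (fun κ => θ ≤ wt p σ x κ), wt p σ x κ :=
        Finset.sum_le_sum fun κ hκ => (Finset.mem_filter.1 hκ).2
    _ ≤ ∑ κ ∈ words n T, wt p σ x κ :=
        Finset.sum_le_sum_of_subset_of_nonneg (Finset.filter_subset _ _) fun κ _ _ =>
          wt_nonneg hp _ _ _
    _ ≤ 1 := sum_wt_le_one hp hp1 σ x T

lemma card_heavy_wordsLT_le {p : Fin n → Fin n → ℝ} (hp : ∀ i j, 0 ≤ p i j)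
    (hp1 : ∀ i, ∑ j, p i j ≤ 1) {θ : ℝ} (hθ : 0 < θ) (σ : Env n) (x : Fin n) (T : ℕ) :
    (((wordsLT n T).filter fun κ => θ ≤ wt p σ x κ).card : ℝ) ≤ T / θ := by
  rw [wordsLT, Finset.filter_biUnion]
  have h1 : ((((Finset.range T).biUnion fun u => (words n u).filter fun κ =>
      θ ≤ wt p σ x κ).card : ℕ) : ℝ) ≤
      ∑ u ∈ Finset.range T, (((words n u).filter fun κ => θ ≤ wt p σ x κ).card : ℝ) := by
    exact_mod_cast Finset.card_biUnion_le
  refine h1.trans ((Finset.sum_le_sum fun u _ =>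
    card_heavy_words_le hp hp1 hθ σ x u).trans (le_of_eq ?_))
  simp [div_eq_mul_inv]

lemma card_explore_le {p : Fin n → Fin n → ℝ} (hp : ∀ i j, 0 ≤ p i j)
    (hp1 : ∀ i, ∑ j, p i j ≤ 1) {θ : ℝ} (hθ : 0 < θ) (σ : Env n) (x : Fin n) (T : ℕ) :
    ((explore p T θ σ x).card : ℝ) ≤ T / θ :=
  le_trans (by exact_mod_cast Finset.card_image_le) (card_heavy_wordsLT_le hp hp1 hθ σ x T)

lemma card_frontier_le {p : Fin n → Fin n → ℝ} (hp : ∀ i j, 0 ≤ p i j)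
    (hp1 : ∀ i, ∑ j, p i j ≤ 1) {θ' : ℝ} (hθ' : 0 < θ') {Q : ℕ → ℝ → Prop}
    (hQ : ∀ u w, Q u w → θ' ≤ w) (σ : Env n) (x : Fin n) (T : ℕ) (θ : ℝ) (N : ℕ) :
    ((frontier p T θ N Q σ x).card : ℝ) ≤ N / θ' := by
  refine le_trans ?_ (card_heavy_wordsLT_le hp hp1 hθ' σ x N)
  refine le_trans (Nat.cast_le.2 Finset.card_image_le) (Nat.cast_le.2 (Finset.card_le_card ?_))
  intro κ hκ
  have := mem_exits.1 hκ
  exact Finset.mem_filter.2 ⟨mem_wordsLT.2 this.1, hQ _ _ this.2.2.2⟩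

/-! ### Reaching a typical vertex from an arbitrary one -/

/-- No three distinct words of the same length at most `s` and weight at least `θ` lead from `x`
to the same vertex. -/
def AtMostTwo (p : Fin n → Fin n → ℝ) (s : ℕ) (θ : ℝ) (σ : Env n) (x : Fin n) : Prop :=
  ∀ u < s + 1, ∀ v, ((words n u).filter fun κ => θ ≤ wt p σ x κ ∧ run σ x κ = v).card ≤ 2

lemma Pr_not_atMostTwo_le {p : Fin n → Fin n → ℝ} (hp : ∀ i j, 0 ≤ p i j)
    (hp1 : ∀ i, ∑ j, p i j ≤ 1) {s : ℕ} (hn : 2 * (3 * s + 2) ^ 2 ≤ n) {θ : ℝ} (hθ : 0 < θ) :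
    Pr n (fun σ => ∃ x, ¬ AtMostTwo p s θ σ x) ≤
      n * ((s + 1) * (6 * ((3 * (s : ℝ) + 2) ^ 2 / n) ^ 2 / θ ^ 3)) := by
  refine (Pr_exists_le _).trans ((Finset.sum_le_sum fun x _ =>
    (?_ : _ ≤ ((s : ℝ) + 1) * (6 * ((3 * (s : ℝ) + 2) ^ 2 / n) ^ 2 / θ ^ 3))).trans ?_)
  · have h1 : Pr n (fun σ => ¬ AtMostTwo p s θ σ x) ≤ Pr n (fun σ => ∃ u : Fin (s + 1),
        ∃ v, 2 < ((words n u).filter fun κ => θ ≤ wt p σ x κ ∧ run σ x κ = v).card) := by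
      refine Pr_mono fun σ h => ?_
      simp only [AtMostTwo, not_forall, not_le] at h
      obtain ⟨u, hu, v, h⟩ := h
      exact ⟨⟨u, hu⟩, v, h⟩
    refine h1.trans ((Pr_exists_le _).trans ((Finset.sum_le_sum fun u _ =>
      (?_ : _ ≤ 6 * ((3 * (s : ℝ) + 2) ^ 2 / n) ^ 2 / θ ^ 3)).trans ?_))
    · have hu : (u : ℕ) ≤ s := by omega
      have hn' : 2 * (3 * (u : ℕ) + 2) ^ 2 ≤ n := le_trans (by gcongr) hn
      have h3 := three_words_bound hp hp1 u hn' x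
      set f : Env n → ℝ := fun σ => ∑ κ ∈ words n u, wt p σ x κ * ∑ κ' ∈ words n u,
        wt p σ x κ' * ∑ κ'' ∈ words n u, wt p σ x κ'' *
        ind (run σ x κ = run σ x κ' ∧ run σ x κ = run σ x κ'' ∧ κ ≠ κ' ∧ κ ≠ κ'' ∧ κ' ≠ κ'')
        with hf
      have w0 := fun σ κ => wt_nonneg hp σ x κ
      have c0 : ∀ σ κ κ', 0 ≤ ∑ κ'' ∈ words n u, wt p σ x κ'' *
          ind (run σ x κ = run σ x κ' ∧ run σ x κ = run σ x κ'' ∧ κ ≠ κ' ∧ κ ≠ κ'' ∧ κ' ≠ κ'') :=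
        fun σ κ κ' => Finset.sum_nonneg fun κ'' _ => mul_nonneg (w0 _ _) (ind_nonneg _)
      have b0 : ∀ σ κ, 0 ≤ ∑ κ' ∈ words n u,
          wt p σ x κ' * ∑ κ'' ∈ words n u, wt p σ x κ'' *
          ind (run σ x κ = run σ x κ' ∧ run σ x κ = run σ x κ'' ∧ κ ≠ κ' ∧ κ ≠ κ'' ∧ κ' ≠ κ'') :=
        fun σ κ => Finset.sum_nonneg fun κ' _ => mul_nonneg (w0 _ _) (c0 _ _ _)
      refine (Pr_le_Ex_div (f := f) (fun σ => Finset.sum_nonneg fun κ _ =>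
        mul_nonneg (w0 _ _) (b0 _ _)) (pow_pos hθ 3) ?_).trans
        (div_le_div_of_nonneg_right (h3.trans ?_) (pow_pos hθ 3).le)
      · rintro σ ⟨v, hv⟩
        obtain ⟨a, b, c, ha, hb, hc, hab, hac, hbc⟩ := Finset.two_lt_card_iff.1 hv
        simp only [Finset.mem_filter] at ha hb hc
        have i1 : wt p σ x a * (wt p σ x b * wt p σ x c) ≤ f σ := by
          refine le_trans ?_ (Finset.single_le_sum (fun κ _ => mul_nonneg (w0 _ _) (b0 _ _)) ha.1)
          refine mul_le_mul_of_nonneg_left ?_ (w0 _ _)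
          refine le_trans ?_ (Finset.single_le_sum
            (fun κ _ => mul_nonneg (w0 _ _) (c0 _ _ _)) hb.1)
          refine mul_le_mul_of_nonneg_left ?_ (w0 _ _)
          refine le_trans ?_ (Finset.single_le_sum
            (fun κ _ => mul_nonneg (w0 _ _) (ind_nonneg _)) hc.1)
          rw [ind_of ⟨by rw [ha.2.2, hb.2.2], by rw [ha.2.2, hc.2.2], hab, hac, hbc⟩, mul_one]
        refine le_trans ?_ i1
        calc θ ^ 3 = θ * (θ * θ) := by ring
          _ ≤ _ := by
            have := ha.2.1; have := hb.2.1; have := hc.2.1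
            gcongr
            · exact w0 _ _
            · exact w0 _ _
      · have : (u : ℝ) ≤ s := by exact_mod_cast hu
        gcongr
    · simp
  · simp

lemma sum_atMostTwo_le {p : Fin n → Fin n → ℝ} {s : ℕ} {θ b : ℝ}
    (hb : 0 ≤ b) {σ : Env n} {x : Fin n} (h : AtMostTwo p s θ σ x) (v : Fin n) :
    ∑ κ ∈ (wordsLT n (s + 1)).filter (fun κ => θ ≤ wt p σ x κ ∧ wt p σ x κ ≤ b ∧ run σ x κ = v),
      wt p σ x κ ≤ 2 * (s + 1) * b := by
  rw [Finset.sum_filter, sum_wordsLT]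
  calc _ ≤ ∑ u ∈ Finset.range (s + 1), 2 * b := Finset.sum_le_sum fun u hu => ?_
    _ = _ := by simp; ring
  have hc := h u (Finset.mem_range.1 hu) v
  calc _ ≤ ∑ κ ∈ words n u, if θ ≤ wt p σ x κ ∧ run σ x κ = v then b else 0 := by
        refine Finset.sum_le_sum fun κ _ => ?_
        by_cases h1 : θ ≤ wt p σ x κ ∧ wt p σ x κ ≤ b ∧ run σ x κ = v
        · rw [if_pos h1, if_pos ⟨h1.1, h1.2.2⟩]; exact h1.2.1
        · rw [if_neg h1]; split_ifs; exacts [hb, le_rfl]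
    _ = (((words n u).filter fun κ => θ ≤ wt p σ x κ ∧ run σ x κ = v).card : ℝ) * b := by
        rw [← Finset.sum_filter, Finset.sum_const, nsmul_eq_mul]
    _ ≤ 2 * b := mul_le_mul_of_nonneg_right (by exact_mod_cast hc) hb

lemma exitMass_le_of_atMostTwo {p : Fin n → Fin n → ℝ} (hp : ∀ i j, 0 ≤ p i j) {s : ℕ}
    {θ θc : ℝ} (hθ : 0 ≤ θ) {σ : Env n} {x : Fin n} (h : AtMostTwo p s θc σ x) (v : Fin n) :
    exitMass p (s + 1) θ (s + 1) (fun _ w => θc ≤ w) σ x v ≤ 2 * (s + 1) * θ := by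
  refine le_trans ?_ (sum_atMostTwo_le hθ h v)
  rw [exitMass, ← Finset.sum_filter]
  refine Finset.sum_le_sum_of_subset_of_nonneg ?_ fun κ _ _ => wt_nonneg hp _ _ _
  intro κ hκ
  rw [Finset.mem_filter, mem_exits] at hκ
  obtain ⟨⟨h1, -, h2, h3⟩, h4⟩ := hκ
  refine Finset.mem_filter.2 ⟨mem_wordsLT.2 h1, h3, ?_, h4⟩
  by_contra hc
  exact h2 (mem_explore.2 ⟨κ, h1, (not_le.1 hc).le, rfl⟩)

lemma sum_prefix_wt_le {p : Fin n → Fin n → ℝ} (hp : ∀ i j, 0 ≤ p i j)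
    (hp1 : ∀ i, ∑ j, p i j ≤ 1) (σ : Env n) (x : Fin n) (s : ℕ) {ρ : List (Fin n)}
    (hρ : ρ.length ≤ s) :
    ∑ κ ∈ words n s, (if ρ <+: κ then wt p σ x κ else 0) ≤ wt p σ x ρ := by
  have hs : s = ρ.length + (s - ρ.length) := by omega
  rw [hs, sum_words_add, Finset.sum_eq_single ρ]
  · simp only [List.prefix_append, if_true, wt_append, ← Finset.mul_sum]
    exact mul_le_of_le_one_right (wt_nonneg hp _ _ _) (sum_wt_le_one hp hp1 _ _ _)
  · intro κ hκ hne
    refine Finset.sum_eq_zero fun κ' _ => if_neg fun hpre => hne ?_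
    have hl := mem_words.1 hκ
    exact ((List.prefix_of_prefix_length_le hpre (List.prefix_append κ κ') hl.ge).eq_of_length
      hl.symm).symm
  · intro h; exact absurd (mem_words.2 rfl) h

lemma exists_light_initial {p : Fin n → Fin n → ℝ} (hp : ∀ i j, 0 ≤ p i j) {θ τ : ℝ}
    (hθ : 0 < θ) (hθ1 : θ ≤ 1) {σ : Env n} {x : Fin n} (κ : List (Fin n))
    (hw : wt (trunc τ p) σ x κ ≠ 0) (hl : wt p σ x κ < θ) :
    ∃ ρ, ρ <+: κ ∧ θ * τ ≤ wt p σ x ρ ∧ wt p σ x ρ < θ := by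
  induction κ using List.reverseRecOn with
  | nil => simp at hl; linarith
  | append_singleton κ k ih =>
    rw [wt_append] at hw
    by_cases h : wt p σ x κ < θ
    · obtain ⟨ρ, h1, h2⟩ := ih (left_ne_zero_of_mul hw) h
      exact ⟨ρ, h1.trans (List.prefix_append _ _), h2⟩
    · refine ⟨κ ++ [k], List.prefix_rfl, ?_, hl⟩
      have hk := right_ne_zero_of_mul hw
      simp only [wt_cons, wt_nil, mul_one, trunc] at hk
      rw [wt_append, wt_cons, wt_nil, mul_one]
      have hτ : τ ≤ p (run σ x κ) k := by
        by_contra hc; simp [not_le.1 hc] at hk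
      push Not at h
      calc θ * τ ≤ θ * p (run σ x κ) k := by gcongr
        _ ≤ _ := mul_le_mul_of_nonneg_right h (hp _ _)

lemma exists_exit_initial {V : Finset (Fin n)} {σ : Env n} {x : Fin n} (hx : x ∈ V)
    (κ : List (Fin n)) : (∃ ρ, ρ <+: κ ∧ (∀ y ∈ tails σ x ρ, y ∈ V) ∧ run σ x ρ ∉ V) ∨
      ((∀ y ∈ tails σ x κ, y ∈ V) ∧ run σ x κ ∈ V) := by
  induction κ using List.reverseRecOn with
  | nil => right; simpa using hx
  | append_singleton κ k ih =>
    rcases ih with ⟨ρ, h1, h2⟩ | ⟨h1, h2⟩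
    · exact Or.inl ⟨ρ, h1.trans (List.prefix_append _ _), h2⟩
    · have ht : ∀ y ∈ tails σ x (κ ++ [k]), y ∈ V := by
        intro y hy
        rw [tails_append] at hy
        simp only [tails_cons, tails_nil, List.mem_append, List.mem_singleton] at hy
        rcases hy with hy | rfl
        · exact h1 y hy
        · exact h2
      by_cases h : run σ x (κ ++ [k]) ∈ V
      · exact Or.inr ⟨ht, h⟩
      · exact Or.inl ⟨_, List.prefix_rfl, ht, h⟩

/-- Most of the mass goes through the exit words. -/
lemma exits_cover {p : Fin n → Fin n → ℝ} (hp : ∀ i j, 0 ≤ p i j)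
    (hrow : ∀ i, ∑ j, p i j = 1) {s : ℕ} {θ₁ θ₂ θc τ : ℝ} (h1 : 0 < θ₁) (h11 : θ₁ ≤ 1)
    (h2 : 0 < θ₂) (h21 : θ₂ ≤ 1) (hc : θc ≤ θ₂ * τ) {σ : Env n} {x : Fin n}
    (hA : AtMostTwo p s θc σ x) :
    1 ≤ ∑ κ ∈ exits p (s + 1) θ₁ (s + 1) (fun _ w => θc ≤ w) σ x, wt p σ x κ +
      heavyMass p θ₂ s σ x + (1 - ∑ κ ∈ words n s, wt (trunc τ p) σ x κ) +
      2 * (s + 1) ^ 2 * θ₂ / θ₁ := by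
  have hp1 : ∀ i, ∑ j, p i j ≤ 1 := fun i => (hrow i).le
  have hle1 : ∀ i j, p i j ≤ 1 := fun i j =>
    (Finset.single_le_sum (fun j _ => hp i j) (Finset.mem_univ j)).trans (hp1 i)
  set V := explore p (s + 1) θ₁ σ x with hV
  set E := exits p (s + 1) θ₁ (s + 1) (fun _ w => θc ≤ w) σ x with hE
  set A := (wordsLT n (s + 1)).filter (fun κ => θc ≤ wt p σ x κ ∧ wt p σ x κ ≤ θ₂ ∧ run σ x κ ∈ V)
    with hAdef
  have hxV : x ∈ V := mem_explore.2 ⟨[], by simp, by simpa using h11, rfl⟩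
  have hAsum : ∑ κ ∈ A, wt p σ x κ ≤ 2 * (s + 1) ^ 2 * θ₂ / θ₁ := by
    have e : A ⊆ V.biUnion fun v => (wordsLT n (s + 1)).filter
        (fun κ => θc ≤ wt p σ x κ ∧ wt p σ x κ ≤ θ₂ ∧ run σ x κ = v) := by
      intro κ hκ
      simp only [hAdef, Finset.mem_filter, Finset.mem_biUnion] at hκ ⊢
      exact ⟨_, hκ.2.2.2, hκ.1, hκ.2.1, hκ.2.2.1, rfl⟩
    calc _ ≤ ∑ κ ∈ (V.biUnion fun v => (wordsLT n (s + 1)).filter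
        (fun κ => θc ≤ wt p σ x κ ∧ wt p σ x κ ≤ θ₂ ∧ run σ x κ = v)), wt p σ x κ :=
          Finset.sum_le_sum_of_subset_of_nonneg e fun κ _ _ => wt_nonneg hp _ _ _
      _ = ∑ v ∈ V, ∑ κ ∈ (wordsLT n (s + 1)).filter
        (fun κ => θc ≤ wt p σ x κ ∧ wt p σ x κ ≤ θ₂ ∧ run σ x κ = v), wt p σ x κ := by
          refine Finset.sum_biUnion fun a _ b _ hab => ?_
          rw [Function.onFun, Finset.disjoint_left]
          intro κ ha hb
          exact hab ((Finset.mem_filter.1 ha).2.2.2.symm.trans (Finset.mem_filter.1 hb).2.2.2)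
      _ ≤ ∑ v ∈ V, 2 * (s + 1) * θ₂ := Finset.sum_le_sum fun v _ =>
          sum_atMostTwo_le h2.le hA v
      _ = (V.card : ℝ) * (2 * (s + 1) * θ₂) := by simp
      _ ≤ ((s + 1 : ℕ) / θ₁) * (2 * (s + 1) * θ₂) :=
          mul_le_mul_of_nonneg_right (card_explore_le hp hp1 h1 σ x (s + 1)) (by positivity)
      _ = _ := by push_cast; field_simp
  have key : ∀ κ ∈ words n s, wt p σ x κ ≤ (if θ₂ ≤ wt p σ x κ then wt p σ x κ else 0) +
      (wt p σ x κ - wt (trunc τ p) σ x κ) +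
      (∑ ρ ∈ E, if ρ <+: κ then wt p σ x κ else 0) +
      ∑ ρ ∈ A, if ρ <+: κ then wt p σ x κ else 0 := by
    intro κ hκ
    have w0 := wt_nonneg hp σ x κ
    have a1 : 0 ≤ wt p σ x κ - wt (trunc τ p) σ x κ :=
      sub_nonneg.2 (wt_mono (trunc_nonneg hp τ) (trunc_le hp τ) σ x κ)
    have a2 : 0 ≤ ∑ ρ ∈ E, if ρ <+: κ then wt p σ x κ else 0 :=
      Finset.sum_nonneg fun ρ _ => by split_ifs; exacts [w0, le_rfl]
    have a3 : 0 ≤ ∑ ρ ∈ A, if ρ <+: κ then wt p σ x κ else 0 :=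
      Finset.sum_nonneg fun ρ _ => by split_ifs; exacts [w0, le_rfl]
    by_cases b1 : θ₂ ≤ wt p σ x κ
    · rw [if_pos b1]; linarith
    rw [if_neg b1]
    by_cases b2 : wt (trunc τ p) σ x κ = 0
    · rw [b2]; rw [b2] at a1; linarith
    obtain ⟨ρ, r1, r2, r3⟩ := exists_light_initial hp h2 h21 κ b2 (not_le.1 b1)
    have rl : ρ.length < s + 1 := by have := r1.length_le; rw [mem_words.1 hκ] at this; omega
    have rc : θc ≤ wt p σ x ρ := hc.trans r2
    by_cases b3 : run σ x ρ ∈ V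
    · have hm : ρ ∈ A := Finset.mem_filter.2 ⟨mem_wordsLT.2 rl, rc, r3.le, b3⟩
      have := Finset.single_le_sum (f := fun ρ => if ρ <+: κ then wt p σ x κ else 0)
        (fun ρ _ => by split_ifs; exacts [w0, le_rfl]) hm
      simp only [r1, if_true] at this
      linarith
    · rcases exists_exit_initial (σ := σ) hxV ρ with ⟨ν, n1, n2, n3⟩ | ⟨_, h⟩
      · obtain ⟨μ, rfl⟩ := n1
        have hm : ν ∈ E := mem_exits.2 ⟨by simp at rl; omega, n2, n3,
          rc.trans (wt_append_le hp hle1 _ _ _ _)⟩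
        have := Finset.single_le_sum (f := fun ρ => if ρ <+: κ then wt p σ x κ else 0)
          (fun ρ _ => by split_ifs; exacts [w0, le_rfl]) hm
        simp only [(List.prefix_append ν μ).trans r1, if_true] at this
        linarith
      · exact absurd h b3
  have hsum := Finset.sum_le_sum key
  rw [sum_wt_eq_one hrow, Finset.sum_add_distrib, Finset.sum_add_distrib, Finset.sum_add_distrib,
    Finset.sum_sub_distrib, sum_wt_eq_one hrow, Finset.sum_comm (s := words n s) (t := E),
    Finset.sum_comm (s := words n s) (t := A)] at hsum
  have eE : ∑ ρ ∈ E, ∑ κ ∈ words n s, (if ρ <+: κ then wt p σ x κ else 0) ≤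
      ∑ ρ ∈ E, wt p σ x ρ := Finset.sum_le_sum fun ρ hρ =>
    sum_prefix_wt_le hp hp1 σ x s (by have := (mem_exits.1 hρ).1; omega)
  have eA : ∑ ρ ∈ A, ∑ κ ∈ words n s, (if ρ <+: κ then wt p σ x κ else 0) ≤
      ∑ ρ ∈ A, wt p σ x ρ := Finset.sum_le_sum fun ρ hρ =>
    sum_prefix_wt_le hp hp1 σ x s
      (by have := mem_wordsLT.1 (Finset.mem_filter.1 hρ).1; omega)
  unfold heavyMass
  linarith

/-- A prefix-free family of words from `x`, of length at most `N` and weight at least `w`, whose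
endpoints avoid `B` and whose total mass is at least `1 - δ`. -/
def Reaches (p : Fin n → Fin n → ℝ) (N : ℕ) (w δ : ℝ) (B : Finset (Fin n)) (σ : Env n)
    (x : Fin n) : Prop :=
  ∃ A : Finset (List (Fin n)), PrefixFree A ∧
    (∀ κ ∈ A, κ.length ≤ N ∧ w ≤ wt p σ x κ ∧ run σ x κ ∉ B) ∧ 1 - δ ≤ ∑ κ ∈ A, wt p σ x κ

lemma prefixFree_extend {A : Finset (List (Fin n))} (hA : PrefixFree A)
    {C : Finset (List (Fin n))} (hC : ∀ κ ∈ C, ∃ ρ ∈ A, ∃ k, κ = ρ ++ [k]) : PrefixFree C := by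
  intro κ hκ κ' hκ' h
  obtain ⟨ρ, hρ, k, rfl⟩ := hC κ hκ
  obtain ⟨ρ', hρ', k', rfl⟩ := hC κ' hκ'
  have h1 : ρ <+: ρ' ++ [k'] := (List.prefix_append _ _).trans h
  have h2 : ρ' <+: ρ' ++ [k'] := List.prefix_append _ _
  have : ρ = ρ' := by
    rcases List.prefix_or_prefix_of_prefix h1 h2 with h3 | h3
    · exact hA _ hρ _ hρ' h3
    · exact (hA _ hρ' _ hρ h3).symm
  subst this
  exact h.eq_of_length (by simp)

lemma sum_prefixFree_wt_le {p : Fin n → Fin n → ℝ} (hp : ∀ i j, 0 ≤ p i j)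
    (hrow : ∀ i, ∑ j, p i j = 1) {A : Finset (List (Fin n))} (hA : PrefixFree A) {T : ℕ}
    (hT : ∀ κ ∈ A, κ.length ≤ T) (σ : Env n) (x : Fin n) : ∑ κ ∈ A, wt p σ x κ ≤ 1 := by
  refine le_trans (le_of_eq ?_) ((sum_prefixFree_le hA hT (fun κ => wt_nonneg hp σ x κ)).trans
    (sum_wt_eq_one hrow σ x T).le)
  refine Finset.sum_congr rfl fun κ _ => ?_
  simp only [wt_append, ← Finset.mul_sum]
  rw [sum_wt_eq_one hrow, mul_one]

/-- One step after the exit words, the walk avoids `B` if `B` is rarely hit. -/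
lemma reaches_of_exits {p : Fin n → Fin n → ℝ} (hp : ∀ i j, 0 ≤ p i j)
    (hrow : ∀ i, ∑ j, p i j = 1) {T N : ℕ} {θ θc τ γ δ₁ δ₂ : ℝ} (hτ : 0 ≤ τ) (hθc : 0 ≤ θc)
    (hγ0 : 0 ≤ γ)
    (hγ : ∀ x, 1 - γ ≤ ∑ k, trunc τ p x k) {σ : Env n} {x : Fin n} {B : Finset (Fin n)}
    (hE : 1 - δ₁ ≤ ∑ κ ∈ exits p T θ N (fun _ w => θc ≤ w) σ x, wt p σ x κ)
    (hY : ∑ v ∈ frontier p T θ N (fun _ w => θc ≤ w) σ x,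
      exitMass p T θ N (fun _ w => θc ≤ w) σ x v * ∑ k, p v k * (if σ v k ∈ B then 1 else 0) ≤ δ₂) :
    Reaches p N (θc * τ) (δ₁ + γ + δ₂) B σ x := by
  set E := exits p T θ N (fun _ w => θc ≤ w) σ x with hEdef
  set D := (E ×ˢ (Finset.univ : Finset (Fin n))).filter
    (fun q => τ ≤ p (run σ x q.1) q.2 ∧ σ (run σ x q.1) q.2 ∉ B) with hD
  have hinj : Set.InjOn (fun q : List (Fin n) × Fin n => q.1 ++ [q.2]) D := by
    rintro ⟨a, b⟩ _ ⟨c, d⟩ _ h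
    have h' := List.append_inj' (show a ++ [b] = c ++ [d] from h) rfl
    simp only [List.cons.injEq, and_true] at h'
    exact Prod.ext h'.1 h'.2
  refine ⟨D.image fun q => q.1 ++ [q.2], ?_, ?_, ?_⟩
  · refine prefixFree_extend
      (exits_prefixFree p T θ N (fun _ w => θc ≤ w) σ x) fun κ hκ => ?_
    obtain ⟨q, hq, rfl⟩ := Finset.mem_image.1 hκ
    exact ⟨q.1, (Finset.mem_product.1 (Finset.mem_filter.1 hq).1).1, q.2, rfl⟩
  · intro κ hκ
    obtain ⟨q, hq, rfl⟩ := Finset.mem_image.1 hκ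
    obtain ⟨h1, h2, h3⟩ := Finset.mem_filter.1 hq
    have h4 := mem_exits.1 (Finset.mem_product.1 h1).1
    refine ⟨by simp; omega, ?_, ?_⟩
    · rw [wt_append, wt_cons, wt_nil, mul_one]
      exact mul_le_mul h4.2.2.2 h2 hτ (hθc.trans h4.2.2.2)
    · rw [run_append]; exact h3
  · rw [Finset.sum_image hinj, hD, Finset.sum_filter, Finset.sum_product]
    rw [← sum_exits_eq p T θ N _ σ x (fun v => ∑ k, p v k * (if σ v k ∈ B then 1 else 0))] at hY
    have key : ∀ κ ∈ E, wt p σ x κ * (1 - γ) -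
        wt p σ x κ * ∑ k, p (run σ x κ) k * (if σ (run σ x κ) k ∈ B then 1 else 0) ≤
        ∑ k, if τ ≤ p (run σ x κ) k ∧ σ (run σ x κ) k ∉ B then wt p σ x (κ ++ [k]) else 0 := by
      intro κ _
      have w0 := wt_nonneg hp σ x κ
      have h1 : wt p σ x κ * (1 - γ) ≤ wt p σ x κ * ∑ k, trunc τ p (run σ x κ) k :=
        mul_le_mul_of_nonneg_left (hγ _) w0
      refine (sub_le_sub_right h1 _).trans ?_
      rw [Finset.mul_sum, Finset.mul_sum, ← Finset.sum_sub_distrib]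
      refine Finset.sum_le_sum fun k _ => ?_
      rw [wt_append, wt_cons, wt_nil, mul_one]
      have hpk := mul_nonneg w0 (hp (run σ x κ) k)
      unfold trunc
      by_cases a : p (run σ x κ) k < τ
      · simp only [a, if_true, not_le.2 a, false_and, if_false]
        split_ifs <;> simp [hpk]
      · by_cases b : σ (run σ x κ) k ∈ B
        · simp [a, b]
        · simp [a, b, not_lt.1 a]
    have hsum := Finset.sum_le_sum key
    rw [Finset.sum_sub_distrib, ← Finset.sum_mul] at hsum
    have hE1 := sum_prefixFree_wt_le hp hrow (exits_prefixFree p T θ N (fun _ w => θc ≤ w) σ x)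
      (fun κ hκ => (mem_exits.1 hκ).1.le) σ x
    nlinarith

/-- For a fixed root, the step following the exit words avoids small sets with overwhelming
probability. -/
lemma Pr_frontier_hit_le {p : Fin n → Fin n → ℝ} (hp : ∀ i j, 0 ≤ p i j)
    (hrow : ∀ i, ∑ j, p i j = 1) {T N : ℕ} {θ : ℝ} {Q : ℕ → ℝ → Prop}
    {B : Finset (Fin n) → Env n → Finset (Fin n)}
    (hB : ∀ W σ σ', (∀ y, y ∉ W → σ y = σ' y) → B W σ' = B W σ) {η δ b : ℝ}
    (hb : 0 < b) (hη : 0 ≤ η) (x : Fin n) :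
    Pr n (fun σ => (∀ v, exitMass p T θ N Q σ x v ≤ b) ∧
      ((B (explore p T θ σ x ∪ frontier p T θ N Q σ x) σ).card : ℝ) ≤ η * n ∧
      ∑ v ∈ frontier p T θ N Q σ x, exitMass p T θ N Q σ x v ≤ 1 ∧
      δ < ∑ v ∈ frontier p T θ N Q σ x, exitMass p T θ N Q σ x v *
        ∑ k, p v k * (if σ v k ∈ B (explore p T θ σ x ∪ frontier p T θ N Q σ x) σ then 1 else 0)) ≤
      Real.exp ((2 * η - δ) / b) := by
  have hle1 : ∀ i j, p i j ≤ 1 := fun i j =>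
    (Finset.single_le_sum (fun j _ => hp i j) (Finset.mem_univ j)).trans (hrow i).le
  rw [Pr_eq_Ex, ← Ex_const (n := n) (Real.exp ((2 * η - δ) / b))]
  have hV : ∀ σ σ' : Env n, (∀ y ∈ (frontier p T θ N Q σ x)ᶜ, σ y = σ' y) →
      ∀ y ∈ explore p T θ σ x, σ y = σ' y := fun σ σ' h y hy =>
    h y (Finset.mem_compl.2 (frontier_disjoint hy))
  refine Ex_le_Ex_of_mix (fun σ => (frontier p T θ N Q σ x)ᶜ)
    (fun σ σ' h => by rw [frontier_congr hp hle1 (hV σ σ' h)]) fun σ => ?_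
  set L := frontier p T θ N Q σ x with hL
  set V := explore p T θ σ x with hVdef
  set m := exitMass p T θ N Q σ x with hm
  set B₀ := B (V ∪ L) σ with hB₀
  have hm0 : ∀ v, 0 ≤ m v := exitMass_nonneg hp T θ N Q σ x
  have e0 : ∀ σ' : Env n, ∀ y ∈ V, σ y = mix Lᶜ σ σ' y := fun σ' y hy =>
    (mix_apply_of_mem (Finset.mem_compl.2 (frontier_disjoint hy)) σ σ').symm
  have e1 : ∀ σ', explore p T θ (mix Lᶜ σ σ') x = V := fun σ' => explore_congr hp hle1 (e0 σ')
  have e2 : ∀ σ', frontier p T θ N Q (mix Lᶜ σ σ') x = L := fun σ' =>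
    frontier_congr hp hle1 (e0 σ')
  have e3 : ∀ σ' v, exitMass p T θ N Q (mix Lᶜ σ σ') x v = m v := fun σ' v =>
    exitMass_congr hp hle1 (e0 σ') v
  have e4 : ∀ σ', B (V ∪ L) (mix Lᶜ σ σ') = B₀ := fun σ' => hB _ _ _ fun y hy =>
    (mix_apply_of_mem (Finset.mem_compl.2 fun h => hy (Finset.mem_union_right _ h)) σ σ').symm
  simp only [e1, e2, e3, e4]
  by_cases hg : (∀ v, m v ≤ b) ∧ (B₀.card : ℝ) ≤ η * n ∧ ∑ v ∈ L, m v ≤ 1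
  · have hfl : ∀ σ' : Env n, ∑ v ∈ L, m v *
        ∑ k, p v k * (if mix Lᶜ σ σ' v k ∈ B₀ then 1 else 0) =
        ∑ v ∈ L, m v * ∑ k, p v k * (if σ' v k ∈ B₀ then 1 else 0) := fun σ' =>
      Finset.sum_congr rfl fun v hv => by
        rw [mix_apply_of_notMem (by simpa using hv) σ σ']
    simp only [hfl]
    have hX := Ex_exp_row_le hp hrow L B₀ (fun v _ => hm0 v) (a := 1 / b) (η := η) (by positivity)
      (fun v _ => by rw [one_div, inv_mul_le_iff₀ hb, mul_one]; exact hg.1 v) hg.2.1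
    have hpt : ∀ σ' : Env n, (if (∀ v, m v ≤ b) ∧ (B₀.card : ℝ) ≤ η * n ∧ ∑ v ∈ L, m v ≤ 1 ∧
        δ < ∑ v ∈ L, m v * ∑ k, p v k * (if σ' v k ∈ B₀ then 1 else 0) then (1 : ℝ) else 0) ≤
        Real.exp (-(1 / b) * δ) * Real.exp (1 / b * ∑ v ∈ L, m v *
          ∑ k, p v k * if σ' v k ∈ B₀ then 1 else 0) := fun σ' => by
      rw [← Real.exp_add]
      split_ifs with h
      · rw [Real.one_le_exp_iff]
        have : 1 / b * δ ≤ 1 / b * ∑ v ∈ L, m v * ∑ k, p v k * if σ' v k ∈ B₀ then 1 else 0 :=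
          mul_le_mul_of_nonneg_left h.2.2.2.le (by positivity)
        linarith
      · positivity
    refine (Ex_mono hpt).trans ?_
    rw [Ex_mul_left]
    refine (mul_le_mul_of_nonneg_left hX (Real.exp_pos _).le).trans ?_
    rw [← Real.exp_add, Real.exp_le_exp]
    have : 2 * (1 / b) * η * ∑ v ∈ L, m v ≤ 2 * (1 / b) * η * 1 :=
      mul_le_mul_of_nonneg_left hg.2.2 (by positivity)
    calc _ ≤ -(1 / b) * δ + 2 * (1 / b) * η * 1 := by linarith
      _ = _ := by field_simp; ring
  · have : ∀ σ' : Env n, ¬ ((∀ v, m v ≤ b) ∧ (B₀.card : ℝ) ≤ η * n ∧ ∑ v ∈ L, m v ≤ 1 ∧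
        δ < ∑ v ∈ L, m v * ∑ k, p v k * (if mix Lᶜ σ σ' v k ∈ B₀ then 1 else 0)) :=
      fun σ' h => hg ⟨h.1, h.2.1, h.2.2.1⟩
    simp only [this, if_false, Ex_const]
    positivity

/-- With high probability, every vertex reaches the complement of `B W σ`, for a small set `W`. -/
lemma Pr_reaches {p : Fin n → Fin n → ℝ} (hp : ∀ i j, 0 ≤ p i j)
    (hrow : ∀ i, ∑ j, p i j = 1) {s : ℕ} {θ₁ θ₂ θc τ γ δ η ε₁ ε₂ K : ℝ}
    (h1 : 0 < θ₁) (h11 : θ₁ ≤ 1) (h2 : 0 < θ₂) (h21 : θ₂ ≤ 1) (hc0 : 0 < θc) (hτ : 0 ≤ τ)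
    (hc : θc ≤ θ₂ * τ) (hγ0 : 0 ≤ γ) (hγ1 : γ ≤ 1) (hγ : ∀ x, 1 - γ ≤ ∑ k, trunc τ p x k)
    (hη : 0 ≤ η) (hK : (s + 1) / θ₁ + (s + 1) / θc ≤ K)
    {B : Finset (Fin n) → Env n → Finset (Fin n)}
    (hB : ∀ W σ σ', (∀ y, y ∉ W → σ y = σ' y) → B W σ' = B W σ)
    (hheavy : Pr n (fun σ => ∃ x, δ < heavyMass p θ₂ s σ x) ≤ ε₁)
    (htwo : Pr n (fun σ => ∃ x, ¬ AtMostTwo p s θc σ x) ≤ ε₂) :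
    Pr n (fun σ => (∀ W : Finset (Fin n), (W.card : ℝ) ≤ K → ((B W σ).card : ℝ) ≤ η * n) ∧
      ∃ x, ∀ W : Finset (Fin n), (W.card : ℝ) ≤ K → ¬ Reaches p (s + 1) (θc * τ)
        (δ + s * γ + 2 * (s + 1) ^ 2 * θ₂ / θ₁ + γ + δ) (B W σ) σ x) ≤
      ε₁ + ε₂ + n * Real.exp ((2 * η - δ) / (2 * (s + 1) * θ₁)) := by
  have hp1 : ∀ i, ∑ j, p i j ≤ 1 := fun i => (hrow i).le
  set Q : ℕ → ℝ → Prop := fun _ w => θc ≤ w with hQ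
  set T := s + 1 with hT
  set E : Fin n → Env n → Prop := fun x σ =>
    (∀ v, exitMass p T θ₁ T Q σ x v ≤ 2 * (s + 1) * θ₁) ∧
      ((B (explore p T θ₁ σ x ∪ frontier p T θ₁ T Q σ x) σ).card : ℝ) ≤ η * n ∧
      ∑ v ∈ frontier p T θ₁ T Q σ x, exitMass p T θ₁ T Q σ x v ≤ 1 ∧
      δ < ∑ v ∈ frontier p T θ₁ T Q σ x, exitMass p T θ₁ T Q σ x v *
        ∑ k, p v k * (if σ v k ∈ B (explore p T θ₁ σ x ∪ frontier p T θ₁ T Q σ x) σ then 1 else 0)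
    with hE
  have hEx : ∀ x, Pr n (E x) ≤ Real.exp ((2 * η - δ) / (2 * (s + 1) * θ₁)) := fun x =>
    Pr_frontier_hit_le hp hrow hB (by positivity) hη x
  have hsum : Pr n (fun σ => ∃ x, E x σ) ≤
      n * Real.exp ((2 * η - δ) / (2 * (s + 1) * θ₁)) := by
    refine (Pr_exists_le _).trans ((Finset.sum_le_sum fun x _ => hEx x).trans ?_)
    simp
  refine le_trans (Pr_mono (F := fun σ => ((∃ x, δ < heavyMass p θ₂ s σ x) ∨
    (∃ x, ¬ AtMostTwo p s θc σ x)) ∨ ∃ x, E x σ) ?_) ((Pr_or_le _ _).trans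
    (add_le_add ((Pr_or_le _ _).trans (add_le_add hheavy htwo)) hsum))
  rintro σ ⟨hBσ, x, hx⟩
  by_contra hcon
  push Not at hcon
  obtain ⟨⟨c1, c2⟩, c3⟩ := hcon
  have hA : AtMostTwo p s θc σ x := c2 x
  set V := explore p T θ₁ σ x with hV
  set L := frontier p T θ₁ T Q σ x with hL
  have hW : ((V ∪ L).card : ℝ) ≤ K := by
    have a1 := card_explore_le hp hp1 h1 σ x T
    have a2 := card_frontier_le hp hp1 hc0 (Q := Q) (fun _ _ h => h) σ x T θ₁ T
    have a3 : ((V ∪ L).card : ℝ) ≤ V.card + L.card := by exact_mod_cast Finset.card_union_le V L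
    have : ((T : ℕ) : ℝ) = s + 1 := by push_cast [hT]; ring
    rw [this] at a1 a2
    linarith
  have hcov := exits_cover hp hrow h1 h11 h2 h21 hc hA
  have htr := trunc_loss hp hγ1 hγ σ x s
  have hEsum : ∑ v ∈ L, exitMass p T θ₁ T Q σ x v ≤ 1 := by
    have := sum_exits_eq p T θ₁ T Q σ x (fun _ => 1)
    simp only [mul_one] at this
    rw [← this]
    exact sum_prefixFree_wt_le hp hrow (exits_prefixFree p T θ₁ T Q σ x)
      (fun κ hκ => (mem_exits.1 hκ).1.le) σ x
  refine hx (V ∪ L) hW (reaches_of_exits (T := T) (N := T) (θ := θ₁) hp hrow hτ hc0.le hγ0 hγ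
    (δ₁ := δ + s * γ + 2 * (s + 1) ^ 2 * θ₂ / θ₁) ?_ ?_)
  · have := c1 x
    linarith
  · by_contra hlt
    exact c3 x ⟨exitMass_le_of_atMostTwo hp h1.le hA, hBσ _ hW, hEsum, not_le.1 hlt⟩

/-- Words of length `u` and weight in `[θ, θ')`. -/
def window (u : ℕ) (θ θ' : ℝ) (l : ℕ) (w : ℝ) : Prop := l = u ∧ θ ≤ w ∧ w < θ'

/-- Averaging over the rows of the frontier, the flow through the frontier is nearly uniform. -/
lemma flow_bound {p : Fin n → Fin n → ℝ} (hp : ∀ i j, 0 ≤ p i j)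
    (hrow : ∀ i, ∑ j, p i j = 1) {T N : ℕ} {θ : ℝ} {Q : ℕ → ℝ → Prop} (h : ℕ) {a : ℝ}
    (ha : 0 < a) (y : Fin n) :
    Ex (fun σ => ∑ j, |∑ v ∈ frontier p T θ N Q σ y, exitMass p T θ N Q σ y v *
      (∑ k, p v k *
        kern (kill (explore p T θ σ y ∪ frontier p T θ N Q σ y) p) σ h (σ v k) j -
        unif (kill (explore p T θ σ y ∪ frontier p T θ N Q σ y) p) σ h j)|) ≤
    (n * a * Ex (fun σ => ∑ v ∈ frontier p T θ N Q σ y, exitMass p T θ N Q σ y v ^ 2) +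
      Ex (fun σ => (∑ z, ∑ j, kern p σ h z j ^ 2) / n) / a) / 2 := by
  have hle1 : ∀ i j, p i j ≤ 1 := fun i j =>
    (Finset.single_le_sum (fun j _ => hp i j) (Finset.mem_univ j)).trans (hrow i).le
  have hcomb : (n * a * Ex (fun σ => ∑ v ∈ frontier p T θ N Q σ y,
        exitMass p T θ N Q σ y v ^ 2) +
      Ex (fun σ => (∑ z, ∑ j, kern p σ h z j ^ 2) / n) / a) / 2 =
      Ex (fun σ => (n * a / 2) * (∑ v ∈ frontier p T θ N Q σ y, exitMass p T θ N Q σ y v ^ 2) +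
        (1 / (2 * a)) * ((∑ z, ∑ j, kern p σ h z j ^ 2) / n)) := by
    rw [Ex_add, Ex_mul_left, Ex_mul_left]
    field_simp
  rw [hcomb]
  have hV : ∀ σ σ' : Env n, (∀ z ∈ (frontier p T θ N Q σ y)ᶜ, σ z = σ' z) →
      ∀ z ∈ explore p T θ σ y, σ z = σ' z := fun σ σ' h z hz =>
    h z (Finset.mem_compl.2 (frontier_disjoint hz))
  refine Ex_le_Ex_of_mix (fun σ => (frontier p T θ N Q σ y)ᶜ)
    (fun σ σ' h => by rw [frontier_congr hp hle1 (hV σ σ' h)]) fun σ => ?_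
  set L := frontier p T θ N Q σ y with hL
  set V := explore p T θ σ y with hVdef
  set m := exitMass p T θ N Q σ y with hm
  have e0 : ∀ σ' : Env n, ∀ z ∈ V, σ z = mix Lᶜ σ σ' z := fun σ' z hz =>
    (mix_apply_of_mem (Finset.mem_compl.2 (frontier_disjoint hz)) σ σ').symm
  have e1 : ∀ σ', explore p T θ (mix Lᶜ σ σ') y = V := fun σ' => explore_congr hp hle1 (e0 σ')
  have e2 : ∀ σ', frontier p T θ N Q (mix Lᶜ σ σ') y = L := fun σ' =>
    frontier_congr hp hle1 (e0 σ')
  have e3 : ∀ σ' v, exitMass p T θ N Q (mix Lᶜ σ σ') y v = m v := fun σ' v =>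
    exitMass_congr hp hle1 (e0 σ') v
  have e4 : ∀ σ' x j, kern (kill (V ∪ L) p) (mix Lᶜ σ σ') h x j = kern (kill (V ∪ L) p) σ h x j :=
    fun σ' x j => kern_kill_congr (fun z hz => (mix_apply_of_mem
      (Finset.mem_compl.2 fun h => hz (Finset.mem_union_right _ h)) σ σ').symm) p h x j
  have e5 : ∀ σ' j, unif (kill (V ∪ L) p) (mix Lᶜ σ σ') h j = unif (kill (V ∪ L) p) σ h j :=
    fun σ' j => by simp only [unif, e4]
  simp only [e1, e2, e3, e4, e5]
  have hfl : ∀ (σ' : Env n) (j : Fin n), ∑ v ∈ L, m v * (∑ k, p v k *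
        kern (kill (V ∪ L) p) σ h (mix Lᶜ σ σ' v k) j - unif (kill (V ∪ L) p) σ h j) =
      ∑ v ∈ L, m v * (∑ k, p v k *
        kern (kill (V ∪ L) p) σ h (σ' v k) j - unif (kill (V ∪ L) p) σ h j) := fun σ' j =>
    Finset.sum_congr rfl fun v hv => by
      rw [mix_apply_of_notMem (by simpa using hv) σ σ']
  simp only [hfl]
  rw [Ex_sum]
  set M := ∑ v ∈ L, m v ^ 2 with hM
  have hM0 : 0 ≤ M := Finset.sum_nonneg fun v _ => sq_nonneg _
  have hj : ∀ j, Ex (fun σ' : Env n => |∑ v ∈ L, m v * (∑ k, p v k *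
        kern (kill (V ∪ L) p) σ h (σ' v k) j - unif (kill (V ∪ L) p) σ h j)|) ≤
      (a / 2) * M + (1 / (2 * a)) * ((∑ z, kern p σ h z j ^ 2) / n) := by
    intro j
    refine (Ex_sum_row_abs_le hp hrow L m fun z => kern (kill (V ∪ L) p) σ h z j).trans ?_
    have hq : (∑ z, kern (kill (V ∪ L) p) σ h z j ^ 2) / n ≤ (∑ z, kern p σ h z j ^ 2) / n := by
      gcongr with z
      · exact kern_nonneg (kill_nonneg hp _) _ _ _ _
      · exact kern_mono (kill_nonneg hp _) (kill_le hp _) _ _ _ _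
    set q := (∑ z, kern p σ h z j ^ 2) / n with hqd
    have hq0 : 0 ≤ q := div_nonneg (Finset.sum_nonneg fun z _ => sq_nonneg _) (by positivity)
    refine (Real.sqrt_le_sqrt (mul_le_mul_of_nonneg_left hq hM0)).trans ?_
    refine Real.sqrt_le_iff.2 ⟨by positivity, ?_⟩
    have : (a / 2 * M + 1 / (2 * a) * q) ^ 2 = M * q + (a / 2 * M - 1 / (2 * a) * q) ^ 2 := by
      field_simp; ring
    rw [this]
    nlinarith [sq_nonneg (a / 2 * M - 1 / (2 * a) * q)]
  refine (Finset.sum_le_sum fun j _ => hj j).trans (le_of_eq ?_)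
  rw [Finset.sum_add_distrib, Finset.sum_const, ← Finset.mul_sum, ← Finset.sum_div,
    Finset.sum_comm (γ := Fin n)]
  simp
  ring

/-- The flow through the window words is bounded by light masses. -/
lemma sum_exitMass_sq_le {p : Fin n → Fin n → ℝ} (hp : ∀ i j, 0 ≤ p i j)
    (hp1 : ∀ i, ∑ j, p i j ≤ 1) {u : ℕ} (hn : 2 * (u + u + 2) ^ 2 ≤ n) {θ θ' : ℝ} (hθ : 0 ≤ θ')
    (y : Fin n) :
    Ex (fun σ => ∑ v ∈ frontier p u θ (u + 1) (window u θ θ') σ y,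
      exitMass p u θ (u + 1) (window u θ θ') σ y v ^ 2) ≤
      6 * (((u : ℝ) + u + 2) ^ 2 / n) + θ' := by
  refine (Ex_mono fun σ => ?_).trans (light_sq_bound hp hp1 hn hθ y)
  refine (Finset.sum_le_sum_of_subset_of_nonneg (Finset.subset_univ _)
    fun v _ _ => sq_nonneg _).trans ?_
  refine Finset.sum_le_sum fun v _ => ?_
  refine pow_le_pow_left₀ (exitMass_nonneg hp _ _ _ _ _ _ _) ?_ 2
  unfold exitMass
  calc _ ≤ ∑ κ ∈ exits p u θ (u + 1) (window u θ θ') σ y,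
        (if run σ y κ = v ∧ wt p σ y κ ≤ θ' then wt p σ y κ else 0) := by
        refine Finset.sum_le_sum fun κ hκ => ?_
        have h1 := (mem_exits.1 hκ).2.2.2.2.2.le
        simp [h1]
    _ ≤ _ := by
        refine Finset.sum_le_sum_of_subset_of_nonneg ?_ fun κ _ _ => ?_
        · intro κ hκ
          exact mem_words.2 (mem_exits.1 hκ).2.2.2.1
        · split_ifs; exacts [wt_nonneg hp _ _ _, le_rfl]

/-- Mass of the words whose endpoint is already reached by a heavy shorter word. -/
noncomputable def revisitMass (p : Fin n → Fin n → ℝ) (θ : ℝ) (T : ℕ) (σ : Env n) (x : Fin n) :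
    ℝ :=
  ∑ κ ∈ words n T, wt p σ x κ * ind (∃ κ' : List (Fin n), κ'.length < T ∧ θ ≤ wt p σ x κ' ∧
    run σ x κ' = run σ x κ)

lemma exitMass_loss {p : Fin n → Fin n → ℝ} (hp : ∀ i j, 0 ≤ p i j)
    (hrow : ∀ i, ∑ j, p i j = 1) (u : ℕ) (θ θ' : ℝ) (σ : Env n) (y : Fin n) :
    1 - ∑ v ∈ frontier p u θ (u + 1) (window u θ θ') σ y,
      exitMass p u θ (u + 1) (window u θ θ') σ y v ≤
      lightMass p θ u σ y + heavyMass p θ' u σ y + revisitMass p θ u σ y := by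
  have hle1 : ∀ i j, p i j ≤ 1 := fun i j =>
    (Finset.single_le_sum (fun j _ => hp i j) (Finset.mem_univ j)).trans (hrow i).le
  have h0 := sum_exits_eq p u θ (u + 1) (window u θ θ') σ y (fun _ => 1)
  simp only [mul_one] at h0
  have h1 : exits p u θ (u + 1) (window u θ θ') σ y = (words n u).filter (fun κ =>
      (θ ≤ wt p σ y κ ∧ wt p σ y κ < θ') ∧ ¬ ∃ κ' : List (Fin n), κ'.length < u ∧
        θ ≤ wt p σ y κ' ∧ run σ y κ' = run σ y κ) := by
    ext κ
    rw [mem_exits, Finset.mem_filter, mem_words, mem_explore]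
    constructor
    · rintro ⟨_, _, h3, h4⟩
      exact ⟨h4.1, h4.2, h3⟩
    · rintro ⟨h2, h4, h3⟩
      exact ⟨by omega, tails_subset_explore hp hle1 h2.le h4.1, h3, h2, h4⟩
  rw [← h0, h1, ← sum_wt_eq_one hrow σ y u, Finset.sum_filter, ← Finset.sum_sub_distrib]
  unfold lightMass heavyMass revisitMass
  rw [← Finset.sum_add_distrib, ← Finset.sum_add_distrib]
  refine Finset.sum_le_sum fun κ _ => ?_
  have w0 := wt_nonneg hp σ y κ
  unfold ind
  by_cases a : wt p σ y κ < θ <;> by_cases b : θ' ≤ wt p σ y κ <;>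
    by_cases c : (∃ κ' : List (Fin n), κ'.length < u ∧ θ ≤ wt p σ y κ' ∧
      run σ y κ' = run σ y κ) <;> simp [a, b, c, not_lt.1, not_le.1] <;>
    (try split_ifs) <;> linarith

/-- Overlap of the law at time `u` from `y` with the law at time `h` from the uniform
distribution. -/
noncomputable def ov (p : Fin n → Fin n → ℝ) (σ : Env n) (u h : ℕ) (y : Fin n) : ℝ :=
  ∑ j, min (kern p σ u y j) (unif p σ h j)

lemma sum_unif_le {p : Fin n → Fin n → ℝ} (hp : ∀ i j, 0 ≤ p i j) (hp1 : ∀ i, ∑ j, p i j ≤ 1)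
    (σ : Env n) (h : ℕ) : ∑ j, unif p σ h j ≤ 1 := by
  unfold unif
  rw [← Finset.sum_div, Finset.sum_comm]
  refine div_le_one_of_le₀ ?_ (by positivity)
  calc _ ≤ ∑ _y : Fin n, (1 : ℝ) := Finset.sum_le_sum fun y _ => by
        rw [sum_kern]; exact sum_wt_le_one hp hp1 σ y h
    _ = n := by simp

lemma sum_unif_eq {p : Fin n → Fin n → ℝ} (hrow : ∀ i, ∑ j, p i j = 1) (hn : 0 < n)
    (σ : Env n) (h : ℕ) : ∑ j, unif p σ h j = 1 := by
  unfold unif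
  rw [← Finset.sum_div, Finset.sum_comm]
  simp only [sum_kern, sum_wt_eq_one hrow]
  have : (n : ℝ) ≠ 0 := by positivity
  simp [this]

lemma unif_mono {p p' : Fin n → Fin n → ℝ} (hp : ∀ i j, 0 ≤ p i j) (h : ∀ i j, p i j ≤ p' i j)
    (σ : Env n) (T : ℕ) (j : Fin n) : unif p σ T j ≤ unif p' σ T j :=
  div_le_div_of_nonneg_right (Finset.sum_le_sum fun y _ => kern_mono hp h σ T y j) (by positivity)

/-- The total discrepancy between the flow through the frontier and the uniform flow. -/
noncomputable def flow (p : Fin n → Fin n → ℝ) (u h : ℕ) (θ θ' : ℝ) (σ : Env n) (y : Fin n) : ℝ :=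
  ∑ j, |∑ v ∈ frontier p u θ (u + 1) (window u θ θ') σ y,
    exitMass p u θ (u + 1) (window u θ θ') σ y v *
      (∑ k, p v k * kern (kill (explore p u θ σ y ∪
        frontier p u θ (u + 1) (window u θ θ') σ y) p) σ h (σ v k) j -
        unif (kill (explore p u θ σ y ∪ frontier p u θ (u + 1) (window u θ θ') σ y) p) σ h j)|

lemma ov_loss {p : Fin n → Fin n → ℝ} (hp : ∀ i j, 0 ≤ p i j)
    (hrow : ∀ i, ∑ j, p i j = 1) (u h : ℕ) (θ θ' : ℝ) (σ : Env n) (y : Fin n) :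
    1 - ov p σ (u + (1 + h)) h y ≤
      (lightMass p θ u σ y + heavyMass p θ' u σ y + revisitMass p θ u σ y) +
      (1 - ∑ j, unif (kill (explore p u θ σ y ∪ frontier p u θ (u + 1) (window u θ θ') σ y) p)
        σ h j) + flow p u h θ θ' σ y := by
  have hp1 : ∀ i, ∑ j, p i j ≤ 1 := fun i => (hrow i).le
  have hloss := exitMass_loss hp hrow u θ θ' σ y
  unfold flow
  set Q := window u θ θ'
  set L := frontier p u θ (u + 1) Q σ y with hL
  set W := explore p u θ σ y ∪ L with hW
  set m := exitMass p u θ (u + 1) Q σ y with hm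
  have hm0 : ∀ v, 0 ≤ m v := exitMass_nonneg hp _ _ _ _ σ y
  set g := fun z j => kern (kill W p) σ h z j with hg
  have hkn := kill_nonneg hp W
  have hkl := kill_le hp W
  have hk1 : ∀ i, ∑ j, kill W p i j ≤ 1 := fun i =>
    (Finset.sum_le_sum fun j _ => hkl i j).trans (hp1 i)
  have hg1 := sum_unif_le hkn hk1 σ h
  have hM1 : ∑ v ∈ L, m v ≤ 1 := by
    have h0 := sum_exits_eq p u θ (u + 1) Q σ y (fun _ => 1)
    simp only [mul_one] at h0
    rw [← h0]
    exact sum_prefixFree_wt_le hp hrow (exits_prefixFree p u θ (u + 1) Q σ y)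
      (fun κ hκ => (mem_exits.1 hκ).1.le) σ y
  set M := ∑ v ∈ L, m v with hM
  have hM0 : 0 ≤ M := Finset.sum_nonneg fun v _ => hm0 v
  have hker : ∀ j, ∑ v ∈ L, m v * ∑ k, p v k * g (σ v k) j ≤ kern p σ (u + (1 + h)) y j := by
    intro j
    rw [← sum_exits_eq p u θ (u + 1) Q σ y (fun v => ∑ k, p v k * g (σ v k) j), kern_add]
    refine (Finset.sum_le_sum fun κ _ => mul_le_mul_of_nonneg_left (b := ∑ k, p (run σ y κ) k *
      g (σ (run σ y κ) k) j) (c := kern p σ (1 + h) (run σ y κ) j) ?_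
      (wt_nonneg hp σ y κ)).trans ?_
    · rw [add_comm 1 h, kern_succ]
      exact Finset.sum_le_sum fun k _ => mul_le_mul_of_nonneg_left
        (kern_mono hkn hkl _ _ _ _) (hp _ _)
    · refine Finset.sum_le_sum_of_subset_of_nonneg (fun κ hκ => ?_) fun κ _ _ =>
        mul_nonneg (wt_nonneg hp _ _ _) (kern_nonneg hp _ _ _ _)
      exact mem_words.2 (mem_exits.1 hκ).2.2.2.1
  have hpt : ∀ j, M * unif (kill W p) σ h j - |∑ v ∈ L, m v * (∑ k, p v k * g (σ v k) j -
      unif (kill W p) σ h j)| ≤ min (kern p σ (u + (1 + h)) y j) (unif p σ h j) := by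
    intro j
    have hu0 := unif_nonneg hkn σ h j
    refine le_min ?_ ?_
    · refine le_trans ?_ (hker j)
      have : ∑ v ∈ L, m v * (∑ k, p v k * g (σ v k) j - unif (kill W p) σ h j) =
          ∑ v ∈ L, m v * ∑ k, p v k * g (σ v k) j - M * unif (kill W p) σ h j := by
        simp only [mul_sub, Finset.sum_sub_distrib, hM, Finset.sum_mul]
      rw [this]
      linarith [neg_abs_le (∑ v ∈ L, m v * ∑ k, p v k * g (σ v k) j - M * unif (kill W p) σ h j)]
    · have h1 := unif_mono hkn hkl σ h j
      have h2 : M * unif (kill W p) σ h j ≤ 1 * unif (kill W p) σ h j := by gcongr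
      linarith [abs_nonneg (∑ v ∈ L, m v * (∑ k, p v k * g (σ v k) j - unif (kill W p) σ h j))]
  have hsum := Finset.sum_le_sum fun j (_ : j ∈ Finset.univ) => hpt j
  rw [Finset.sum_sub_distrib, ← Finset.mul_sum] at hsum
  have hu0 : 0 ≤ ∑ j, unif (kill W p) σ h j := Finset.sum_nonneg fun j _ => unif_nonneg hkn σ h j
  unfold ov
  simp only [hg] at hsum
  nlinarith

/-- The mass, from the uniform distribution, lost by killing on `W`. -/
lemma unif_kill_loss {p : Fin n → Fin n → ℝ} (hp : ∀ i j, 0 ≤ p i j)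
    (hrow : ∀ i, ∑ j, p i j = 1) (hn : 0 < n) (W : Finset (Fin n)) (σ : Env n) (h : ℕ) :
    1 - ∑ j, unif (kill W p) σ h j ≤ ∑ t ∈ Finset.range h, ∑ w ∈ W, unif p σ t w := by
  have hn' : (0 : ℝ) < n := by exact_mod_cast hn
  have e1 : 1 - ∑ j, unif (kill W p) σ h j =
      (∑ y, (1 - ∑ κ ∈ words n h, wt (kill W p) σ y κ)) / n := by
    unfold unif
    rw [← Finset.sum_div, Finset.sum_comm]
    simp only [sum_kern, Finset.sum_sub_distrib]
    simp
    field_simp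
  have e2 : ∑ t ∈ Finset.range h, ∑ w ∈ W, unif p σ t w =
      (∑ y, ∑ t ∈ Finset.range h, ∑ w ∈ W, kern p σ t y w) / n := by
    unfold unif
    rw [Finset.sum_comm (s := Finset.univ), Finset.sum_div]
    refine Finset.sum_congr rfl fun t _ => ?_
    rw [Finset.sum_comm (s := Finset.univ), Finset.sum_div]
  rw [e1, e2]
  exact div_le_div_of_nonneg_right (Finset.sum_le_sum fun y _ => kill_loss hp hrow W σ h y)
    hn'.le

/-- Time spent in a small set by the walk started from the uniform distribution. -/
lemma sum_unif_small_le {p : Fin n → Fin n → ℝ} {σ : Env n} {h T : ℕ} {q K : ℝ}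
    (hE : ∀ t < T, ∑ j, unif p σ t j ^ 2 ≤ q) (hh : h ≤ T) {W : Finset (Fin n)}
    (hW : (W.card : ℝ) ≤ K) :
    ∑ t ∈ Finset.range h, ∑ w ∈ W, unif p σ t w ≤ T * Real.sqrt (K * q) := by
  have h1 : ∀ t ∈ Finset.range h, ∑ w ∈ W, unif p σ t w ≤ Real.sqrt (K * q) := by
    intro t ht
    refine Real.le_sqrt_of_sq_le (sq_sum_le_card_mul_sum_sq.trans ?_)
    refine mul_le_mul hW ?_ (Finset.sum_nonneg fun _ _ => sq_nonneg _)
      (le_trans (by positivity) hW)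
    exact (Finset.sum_le_sum_of_subset_of_nonneg (Finset.subset_univ W)
      fun _ _ _ => sq_nonneg _).trans (hE t (by have := Finset.mem_range.1 ht; omega))
  refine (Finset.sum_le_sum h1).trans ?_
  rw [Finset.sum_const, Finset.card_range, nsmul_eq_mul]
  gcongr

lemma lightMass_le_add {p : Fin n → Fin n → ℝ} (hp : ∀ i j, 0 ≤ p i j)
    (hrow : ∀ i, ∑ j, p i j = 1) (θ : ℝ) (T U : ℕ) (σ : Env n) (x : Fin n) :
    lightMass p θ T σ x ≤ lightMass p θ (T + U) σ x := by
  have h1 := heavyMass_add_lightMass p θ T σ x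
  have h2 := heavyMass_add_lightMass p θ (T + U) σ x
  have h3 := heavyMass_add_le hp (fun i => (hrow i).le) θ T U σ x
  rw [sum_wt_eq_one hrow] at h1 h2
  linarith

lemma revisitMass_nonneg {p : Fin n → Fin n → ℝ} (hp : ∀ i j, 0 ≤ p i j) (θ : ℝ) (T : ℕ)
    (σ : Env n) (x : Fin n) : 0 ≤ revisitMass p θ T σ x :=
  Finset.sum_nonneg fun _ _ => mul_nonneg (wt_nonneg hp _ _ _) (ind_nonneg _)

lemma flow_nonneg (p : Fin n → Fin n → ℝ) (u h : ℕ) (θ θ' : ℝ) (σ : Env n) (y : Fin n) :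
    0 ≤ flow p u h θ θ' σ y := Finset.sum_nonneg fun _ _ => abs_nonneg _

/-- The laws started from the uniform distribution are spread out up to time `T`. -/
def Spread (p : Fin n → Fin n → ℝ) (T : ℕ) (q : ℝ) (σ : Env n) : Prop :=
  ∀ t < T, ∑ j, unif p σ t j ^ 2 ≤ q

lemma card_filter_lt_le {f : Fin n → ℝ} (hf : ∀ y, 0 ≤ f y) {a : ℝ} (ha : 0 < a) :
    ((Finset.univ.filter fun y => a < f y).card : ℝ) ≤ (∑ y, f y) / a := by
  rw [le_div_iff₀ ha]
  calc _ = ∑ y ∈ Finset.univ.filter (fun y => a < f y), a := by simp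
    _ ≤ ∑ y ∈ Finset.univ.filter (fun y => a < f y), f y :=
        Finset.sum_le_sum fun y hy => (Finset.mem_filter.1 hy).2.le
    _ ≤ _ := Finset.sum_le_sum_of_subset_of_nonneg (Finset.filter_subset _ _) fun y _ _ => hf y

/-- Vertices from which the walk fails to mix at some time in a window. -/
noncomputable def badMix (p : Fin n → Fin n → ℝ) (s D h : ℕ) (δ : ℝ) (σ : Env n) :
    Finset (Fin n) :=
  Finset.univ.filter fun y => ∃ d ≤ D, ov p σ (s + d + (1 + h)) h y < 1 - δ

lemma Pr_badMix_le {p : Fin n → Fin n → ℝ} (hp : ∀ i j, 0 ≤ p i j)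
    (hrow : ∀ i, ∑ j, p i j = 1) (hn : 0 < n) {s D h T : ℕ} {θ θ' δ η q bL bH bR bF : ℝ}
    (hθ : 0 < θ) (hδ : 0 < δ) (hη : 0 < η) (hh : h ≤ T)
    (hK : T * Real.sqrt ((2 * (s + D) + 1) / θ * q) ≤ δ / 2)
    (hL : Ex (fun σ => (∑ y, lightMass p θ (s + D) σ y) / n) ≤ bL)
    (hH : Ex (fun σ => (∑ y, heavyMass p θ' s σ y) / n) ≤ bH)
    (hR : ∀ d ≤ D, ∀ y, Ex (fun σ => revisitMass p θ (s + d) σ y) ≤ bR)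
    (hF : ∀ d ≤ D, ∀ y, Ex (fun σ => flow p (s + d) h θ θ' σ y) ≤ bF) :
    Pr n (fun σ => Spread p T q σ ∧ η * n < (badMix p s D h δ σ).card) ≤
      (bL + bH + (D + 1) * (bR + bF)) / (η * (δ / 2)) := by
  have hp1 : ∀ i, ∑ j, p i j ≤ 1 := fun i => (hrow i).le
  have hn' : (0 : ℝ) < n := by exact_mod_cast hn
  set f : Env n → Fin n → ℝ := fun σ y => lightMass p θ (s + D) σ y + heavyMass p θ' s σ y +
    ∑ d ∈ Finset.range (D + 1), (revisitMass p θ (s + d) σ y + flow p (s + d) h θ θ' σ y) with hf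
  have hf0 : ∀ σ y, 0 ≤ f σ y := fun σ y =>
    add_nonneg (add_nonneg (lightMass_nonneg hp _ _ _ _) (heavyMass_nonneg hp _ _ _ _))
      (Finset.sum_nonneg fun d _ => add_nonneg (revisitMass_nonneg hp _ _ _ _)
        (flow_nonneg _ _ _ _ _ _ _))
  have hbad : ∀ σ, Spread p T q σ → badMix p s D h δ σ ⊆
      Finset.univ.filter fun y => δ / 2 < f σ y := by
    intro σ hσ y hy
    obtain ⟨d, hd, hov⟩ := (Finset.mem_filter.1 hy).2
    refine Finset.mem_filter.2 ⟨Finset.mem_univ _, ?_⟩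
    have h1 := ov_loss hp hrow (s + d) h θ θ' σ y
    have h2 := unif_kill_loss hp hrow hn (explore p (s + d) θ σ y ∪
      frontier p (s + d) θ (s + d + 1) (window (s + d) θ θ') σ y) σ h
    have hc : ((explore p (s + d) θ σ y ∪
      frontier p (s + d) θ (s + d + 1) (window (s + d) θ θ') σ y).card : ℝ) ≤
        (2 * (s + D) + 1) / θ := by
      have a1 := card_explore_le hp hp1 hθ σ y (s + d)
      have a2 := card_frontier_le hp hp1 hθ (Q := window (s + d) θ θ') (fun _ _ h => h.2.1) σ y
        (s + d) θ (s + d + 1)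
      refine le_trans (by exact_mod_cast Finset.card_union_le _ _) ((add_le_add a1 a2).trans ?_)
      rw [← add_div]
      have : (d : ℝ) ≤ D := by exact_mod_cast hd
      push_cast
      exact div_le_div_of_nonneg_right (by linarith) hθ.le
    have h3 := sum_unif_small_le hσ hh hc
    have h4 : lightMass p θ (s + d) σ y ≤ lightMass p θ (s + D) σ y := by
      have := lightMass_le_add hp hrow θ (s + d) (D - d) σ y
      rwa [show s + d + (D - d) = s + D by omega] at this
    have h5 : heavyMass p θ' (s + d) σ y ≤ heavyMass p θ' s σ y := heavyMass_add_le hp hp1 _ _ _ _ _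
    have h6 : revisitMass p θ (s + d) σ y + flow p (s + d) h θ θ' σ y ≤
        ∑ d ∈ Finset.range (D + 1), (revisitMass p θ (s + d) σ y + flow p (s + d) h θ θ' σ y) :=
      Finset.single_le_sum (f := fun d => revisitMass p θ (s + d) σ y + flow p (s + d) h θ θ' σ y)
        (fun d _ => add_nonneg (revisitMass_nonneg hp _ _ _ _) (flow_nonneg _ _ _ _ _ _ _))
        (Finset.mem_range.2 (by omega))
    simp only [hf]
    linarith
  have hEx : Ex (fun σ => (∑ y, f σ y) / n) ≤ bL + bH + (D + 1) * (bR + bF) := by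
    have e : ∀ σ, (∑ y, f σ y) / n = ((∑ y, lightMass p θ (s + D) σ y) / n +
        (∑ y, heavyMass p θ' s σ y) / n) + (1 / (n : ℝ)) * ∑ y, ∑ d ∈ Finset.range (D + 1),
          (revisitMass p θ (s + d) σ y + flow p (s + d) h θ θ' σ y) := fun σ => by
      simp only [hf, Finset.sum_add_distrib]
      ring
    simp only [e]
    rw [Ex_add, Ex_add, Ex_mul_left, Ex_sum]
    refine add_le_add (add_le_add hL hH) ?_
    have : ∀ y ∈ (Finset.univ : Finset (Fin n)), Ex (fun σ => ∑ d ∈ Finset.range (D + 1),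
        (revisitMass p θ (s + d) σ y + flow p (s + d) h θ θ' σ y)) ≤ (D + 1) * (bR + bF) := by
      intro y _
      rw [Ex_sum]
      calc _ ≤ ∑ _d ∈ Finset.range (D + 1), (bR + bF) := by
            refine Finset.sum_le_sum fun d hd => ?_
            have hd' : d ≤ D := by have := Finset.mem_range.1 hd; omega
            rw [Ex_add]
            exact add_le_add (hR d hd' y) (hF d hd' y)
        _ = _ := by simp; ring
    calc _ ≤ 1 / (n : ℝ) * ∑ _y : Fin n, ((D : ℝ) + 1) * (bR + bF) := by
          gcongr with y hy; exact this y hy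
      _ = _ := by simp; field_simp
  have hnn : ∀ σ, 0 ≤ (∑ y, f σ y) / n := fun σ =>
    div_nonneg (Finset.sum_nonneg fun y _ => hf0 σ y) hn'.le
  refine (Pr_le_Ex_div hnn (a := η * (δ / 2)) (by positivity) fun σ hσ => ?_).trans
    (div_le_div_of_nonneg_right hEx (by positivity))
  have h1 := card_filter_lt_le (hf0 σ) (show 0 < δ / 2 by linarith)
  have h2 : ((badMix p s D h δ σ).card : ℝ) ≤ _ :=
    (Nat.cast_le.2 (Finset.card_le_card (hbad σ hσ.1))).trans h1
  have h3 := hσ.2.trans_le h2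
  rw [lt_div_iff₀ (by positivity)] at h3
  rw [le_div_iff₀ hn']
  linarith

/-- Enlarging a bad set by the vertices from which a small set `W` is likely to be visited. -/
lemma card_le_of_visit {p : Fin n → Fin n → ℝ} (hp : ∀ i j, 0 ≤ p i j) (hn : 0 < n) {T : ℕ}
    {q K δ η : ℝ} {σ : Env n} (hσ : Spread p T q σ) (hδ : 0 < δ)
    (hK : T * Real.sqrt (K * q) ≤ δ * η / 4) {W S bad : Finset (Fin n)} (hW : (W.card : ℝ) ≤ K)
    (hbad : (bad.card : ℝ) ≤ η / 2 * n)
    (hS : ∀ y ∈ S, y ∈ bad ∨ δ / 2 < ∑ t ∈ Finset.range T, ∑ w ∈ W, kern p σ t y w) :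
    (S.card : ℝ) ≤ η * n := by
  have hn' : (0 : ℝ) < n := by exact_mod_cast hn
  have h1 := card_filter_lt_le (f := fun y => ∑ t ∈ Finset.range T, ∑ w ∈ W, kern p σ t y w)
    (fun y => Finset.sum_nonneg fun _ _ => Finset.sum_nonneg fun _ _ => kern_nonneg hp _ _ _ _)
    (show 0 < δ / 2 by linarith)
  have h2 : ∑ y, ∑ t ∈ Finset.range T, ∑ w ∈ W, kern p σ t y w =
      n * ∑ t ∈ Finset.range T, ∑ w ∈ W, unif p σ t w := by
    simp only [unif, Finset.mul_sum]
    rw [Finset.sum_comm]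
    refine Finset.sum_congr rfl fun t _ => ?_
    rw [Finset.sum_comm]
    exact Finset.sum_congr rfl fun w _ => by field_simp
  have h3 := sum_unif_small_le hσ le_rfl hW
  have h4 : S ⊆ bad ∪ Finset.univ.filter fun y =>
      δ / 2 < ∑ t ∈ Finset.range T, ∑ w ∈ W, kern p σ t y w := by
    intro y hy
    rcases hS y hy with h | h
    · exact Finset.mem_union_left _ h
    · exact Finset.mem_union_right _ (Finset.mem_filter.2 ⟨Finset.mem_univ _, h⟩)
  have h5 : (S.card : ℝ) ≤ bad.card + (Finset.univ.filter fun y =>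
      δ / 2 < ∑ t ∈ Finset.range T, ∑ w ∈ W, kern p σ t y w).card := by
    exact_mod_cast (Finset.card_le_card h4).trans (Finset.card_union_le _ _)
  have h6 : (∑ y, ∑ t ∈ Finset.range T, ∑ w ∈ W, kern p σ t y w) / (δ / 2) ≤ η / 2 * n := by
    rw [h2, div_le_iff₀ (by linarith)]
    have := mul_le_mul_of_nonneg_left (h3.trans hK) hn'.le
    linarith
  linarith

lemma kill_loss_le {p : Fin n → Fin n → ℝ} (hp : ∀ i j, 0 ≤ p i j)
    (hrow : ∀ i, ∑ j, p i j = 1) (W : Finset (Fin n)) (σ : Env n) {t T : ℕ} (ht : t ≤ T)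
    (x : Fin n) : 1 - ∑ κ ∈ words n t, wt (kill W p) σ x κ ≤
      ∑ s ∈ Finset.range T, ∑ w ∈ W, kern p σ s x w :=
  (kill_loss hp hrow W σ t x).trans (Finset.sum_le_sum_of_subset_of_nonneg
    (Finset.range_subset_range.2 ht) fun _ _ _ => Finset.sum_nonneg fun _ _ => kern_nonneg hp _ _ _ _)

lemma ov_kill_ge {p : Fin n → Fin n → ℝ} (hp : ∀ i j, 0 ≤ p i j)
    (hrow : ∀ i, ∑ j, p i j = 1) (hn : 0 < n) (W : Finset (Fin n)) (σ : Env n) (u h : ℕ)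
    (y : Fin n) :
    ov p σ u h y - (1 - ∑ κ ∈ words n u, wt (kill W p) σ y κ) -
      (1 - ∑ j, unif (kill W p) σ h j) ≤ ov (kill W p) σ u h y := by
  have e1 : 1 - ∑ κ ∈ words n u, wt (kill W p) σ y κ =
      ∑ j, kern p σ u y j - ∑ j, kern (kill W p) σ u y j := by
    rw [sum_kern, sum_kern, sum_wt_eq_one hrow]
  rw [e1, ← sum_unif_eq hrow hn σ h]
  unfold ov
  rw [← Finset.sum_sub_distrib, ← Finset.sum_sub_distrib, ← Finset.sum_sub_distrib,
    ← Finset.sum_sub_distrib]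
  refine Finset.sum_le_sum fun j _ => ?_
  have h1 := kern_mono (kill_nonneg hp W) (kill_le hp W) σ u y j
  have h2 := unif_mono (kill_nonneg hp W) (kill_le hp W) σ h j
  refine le_min ?_ ?_
  · linarith [min_le_left (kern p σ u y j) (unif p σ h j)]
  · linarith [min_le_right (kern p σ u y j) (unif p σ h j)]

lemma card_badMix_kill_le {p : Fin n → Fin n → ℝ} (hp : ∀ i j, 0 ≤ p i j)
    (hrow : ∀ i, ∑ j, p i j = 1) (hn : 0 < n) {s D h T : ℕ} {q K δ η : ℝ} {σ : Env n}
    (hσ : Spread p T q σ) (hδ : 0 < δ) (hη : η ≤ 1) (hT : s + D + (1 + h) ≤ T)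
    (hK : T * Real.sqrt (K * q) ≤ δ * η / 4)
    (hbad : ((badMix p s D h δ σ).card : ℝ) ≤ η / 2 * n) {W : Finset (Fin n)}
    (hW : (W.card : ℝ) ≤ K) :
    ((badMix (kill W p) s D h (2 * δ) σ).card : ℝ) ≤ η * n := by
  refine card_le_of_visit hp hn hσ hδ hK hW hbad fun y hy => ?_
  obtain ⟨d, hd, hov⟩ := (Finset.mem_filter.1 hy).2
  by_contra hcon
  push Not at hcon
  obtain ⟨h1, h2⟩ := hcon
  have h3 : 1 - δ ≤ ov p σ (s + d + (1 + h)) h y := by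
    by_contra h4
    exact h1 (Finset.mem_filter.2 ⟨Finset.mem_univ _, d, hd, not_le.1 h4⟩)
  have h5 := ov_kill_ge hp hrow hn W σ (s + d + (1 + h)) h y
  have h6 := kill_loss_le hp hrow W σ (show s + d + (1 + h) ≤ T by omega) y
  have h7 := (unif_kill_loss hp hrow hn W σ h).trans
    ((sum_unif_small_le hσ (by omega) hW).trans hK)
  have : δ * η ≤ δ * 1 := by gcongr
  linarith

/-- Vertices from which the walk does not typically follow heavy words. -/
noncomputable def badLight (p : Fin n → Fin n → ℝ) (θ : ℝ) (t : ℕ) (δ : ℝ) (σ : Env n) :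
    Finset (Fin n) :=
  Finset.univ.filter fun y => heavyMass p θ t σ y < 1 - δ

lemma heavyMass_kill_ge {p : Fin n → Fin n → ℝ} (hp : ∀ i j, 0 ≤ p i j)
    (hrow : ∀ i, ∑ j, p i j = 1) {θ : ℝ} (hθ : 0 < θ) (W : Finset (Fin n)) (σ : Env n) (t : ℕ)
    (y : Fin n) : heavyMass p θ t σ y - (1 - ∑ κ ∈ words n t, wt (kill W p) σ y κ) ≤
      heavyMass (kill W p) θ t σ y := by
  rw [← sum_wt_eq_one hrow σ y t]
  unfold heavyMass
  rw [← Finset.sum_sub_distrib, ← Finset.sum_sub_distrib]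
  refine Finset.sum_le_sum fun κ _ => ?_
  have w0 := wt_nonneg hp σ y κ
  rw [wt_kill]
  by_cases a : ∀ z ∈ tails σ y κ, z ∉ W
  · simp [if_pos a]
  · simp only [if_neg a, not_le.2 hθ, if_false]
    split_ifs <;> linarith

lemma card_badLight_kill_le {p : Fin n → Fin n → ℝ} (hp : ∀ i j, 0 ≤ p i j)
    (hrow : ∀ i, ∑ j, p i j = 1) (hn : 0 < n) {t T : ℕ} {θ q K δ η : ℝ} {σ : Env n} (hθ : 0 < θ)
    (hσ : Spread p T q σ) (hδ : 0 < δ) (hT : t ≤ T)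
    (hK : T * Real.sqrt (K * q) ≤ δ * η / 4)
    (hbad : ((badLight p θ t δ σ).card : ℝ) ≤ η / 2 * n) {W : Finset (Fin n)}
    (hW : (W.card : ℝ) ≤ K) :
    ((badLight (kill W p) θ t (2 * δ) σ).card : ℝ) ≤ η * n := by
  refine card_le_of_visit hp hn hσ hδ hK hW hbad fun y hy => ?_
  have hov := (Finset.mem_filter.1 hy).2
  by_contra hcon
  push Not at hcon
  obtain ⟨h1, h2⟩ := hcon
  have h3 : 1 - δ ≤ heavyMass p θ t σ y := by
    by_contra h4
    exact h1 (Finset.mem_filter.2 ⟨Finset.mem_univ _, not_le.1 h4⟩)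
  have h5 := heavyMass_kill_ge hp hrow hθ W σ t y
  have h6 := kill_loss_le hp hrow W σ hT y
  linarith

lemma Pr_badLight_le {p : Fin n → Fin n → ℝ} (hp : ∀ i j, 0 ≤ p i j)
    (hrow : ∀ i, ∑ j, p i j = 1) (hn : 0 < n) {t : ℕ} {θ δ η bL : ℝ} (hδ : 0 < δ) (hη : 0 < η)
    (hL : Ex (fun σ => (∑ y, lightMass p θ t σ y) / n) ≤ bL) :
    Pr n (fun σ => η * n < (badLight p θ t δ σ).card) ≤ bL / (η * δ) := by
  have hn' : (0 : ℝ) < n := by exact_mod_cast hn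
  refine (Pr_le_Ex_div (fun σ => div_nonneg (Finset.sum_nonneg fun y _ =>
    lightMass_nonneg hp θ t σ y) hn'.le) (a := η * δ) (by positivity) fun σ hσ => ?_).trans
    (div_le_div_of_nonneg_right hL (by positivity))
  have h1 := card_filter_lt_le (fun y => lightMass_nonneg hp θ t σ y) hδ
  have hsub : badLight p θ t δ σ ⊆ Finset.univ.filter fun y => δ < lightMass p θ t σ y := by
    intro y hy
    have h2 := heavyMass_add_lightMass p θ t σ y
    rw [sum_wt_eq_one hrow] at h2
    refine Finset.mem_filter.2 ⟨Finset.mem_univ _, ?_⟩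
    linarith [(Finset.mem_filter.1 hy).2]
  have h3 := hσ.trans_le ((Nat.cast_le.2 (Finset.card_le_card hsub)).trans h1)
  rw [lt_div_iff₀ hδ] at h3
  rw [le_div_iff₀ hn']
  linarith

lemma ov_ge_of_reaches {p : Fin n → Fin n → ℝ} (hp : ∀ i j, 0 ≤ p i j)
    (hrow : ∀ i, ∑ j, p i j = 1) {s D h : ℕ} {w δ δ' : ℝ} (hδ' : 0 ≤ δ') {σ : Env n} {x : Fin n}
    {W : Finset (Fin n)} (hx : Reaches p D w δ (badMix (kill W p) s D h δ' σ) σ x) :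
    1 - δ - δ' ≤ ov p σ (s + D + (1 + h)) h x := by
  obtain ⟨A, hA, hAw, hsum⟩ := hx
  have hA1 := sum_prefixFree_wt_le hp hrow hA (fun κ hκ => (hAw κ hκ).1) σ x
  set t := s + D + (1 + h) with ht
  have hker : ∀ j, ∑ κ ∈ A, wt p σ x κ * kern p σ (t - κ.length) (run σ x κ) j ≤
      kern p σ t x j := by
    intro j
    have h1 := sum_prefixFree_le hA (T := t) (fun κ hκ => by have := (hAw κ hκ).1; omega)
      (f := fun κ => if run σ x κ = j then wt p σ x κ else 0)
      (fun κ => by split_ifs; exacts [wt_nonneg hp _ _ _, le_rfl])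
    refine le_trans (le_of_eq ?_) h1
    refine Finset.sum_congr rfl fun κ _ => ?_
    simp only [kern, Finset.mul_sum, run_append, wt_append, mul_ite, mul_zero]
  have hmin : ∀ j, ∑ κ ∈ A, wt p σ x κ * min (kern p σ (t - κ.length) (run σ x κ) j)
      (unif p σ h j) ≤ min (kern p σ t x j) (unif p σ h j) := by
    intro j
    refine le_min ((Finset.sum_le_sum fun κ _ => mul_le_mul_of_nonneg_left (min_le_left _ _)
      (wt_nonneg hp σ x κ)).trans (hker j)) ?_
    refine (Finset.sum_le_sum fun κ _ => mul_le_mul_of_nonneg_left (min_le_right _ _)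
      (wt_nonneg hp σ x κ)).trans ?_
    rw [← Finset.sum_mul]
    exact mul_le_of_le_one_left (unif_nonneg hp _ _ _) hA1
  have hov : ∑ κ ∈ A, wt p σ x κ * ov p σ (t - κ.length) h (run σ x κ) ≤ ov p σ t h x := by
    unfold ov
    simp only [Finset.mul_sum]
    rw [Finset.sum_comm]
    exact Finset.sum_le_sum fun j _ => hmin j
  have hge : ∑ κ ∈ A, wt p σ x κ * (1 - δ') ≤
      ∑ κ ∈ A, wt p σ x κ * ov p σ (t - κ.length) h (run σ x κ) := by
    refine Finset.sum_le_sum fun κ hκ => mul_le_mul_of_nonneg_left ?_ (wt_nonneg hp _ _ _)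
    obtain ⟨h1, -, h3⟩ := hAw κ hκ
    have h4 : 1 - δ' ≤ ov (kill W p) σ (t - κ.length) h (run σ x κ) := by
      by_contra h5
      refine h3 (Finset.mem_filter.2 ⟨Finset.mem_univ _, D - κ.length, by omega, ?_⟩)
      rw [show s + (D - κ.length) + (1 + h) = t - κ.length by omega]
      exact not_le.1 h5
    refine h4.trans (Finset.sum_le_sum fun j _ => min_le_min ?_ ?_)
    · exact kern_mono (kill_nonneg hp W) (kill_le hp W) _ _ _ _
    · exact unif_mono (kill_nonneg hp W) (kill_le hp W) _ _ _
  rw [← Finset.sum_mul] at hge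
  nlinarith

lemma heavyMass_ge_of_reaches {p : Fin n → Fin n → ℝ} (hp : ∀ i j, 0 ≤ p i j)
    (hrow : ∀ i, ∑ j, p i j = 1) {D t : ℕ} (hD : D ≤ t) {w θ δ δ' : ℝ} (hδ' : 0 ≤ δ')
    (hθ : 0 ≤ θ) {σ : Env n} {x : Fin n}
    {W : Finset (Fin n)} (hx : Reaches p D w δ (badLight (kill W p) θ t δ' σ) σ x) :
    1 - δ - δ' ≤ heavyMass p (w * θ) t σ x := by
  obtain ⟨A, hA, hAw, hsum⟩ := hx
  have hA1 := sum_prefixFree_wt_le hp hrow hA (fun κ hκ => (hAw κ hκ).1) σ x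
  have h1 := sum_prefixFree_le hA (T := t) (fun κ hκ => by have := (hAw κ hκ).1; omega)
    (f := fun κ => if w * θ ≤ wt p σ x κ then wt p σ x κ else 0)
    (fun κ => by split_ifs; exacts [wt_nonneg hp _ _ _, le_rfl])
  have h2 : ∑ κ ∈ A, wt p σ x κ * heavyMass p θ (t - κ.length) σ (run σ x κ) ≤
      heavyMass p (w * θ) t σ x := by
    refine le_trans (Finset.sum_le_sum fun κ hκ => ?_) h1
    unfold heavyMass
    rw [Finset.mul_sum]
    refine Finset.sum_le_sum fun κ' _ => ?_
    rw [wt_append]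
    have w0 := wt_nonneg hp σ x κ
    have w0' := wt_nonneg hp σ (run σ x κ) κ'
    by_cases a : θ ≤ wt p σ (run σ x κ) κ'
    · rw [if_pos a, if_pos (mul_le_mul (hAw κ hκ).2.1 a hθ w0)]
    · rw [if_neg a, mul_zero]
      split_ifs; exacts [mul_nonneg w0 w0', le_rfl]
  have hge : ∑ κ ∈ A, wt p σ x κ * (1 - δ') ≤
      ∑ κ ∈ A, wt p σ x κ * heavyMass p θ (t - κ.length) σ (run σ x κ) := by
    refine Finset.sum_le_sum fun κ hκ => mul_le_mul_of_nonneg_left ?_ (wt_nonneg hp _ _ _)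
    obtain ⟨h1, -, h3⟩ := hAw κ hκ
    have h4 : 1 - δ' ≤ heavyMass (kill W p) θ t σ (run σ x κ) := by
      by_contra h5
      exact h3 (Finset.mem_filter.2 ⟨Finset.mem_univ _, not_le.1 h5⟩)
    have h5 : heavyMass (kill W p) θ t σ (run σ x κ) ≤ heavyMass p θ t σ (run σ x κ) := by
      refine Finset.sum_le_sum fun κ' _ => ?_
      have h6 := wt_mono (kill_nonneg hp W) (kill_le hp W) σ (run σ x κ) κ'
      have h7 := wt_nonneg hp σ (run σ x κ) κ'
      split_ifs with c d d
      · exact h6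
      · exact absurd (c.trans h6) d
      · exact h7
      · exact le_rfl
    have h6 := heavyMass_add_le hp (fun i => (hrow i).le) θ (t - κ.length) κ.length σ (run σ x κ)
    rw [show t - κ.length + κ.length = t by omega] at h6
    linarith
  rw [← Finset.sum_mul] at hge
  nlinarith

lemma kern_one (p : Fin n → Fin n → ℝ) (σ : Env n) (i j : Fin n) :
    kern p σ 1 i j = Pmat n p σ i j := by
  rw [← matPow_eq_kern]; simp [matPow]

lemma sum_kern_eq_one {p : Fin n → Fin n → ℝ} (hrow : ∀ i, ∑ j, p i j = 1) (σ : Env n) (T : ℕ)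
    (x : Fin n) : ∑ j, kern p σ T x j = 1 := by
  rw [sum_kern, sum_wt_eq_one hrow]

/-- Every stochastic matrix has a stationary distribution. -/
lemma exists_statDist {P : Fin n → Fin n → ℝ} (hP : ∀ i j, 0 ≤ P i j)
    (hrow : ∀ i, ∑ j, P i j = 1) (hn : 0 < n) : ∃ π, StatDist n P π := by
  set M : Matrix (Fin n) (Fin n) ℝ := Matrix.of P - 1 with hM
  have hdet : M.det = 0 := by
    refine Matrix.exists_mulVec_eq_zero_iff.1 ⟨fun _ => 1, ?_, ?_⟩
    · intro h0
      have := congrFun h0 ⟨0, hn⟩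
      simp at this
    · ext i
      simp [hM, Matrix.mulVec, dotProduct, hrow, Matrix.one_apply]
  obtain ⟨v, hv0, hv⟩ := Matrix.exists_vecMul_eq_zero_iff.2 hdet
  have hvP : ∀ j, ∑ i, v i * P i j = v j := by
    intro j
    have := congrFun hv j
    simp only [hM, Matrix.vecMul_sub, Matrix.vecMul_one, Pi.sub_apply, Pi.zero_apply,
      sub_eq_zero] at this
    rw [← this]
    rfl
  have hle : ∀ j, |v j| ≤ ∑ i, |v i| * P i j := fun j => by
    rw [← hvP j]
    refine (Finset.abs_sum_le_sum_abs _ _).trans (le_of_eq ?_)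
    exact Finset.sum_congr rfl fun i _ => by
      rw [abs_mul, abs_of_nonneg (hP i j)]
  have htot : ∑ j, ∑ i, |v i| * P i j = ∑ j, |v j| := by
    rw [Finset.sum_comm]
    exact Finset.sum_congr rfl fun i _ => by rw [← Finset.mul_sum, hrow, mul_one]
  have heq : ∀ j, |v j| = ∑ i, |v i| * P i j := fun j =>
    (Finset.sum_eq_sum_iff_of_le fun j _ => hle j).1 htot.symm j (Finset.mem_univ j)
  have hpos : 0 < ∑ j, |v j| := by
    obtain ⟨j, hj⟩ := Function.ne_iff.1 hv0
    exact Finset.sum_pos' (fun j _ => abs_nonneg _) ⟨j, Finset.mem_univ j, abs_pos.2 hj⟩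
  refine ⟨fun j => |v j| / ∑ j, |v j|, fun j => by positivity, ?_, fun j => ?_⟩
  · rw [← Finset.sum_div, div_self hpos.ne']
  · simp only [div_mul_eq_mul_div]
    rw [← Finset.sum_div, ← heq j]

lemma statDist_kern {p : Fin n → Fin n → ℝ} {σ : Env n} {π : Fin n → ℝ}
    (h : StatDist n (Pmat n p σ) π) (t : ℕ) (j : Fin n) : ∑ i, π i * kern p σ t i j = π j := by
  induction t generalizing j with
  | zero => simp [kern_zero]
  | succ t ih =>
    simp only [kern_add', Finset.mul_sum]
    rw [Finset.sum_comm]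
    calc _ = ∑ y, (∑ i, π i * kern p σ t i y) * kern p σ 1 y j :=
          Finset.sum_congr rfl fun y _ => by
            rw [Finset.sum_mul]; exact Finset.sum_congr rfl fun i _ => by ring
      _ = ∑ y, π y * Pmat n p σ y j := Finset.sum_congr rfl fun y _ => by rw [ih, kern_one]
      _ = π j := h.2.2 j

/-- An average of rows close to `ν` is close to `ν`. -/
lemma sum_abs_mix_le {K : Fin n → Fin n → ℝ} {ν μ : Fin n → ℝ} {b : ℝ}
    (hK : ∀ x, ∑ j, |K x j - ν j| ≤ b) :
    ∑ j, |∑ x, μ x * (K x j - ν j)| ≤ (∑ x, |μ x|) * b := by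
  calc _ ≤ ∑ j, ∑ x, |μ x| * |K x j - ν j| := Finset.sum_le_sum fun j _ =>
        (Finset.abs_sum_le_sum_abs _ _).trans (le_of_eq (Finset.sum_congr rfl fun x _ =>
          abs_mul _ _))
    _ = ∑ x, |μ x| * ∑ j, |K x j - ν j| := by
        rw [Finset.sum_comm]; simp only [Finset.mul_sum]
    _ ≤ ∑ x, |μ x| * b := Finset.sum_le_sum fun x _ =>
        mul_le_mul_of_nonneg_left (hK x) (abs_nonneg _)
    _ = _ := by rw [Finset.sum_mul]

lemma sum_abs_kern_unif {p : Fin n → Fin n → ℝ} 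
    (hrow : ∀ i, ∑ j, p i j = 1) (hn : 0 < n) (σ : Env n) (u h : ℕ) (x : Fin n) :
    ∑ j, |kern p σ u x j - unif p σ h j| = 2 * (1 - ov p σ u h x) := by
  have h1 : ∀ j, |kern p σ u x j - unif p σ h j| =
      kern p σ u x j + unif p σ h j - 2 * min (kern p σ u x j) (unif p σ h j) := by
    intro j
    rcases le_total (kern p σ u x j) (unif p σ h j) with h | h
    · rw [abs_of_nonpos (by linarith), min_eq_left h]; ring
    · rw [abs_of_nonneg (by linarith), min_eq_right h]; ring
  simp only [h1, Finset.sum_sub_distrib, Finset.sum_add_distrib, ← Finset.mul_sum]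
  rw [sum_kern_eq_one hrow, sum_unif_eq hrow hn]
  unfold ov; ring

/-- Mixing at time `t` gives a unique stationary distribution, close to the laws after `t`. -/
lemma stationary_of_ov {p : Fin n → Fin n → ℝ} (hp : ∀ i j, 0 ≤ p i j)
    (hrow : ∀ i, ∑ j, p i j = 1) (hn : 0 < n) {σ : Env n} {t h : ℕ} {δ : ℝ} (hδ : δ < 1 / 2)
    (hov : ∀ x, 1 - δ ≤ ov p σ t h x) :
    ∃ π, StatDist n (Pmat n p σ) π ∧ (∀ π', StatDist n (Pmat n p σ) π' → π' = π) ∧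
      ∑ j, |π j - unif p σ h j| ≤ 2 * δ ∧
      ∀ t', t ≤ t' → ∀ x, tv n (fun j => matPow n (Pmat n p σ) t' x j) π ≤ 2 * δ := by
  have hrows : ∀ x, ∑ j, |kern p σ t x j - unif p σ h j| ≤ 2 * δ := fun x => by
    rw [sum_abs_kern_unif hrow hn]; linarith [hov x]
  have hδ0 : 0 ≤ δ := by
    have := (Finset.sum_nonneg fun j _ => abs_nonneg _).trans (hrows ⟨0, hn⟩)
    linarith
  obtain ⟨π, hπ⟩ := exists_statDist (P := Pmat n p σ)
    (fun i j => hp _ _) (fun i => by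
      rw [← hrow i]
      exact Equiv.sum_comp (σ i).symm (p i)) hn
  have hclose : ∀ μ : Fin n → ℝ, (∀ x, 0 ≤ μ x) → ∑ x, μ x = 1 →
      ∑ j, |∑ x, μ x * kern p σ t x j - unif p σ h j| ≤ 2 * δ := by
    intro μ h0 h1
    have := sum_abs_mix_le (μ := μ) hrows
    simp only [abs_of_nonneg (h0 _), h1, one_mul, mul_sub, Finset.sum_sub_distrib,
      ← Finset.sum_mul] at this
    exact this
  have hπν : ∑ j, |π j - unif p σ h j| ≤ 2 * δ := by
    have := hclose π hπ.1 hπ.2.1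
    simpa only [statDist_kern hπ] using this
  refine ⟨π, hπ, fun π' hπ' => ?_, hπν, fun t' ht' x => ?_⟩
  · have h1 := sum_abs_mix_le (μ := fun x => π' x - π x) hrows
    have h2 : ∀ j, ∑ x, (π' x - π x) * (kern p σ t x j - unif p σ h j) = π' j - π j := by
      intro j
      simp only [mul_sub, sub_mul, Finset.sum_sub_distrib, ← Finset.sum_mul]
      rw [statDist_kern hπ, statDist_kern hπ', hπ.2.1, hπ'.2.1]
      ring
    simp only [h2] at h1
    have h3 : 0 ≤ ∑ j, |π' j - π j| := Finset.sum_nonneg fun j _ => abs_nonneg _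
    have h4 : ∑ j, |π' j - π j| = 0 := by nlinarith
    funext j
    have := (Finset.sum_eq_zero_iff_of_nonneg fun j _ => abs_nonneg _).1 h4 j (Finset.mem_univ j)
    linarith [abs_eq_zero.1 this]
  · unfold tv
    have h1 := hclose (fun y => kern p σ (t' - t) x y) (fun y => kern_nonneg hp _ _ _ _)
      (sum_kern_eq_one hrow σ _ x)
    simp only [← kern_add', show t' - t + t = t' by omega] at h1
    have h2 : ∑ j, |kern p σ t' x j - π j| ≤
        ∑ j, (|kern p σ t' x j - unif p σ h j| + |π j - unif p σ h j|) :=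
      Finset.sum_le_sum fun j _ => by
        rw [abs_sub_comm (π j)]; exact abs_sub_le _ _ _
    rw [Finset.sum_add_distrib] at h2
    simp only [matPow_eq_kern]
    linarith

lemma sub_le_tv {μ π : Fin n → ℝ} (hμ : ∑ j, μ j = 1) (hπ : ∑ j, π j = 1) (S : Finset (Fin n)) :
    ∑ j ∈ S, μ j - ∑ j ∈ S, π j ≤ tv n μ π := by
  unfold tv
  have h1 := Finset.sum_add_sum_compl S (fun j => |μ j - π j|)
  have h2 := Finset.sum_add_sum_compl S μ
  have h3 := Finset.sum_add_sum_compl S π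
  have h4 : ∑ j ∈ S, (μ j - π j) ≤ ∑ j ∈ S, |μ j - π j| := Finset.sum_le_sum fun j _ => le_abs_self _
  have h5 : ∑ j ∈ Sᶜ, (π j - μ j) ≤ ∑ j ∈ Sᶜ, |μ j - π j| := Finset.sum_le_sum fun j _ => by
    rw [abs_sub_comm]; exact le_abs_self _
  rw [Finset.sum_sub_distrib] at h4 h5
  linarith

/-- If the walk follows heavy words while `π` is spread out, the law of the walk is far from `π`. -/
lemma tv_ge_of_heavy {p : Fin n → Fin n → ℝ} (hp : ∀ i j, 0 ≤ p i j)
    (hrow : ∀ i, ∑ j, p i j = 1) {σ : Env n} {t h : ℕ} {δ δ' θ q : ℝ} (hθ : 0 < θ) {x : Fin n}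
    (hheavy : 1 - δ' ≤ heavyMass p θ t σ x) (hq : ∑ j, unif p σ h j ^ 2 ≤ q)
    {π : Fin n → ℝ} (hπ1 : ∑ j, π j = 1) (hπ : ∑ j, |π j - unif p σ h j| ≤ 2 * δ) :
    1 - δ' - 2 * δ - Real.sqrt (1 / θ * q) ≤
      tv n (fun j => matPow n (Pmat n p σ) t x j) π := by
  set H := (words n t).filter fun κ => θ ≤ wt p σ x κ with hH
  set S := H.image (run σ x) with hS
  have hcard : (S.card : ℝ) ≤ 1 / θ := le_trans (by exact_mod_cast Finset.card_image_le)
    (card_heavy_words_le hp (fun i => (hrow i).le) hθ σ x t)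
  have h1 : heavyMass p θ t σ x ≤ ∑ j ∈ S, kern p σ t x j := by
    unfold heavyMass kern
    rw [Finset.sum_comm]
    refine Finset.sum_le_sum fun κ hκ => ?_
    have h0 : ∀ j ∈ S, 0 ≤ if run σ x κ = j then wt p σ x κ else 0 := fun j _ => by
      split_ifs; exacts [wt_nonneg hp _ _ _, le_rfl]
    by_cases a : θ ≤ wt p σ x κ
    · rw [if_pos a]
      have hm : run σ x κ ∈ S := Finset.mem_image_of_mem _ (Finset.mem_filter.2 ⟨hκ, a⟩)
      have := Finset.single_le_sum h0 hm
      simpa using this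
    · rw [if_neg a]; exact Finset.sum_nonneg h0
  have h2 : ∑ j ∈ S, unif p σ h j ≤ Real.sqrt (1 / θ * q) := by
    refine Real.le_sqrt_of_sq_le (sq_sum_le_card_mul_sum_sq.trans ?_)
    refine mul_le_mul hcard ?_ (Finset.sum_nonneg fun _ _ => sq_nonneg _) (by positivity)
    exact (Finset.sum_le_sum_of_subset_of_nonneg (Finset.subset_univ S)
      fun _ _ _ => sq_nonneg _).trans hq
  have h3 : ∑ j ∈ S, π j - ∑ j ∈ S, unif p σ h j ≤ 2 * δ := by
    rw [← Finset.sum_sub_distrib]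
    refine le_trans ?_ hπ
    refine (Finset.sum_le_sum fun j _ => le_abs_self _).trans ?_
    exact Finset.sum_le_sum_of_subset_of_nonneg (Finset.subset_univ S) fun _ _ _ => abs_nonneg _
  have h4 := sub_le_tv (μ := fun j => matPow n (Pmat n p σ) t x j)
    (by simp only [matPow_eq_kern]; exact sum_kern_eq_one hrow σ t x) hπ1 S
  simp only [matPow_eq_kern] at h4 ⊢
  linarith

lemma heavyMass_kill_congr {W : Finset (Fin n)} {σ σ' : Env n} (h : ∀ y, y ∉ W → σ y = σ' y)
    (p : Fin n → Fin n → ℝ) (θ : ℝ) (t : ℕ) (y : Fin n) :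
    heavyMass (kill W p) θ t σ' y = heavyMass (kill W p) θ t σ y := by
  unfold heavyMass
  refine Finset.sum_congr rfl fun κ _ => ?_
  rw [(walk_kill_congr h p y κ).1]

lemma badLight_kill_congr {W : Finset (Fin n)} {σ σ' : Env n} (h : ∀ y, y ∉ W → σ y = σ' y)
    (p : Fin n → Fin n → ℝ) (θ : ℝ) (t : ℕ) (δ : ℝ) :
    badLight (kill W p) θ t δ σ' = badLight (kill W p) θ t δ σ := by
  unfold badLight
  simp only [heavyMass_kill_congr h p]

lemma unif_kill_congr {W : Finset (Fin n)} {σ σ' : Env n} (h : ∀ y, y ∉ W → σ y = σ' y)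
    (p : Fin n → Fin n → ℝ) (t : ℕ) (j : Fin n) :
    unif (kill W p) σ' t j = unif (kill W p) σ t j := by
  unfold unif
  simp only [kern_kill_congr h p]

lemma badMix_kill_congr {W : Finset (Fin n)} {σ σ' : Env n} (h : ∀ y, y ∉ W → σ y = σ' y)
    (p : Fin n → Fin n → ℝ) (s D k : ℕ) (δ : ℝ) :
    badMix (kill W p) s D k δ σ' = badMix (kill W p) s D k δ σ := by
  unfold badMix ov
  simp only [kern_kill_congr h p, unif_kill_congr h p]

lemma Pr_not_spread_le {p : Fin n → Fin n → ℝ} (hp : ∀ i j, 0 ≤ p i j)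
    (hp1 : ∀ i, ∑ j, p i j ≤ 1) {T : ℕ} (hn : 2 * (T + T + 2) ^ 2 ≤ n) {q : ℝ} (hq : 0 < q) :
    Pr n (fun σ => ¬ Spread p T q σ) ≤
      (T * (6 * (((T : ℝ) + T + 2) ^ 2 / n) + 1 / n)) / q := by
  have hn0 : (0 : ℝ) < n := by
    have : 0 < n := lt_of_lt_of_le (by positivity) hn
    exact_mod_cast this
  refine (Pr_mono (F := fun σ => q ≤ ∑ t ∈ Finset.range T, ∑ j, unif p σ t j ^ 2) ?_).trans
    ((Pr_le_Ex_div (fun σ => by positivity) hq fun σ h => h).trans ?_)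
  · intro σ h
    unfold Spread at h
    push Not at h
    obtain ⟨t, ht, hlt⟩ := h
    refine hlt.le.trans ?_
    exact Finset.single_le_sum (f := fun t => ∑ j, unif p σ t j ^ 2)
      (fun i _ => by positivity) (Finset.mem_range.2 ht)
  · gcongr
    rw [Ex_sum]
    refine (Finset.sum_le_card_nsmul _ _ (6 * (((T : ℝ) + T + 2) ^ 2 / n) + 1 / n) ?_).trans
      (le_of_eq (by rw [Finset.card_range, nsmul_eq_mul]))
    intro t ht
    have ht' : t ≤ T := (Finset.mem_range.1 ht).le
    refine (unif_sq_bound hp hp1 (s := t) (le_trans (by gcongr) hn)).trans ?_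
    gcongr

/-- Powers of the logarithm are negligible against positive powers. -/
lemma eventually_log_pow_le (C : ℝ) (k : ℕ) {a b : ℝ} (ha : 0 < a) (hb : 0 < b) :
    ∀ᶠ n : ℕ in atTop, C * Real.log n ^ k ≤ b * (n : ℝ) ^ a := by
  have h := (isLittleO_log_rpow_rpow_atTop (k : ℝ) ha).const_mul_left C
  have h2 := (h.comp_tendsto tendsto_natCast_atTop_atTop).def hb
  filter_upwards [h2] with n hn
  simp only [Function.comp, Real.rpow_natCast, Real.norm_eq_abs] at hn
  have : |(n : ℝ) ^ a| = (n : ℝ) ^ a := abs_of_nonneg (by positivity)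
  rw [this] at hn
  exact (le_abs_self _).trans hn

lemma eventually_log_ge (C : ℝ) : ∀ᶠ n : ℕ in atTop, C ≤ Real.log n :=
  (Real.tendsto_log_atTop.comp tendsto_natCast_atTop_atTop).eventually_ge_atTop C

/-- A common upper bound for all the times under consideration. -/
noncomputable def horizon (n : ℕ) : ℕ := ⌊Real.log n ^ 2⌋₊

lemma horizon_le (n : ℕ) : (horizon n : ℝ) ≤ Real.log n ^ 2 :=
  Nat.floor_le (by positivity)

lemma eventually_horizon : ∀ᶠ n : ℕ in atTop, 2 * (3 * horizon n + 2) ^ 2 ≤ n := by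
  filter_upwards [eventually_log_pow_le 50 4 (a := 1) (b := 1) one_pos one_pos,
    eventually_log_ge 1] with n h h1
  have h2 := horizon_le n
  have : (2 * (3 * (horizon n : ℝ) + 2) ^ 2) ≤ n := by
    have h3 : 3 * (horizon n : ℝ) + 2 ≤ 5 * Real.log n ^ 2 := by nlinarith
    calc 2 * (3 * (horizon n : ℝ) + 2) ^ 2 ≤ 2 * (5 * Real.log n ^ 2) ^ 2 := by gcongr
      _ = 50 * Real.log n ^ 4 := by ring
      _ ≤ n := by simpa using h
  exact_mod_cast this

lemma eventually_le_horizon (C : ℝ) :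
    ∀ᶠ n : ℕ in atTop, ∀ t : ℕ, (t : ℝ) ≤ C * Real.log n → t ≤ horizon n := by
  filter_upwards [eventually_log_ge C, eventually_log_ge 0] with n h h0 t ht
  refine Nat.le_floor (ht.trans ?_)
  nlinarith

/-- The hypotheses of sparsity and non-degeneracy on a sequence of stochastic matrices. -/
structure Regular (p : (n : ℕ) → Fin n → Fin n → ℝ) : Prop where
  nonneg : ∀ n (i j : Fin n), 0 ≤ p n i j
  row : ∀ n (i : Fin n), ∑ j : Fin n, p n i j = 1
  bdd : ∃ C : ℝ, 1 ≤ C ∧ ∀ n : ℕ, avgEntropy n (p n) ≤ C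
  sparse : ∀ ε : ℝ, 0 < ε → ∀ᶠ n : ℕ in atTop, ∀ i : Fin n,
    ∑ j : Fin n, p n i j * (Real.log (p n i j)) ^ 2 ≤ ε * Real.log n
  nondeg : ∀ β : ℝ, 0 < β → ∃ e : ℝ, 0 < e ∧ e ≤ 1 / 2 ∧
    ∀ᶠ n : ℕ in atTop, (∑ i, ∑ j, gk (p n) e i j) / n ≤ β

lemma sum_gk_le_two {p : Fin n → Fin n → ℝ} (hp : ∀ i j, 0 ≤ p i j)
    (hrow : ∀ i, ∑ j, p i j = 1) {e : ℝ} (he : e ≤ 1 / 2) :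
    (∑ i, ∑ j, gk p e i j) / n ≤ 2 := by
  rcases Nat.eq_zero_or_pos n with rfl | hn
  · simp
  rw [div_le_iff₀ (by exact_mod_cast hn)]
  calc ∑ i, ∑ j, gk p e i j ≤ ∑ i, ∑ j, 2 * p i j := by
        refine Finset.sum_le_sum fun i _ => Finset.sum_le_sum fun j _ => ?_
        unfold gk
        split_ifs with h
        · linarith
        · linarith [hp i j]
    _ = 2 * n := by simp_rw [← Finset.mul_sum, hrow]; simp [mul_comm]

lemma exists_gk_le_of_tendsto {p : (n : ℕ) → Fin n → Fin n → ℝ}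
    (hnonneg : ∀ n (i j : Fin n), 0 ≤ p n i j)
    (hrow : ∀ n (i : Fin n), ∑ j : Fin n, p n i j = 1)
    (hnondeg : Tendsto (fun ε : ℝ =>
        Filter.limsup (fun n : ℕ =>
          (1 / (n : ℝ)) * ∑ i : Fin n, ∑ j : Fin n,
            if 1 - ε < p n i j then (1 : ℝ) else 0) atTop)
        (nhdsWithin 0 (Set.Ioi 0)) (nhds 0)) {β : ℝ} (hβ : 0 < β) :
    ∃ e : ℝ, 0 < e ∧ e ≤ 1 / 2 ∧ ∀ᶠ n : ℕ in atTop, (∑ i, ∑ j, gk (p n) e i j) / n ≤ β := by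
  have h1 := hnondeg.eventually (gt_mem_nhds hβ)
  have h2 : ∀ᶠ e : ℝ in nhdsWithin 0 (Set.Ioi 0), e ∈ Set.Ioc (0 : ℝ) (1 / 2) :=
    Ioc_mem_nhdsGT (by norm_num)
  obtain ⟨e, he, he0, he1⟩ := (h1.and h2).exists
  refine ⟨e, he0, he1, ?_⟩
  have hb : IsBoundedUnder (· ≤ ·) atTop (fun n : ℕ =>
      (1 / (n : ℝ)) * ∑ i : Fin n, ∑ j : Fin n, if 1 - e < p n i j then (1 : ℝ) else 0) := by
    refine isBoundedUnder_of ⟨2, fun n => ?_⟩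
    have := sum_gk_le_two (hnonneg n) (hrow n) he1
    rw [div_eq_inv_mul] at this
    rw [one_div]
    exact this
  filter_upwards [eventually_lt_of_limsup_lt he hb] with n hn
  rw [div_eq_inv_mul, ← one_div]
  exact hn.le

/-- A row without dominating entry has entropy bounded from below. -/
lemma row_entropy_ge {p : Fin n → Fin n → ℝ} (hp : ∀ i j, 0 ≤ p i j)
    (hrow : ∀ i, ∑ j, p i j = 1) {e : ℝ} (he0 : 0 ≤ e) (i : Fin n) :
    e * (1 - ∑ k, gk p e i k) ≤ -∑ k, p i k * Real.log (p i k) ∧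
      ∑ k, p i k ^ 2 ≤ 1 - e * (1 - ∑ k, gk p e i k) := by
  have hle : ∀ k, p i k ≤ 1 := fun k => by
    rw [← hrow i]; exact Finset.single_le_sum (fun j _ => hp i j) (Finset.mem_univ k)
  have hg0 : ∀ k, 0 ≤ gk p e i k := fun k => by unfold gk; split_ifs <;> norm_num
  have key : ∀ k, p i k * e - e * gk p e i k ≤ -(p i k * Real.log (p i k)) ∧
      p i k ^ 2 ≤ p i k - e * (p i k - gk p e i k) := by
    intro k
    have h1 := hle k
    have h0 := hp i k
    have hl : p i k * Real.log (p i k) ≤ p i k * (p i k - 1) := by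
      rcases h0.eq_or_lt with h | h
      · simp [← h]
      · exact mul_le_mul_of_nonneg_left (Real.log_le_sub_one_of_pos h) h0
    unfold gk
    split_ifs with h
    · have : Real.log (p i k) ≤ 0 := Real.log_nonpos h0 h1
      constructor <;> nlinarith [mul_nonneg h0 (neg_nonneg.2 this), mul_nonneg he0 (sub_nonneg.2 h1)]
    · push Not at h
      constructor <;> nlinarith
  constructor
  · calc e * (1 - ∑ k, gk p e i k) = ∑ k, (p i k * e - e * gk p e i k) := by
          rw [Finset.sum_sub_distrib, ← Finset.sum_mul, hrow, ← Finset.mul_sum]; ring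
      _ ≤ ∑ k, -(p i k * Real.log (p i k)) := Finset.sum_le_sum fun k _ => (key k).1
      _ = _ := by rw [Finset.sum_neg_distrib]
  · calc ∑ k, p i k ^ 2 ≤ ∑ k, (p i k - e * (p i k - gk p e i k)) :=
          Finset.sum_le_sum fun k _ => (key k).2
      _ = _ := by
          rw [Finset.sum_sub_distrib, ← Finset.mul_sum, Finset.sum_sub_distrib, hrow]

lemma entropy_ge {p : Fin n → Fin n → ℝ} (hp : ∀ i j, 0 ≤ p i j)
    (hrow : ∀ i, ∑ j, p i j = 1) (hn : 0 < n) {e : ℝ} (he0 : 0 ≤ e)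
    (hg : (∑ i, ∑ j, gk p e i j) / n ≤ 1 / 2) :
    e / 2 ≤ avgEntropy n p ∧ (∑ i, ∑ k, p i k ^ 2) / n ≤ 1 - e / 2 := by
  have hn' : (0 : ℝ) < n := by exact_mod_cast hn
  rw [div_le_iff₀ hn'] at hg
  have hs : ∑ i : Fin n, e * (1 - ∑ k, gk p e i k) ≥ e / 2 * n := by
    rw [← Finset.mul_sum, Finset.sum_sub_distrib]
    simp only [Finset.sum_const, Finset.card_univ, Fintype.card_fin, nsmul_eq_mul, mul_one]
    nlinarith
  constructor
  · have : avgEntropy n p = (∑ i, -∑ k, p i k * Real.log (p i k)) / n := by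
      unfold avgEntropy
      rw [Finset.sum_neg_distrib]; ring
    rw [this, le_div_iff₀ hn']
    exact hs.trans (Finset.sum_le_sum fun i _ => (row_entropy_ge hp hrow he0 i).1)
  · rw [div_le_iff₀ hn']
    refine (Finset.sum_le_sum fun i _ => (row_entropy_ge hp hrow he0 i).2).trans ?_
    rw [Finset.sum_sub_distrib]
    simp only [Finset.sum_const, Finset.card_univ, Fintype.card_fin, nsmul_eq_mul, mul_one]
    linarith

lemma Regular.entropy {p : (n : ℕ) → Fin n → Fin n → ℝ} (h : Regular p) :
    ∃ e : ℝ, 0 < e ∧ e < 1 ∧ ∀ᶠ n : ℕ in atTop,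
      e ≤ avgEntropy n (p n) ∧ (∑ i, ∑ k, p n i k ^ 2) / n ≤ 1 - e := by
  obtain ⟨e, he0, he1, he⟩ := h.nondeg (1 / 2) (by norm_num)
  refine ⟨e / 2, by linarith, by linarith, ?_⟩
  filter_upwards [he, eventually_gt_atTop 0] with n hg hn
  exact entropy_ge (h.nonneg n) (h.row n) hn he0.le hg

lemma eventually_loglog_sq_le (A B : ℝ) {ε : ℝ} (hε : 0 < ε) :
    ∀ᶠ n : ℕ in atTop, (A * Real.log (Real.log n) + B) ^ 2 ≤ ε * Real.log n := by
  have hl : Tendsto (fun n : ℕ => Real.log n) atTop atTop :=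
    Real.tendsto_log_atTop.comp tendsto_natCast_atTop_atTop
  have h1 : ∀ᶠ x : ℝ in atTop, (A * Real.log x + B) ^ 2 ≤ ε * x := by
    have h2 : (fun x : ℝ => A * Real.log x + B) =o[atTop] fun x : ℝ => x ^ (1 / 2 : ℝ) := by
      refine ((isLittleO_log_rpow_atTop (by norm_num)).const_mul_left A).add ?_
      exact Asymptotics.isLittleO_const_left.2 (Or.inr
        (tendsto_norm_atTop_atTop.comp (tendsto_rpow_atTop (by norm_num))))
    filter_upwards [h2.def (Real.sqrt_pos.2 hε), eventually_ge_atTop 0] with x hx h0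
    rw [Real.norm_eq_abs, ← Real.sqrt_eq_rpow, Real.norm_eq_abs, abs_of_nonneg (Real.sqrt_nonneg x)] at hx
    calc (A * Real.log x + B) ^ 2 = |A * Real.log x + B| ^ 2 := (sq_abs _).symm
      _ ≤ (√ε * √x) ^ 2 := by gcongr
      _ = ε * x := by rw [mul_pow, Real.sq_sqrt hε.le, Real.sq_sqrt h0]
  exact hl.eventually h1

lemma one_sub_pow_lt {e l : ℝ} (he0 : 0 < e) (he1 : e ≤ 1) (hl0 : 0 < l) {J : ℕ}
    (hJl : 6 * Real.log l / e ≤ J) : (1 - e) ^ (J + 1) < (l ^ 6)⁻¹ := by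
  calc (1 - e) ^ (J + 1) ≤ Real.exp (-e) ^ (J + 1) := by
        refine pow_le_pow_left₀ (by linarith) ?_ _
        linarith [Real.add_one_le_exp (-e)]
    _ = Real.exp (-(e * (J + 1))) := by rw [← Real.exp_nat_mul]; push_cast; ring_nf
    _ < Real.exp (-(6 * Real.log l)) := by
        rw [Real.exp_lt_exp]
        rw [div_le_iff₀ he0] at hJl
        nlinarith
    _ = (l ^ 6)⁻¹ := by
        have h6 : 6 * Real.log l = Real.log (l ^ 6) := by rw [Real.log_pow]; norm_num
        rw [Real.exp_neg, h6, Real.exp_log (by positivity)]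

set_option maxHeartbeats 800000 in
/-- Uniformly over the starting point, the walk loses most of its weight in a short time. -/
lemma Regular.eventually_heavy_le {p : (n : ℕ) → Fin n → Fin n → ℝ} (h : Regular p) {ε δ ρ : ℝ}
    (hε : 0 < ε) (hδ : 0 < δ) (hρ : 0 < ρ) :
    ∀ᶠ n : ℕ in atTop, Pr n (fun σ => ∃ x, δ < heavyMass (p n) ((Real.log n ^ 6)⁻¹)
      ⌊ε * Real.log n⌋₊ σ x) ≤ ρ := by
  set y : ℝ := 2 + Real.exp (2 / ε) + 4 / ρ with hy
  have hy2 : 2 ≤ y := by have := Real.exp_pos (2 / ε); have : 0 < 4 / ρ := by positivity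
                         linarith
  have hyρ : 4 / ρ ≤ y := by have := Real.exp_pos (2 / ε); linarith
  have hL : 2 / ε ≤ Real.log y := by
    rw [Real.le_log_iff_exp_le (by linarith)]
    have : 0 < 4 / ρ := by positivity
    linarith
  have hy0 : 0 < y := by linarith
  have hLp : 0 < Real.log y := lt_of_lt_of_le (by positivity) hL
  obtain ⟨e, he0, he1, he⟩ := h.nondeg (1 / (2 * y)) (by positivity)
  filter_upwards [he, eventually_horizon, eventually_le_horizon ε, eventually_log_ge 1,
    eventually_log_ge (4 / ε), eventually_log_ge (48 * (ε + 2) ^ 2 / δ / ρ),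
    eventually_loglog_sq_le (18 / e + 6) 10 (ε := ε / 4) (by positivity)]
    with n hg hn hs h1 h4 h48 hll
  set l := Real.log n with hl
  set s := ⌊ε * l⌋₊ with hsdef
  have hl0 : 0 < l := by linarith
  have hsl : (s : ℝ) ≤ ε * l := Nat.floor_le (by positivity)
  have hsl' : ε * l - 1 < s := Nat.sub_one_lt_floor _
  have hsT := hs s hsl
  have hn' : 2 * (s + 2) ^ 2 ≤ n := le_trans (by gcongr; omega) hn
  have hn0 : (0 : ℝ) < n := by
    have : 0 < n := lt_of_lt_of_le (by positivity) hn
    exact_mod_cast this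
  have hll0 : 0 ≤ Real.log l := Real.log_nonneg h1
  set J := ⌈6 * Real.log l / e⌉₊ with hJ
  set J' := ⌈6 * Real.log l⌉₊ with hJ'
  have hJu : (J : ℝ) < 6 * Real.log l / e + 1 := Nat.ceil_lt_add_one (by positivity)
  have hJl : 6 * Real.log l / e ≤ J := Nat.le_ceil _
  have hJ'u : (J' : ℝ) < 6 * Real.log l + 1 := Nat.ceil_lt_add_one (by positivity)
  have hJ'l : 6 * Real.log l ≤ J' := Nat.le_ceil _
  have hεl : 4 ≤ ε * l := by rwa [div_le_iff₀' hε] at h4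
  set R := (18 / e + 6) * Real.log l + 10 with hR
  have hR10 : 10 ≤ R := by
    have : 0 ≤ (18 / e + 6) * Real.log l := by positivity
    linarith
  have hMR : (J' : ℝ) + 2 * (J + 1) + 1 ≤ R := by
    have : 0 ≤ 6 * Real.log l / e := by positivity
    have h18 : (18 / e + 6) * Real.log l = 3 * (6 * Real.log l / e) + 6 * Real.log l := by ring
    linarith
  have hJ0 : (0 : ℝ) ≤ J' := Nat.cast_nonneg _
  have hJ1 : (0 : ℝ) ≤ J := Nat.cast_nonneg _
  have hbound := Pr_heavy_le (h.nonneg n) (fun i => (h.row n i).le) hn' (e := e) (y := y)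
    (θ := (l ^ 6)⁻¹) (δ := δ) (β := 1 / (2 * y)) hy2 (by linarith) he0.le hδ
    (by rw [div_le_div_iff₀ (by positivity) (by norm_num)]; linarith) (by positivity) hg
    (by field_simp; norm_num) (J := J) (M := J' + 2 * (J + 1) + 1) (J' := J')
    (by
      have : ((J : ℝ) + 1) * (J' + 2 * (J + 1) + 1) ≤ s := by nlinarith
      exact_mod_cast this) le_rfl
    (by
      have : (2 : ℝ) * (J + 1) + 1 ≤ s := by nlinarith
      exact_mod_cast this)
    (by
      have h3 : J' + (2 * (J + 1) + 1) + ⌈l / Real.log y⌉₊ ≤ s := by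
        have h5 : (⌈l / Real.log y⌉₊ : ℝ) < l / Real.log y + 1 := Nat.ceil_lt_add_one (by positivity)
        have h6 : l / Real.log y ≤ ε * l / 2 := by
          rw [div_le_iff₀ hLp]
          calc l = ε * l / 2 * (2 / ε) := by field_simp
            _ ≤ _ := by gcongr
        have : (J' : ℝ) + (2 * (J + 1) + 1) + ⌈l / Real.log y⌉₊ ≤ s := by nlinarith
        exact_mod_cast this
      have h7 : (n : ℝ) ≤ y ^ ⌈l / Real.log y⌉₊ := by
        rw [← Real.log_le_log_iff hn0 (by positivity), Real.log_pow]
        rw [← div_le_iff₀ hLp]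
        exact Nat.le_ceil _
      calc (n : ℝ) * y ^ J' ≤ y ^ ⌈l / Real.log y⌉₊ * y ^ J' := by gcongr
        _ = y ^ (⌈l / Real.log y⌉₊ + J') := by rw [pow_add]
        _ ≤ _ := pow_le_pow_right₀ (by linarith) (by omega))
    (one_sub_pow_lt he0 (by linarith) hl0 hJl)
  refine hbound.trans ?_
  have hyJ : l ^ 3 ≤ y ^ J' := by
    rw [← Real.log_le_log_iff (by positivity) (by positivity), Real.log_pow, Real.log_pow]
    have : (1 : ℝ) / 2 ≤ Real.log y := by
      have := Real.log_le_log (by norm_num) hy2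
      linarith [Real.log_two_gt_d9]
    push_cast
    nlinarith
  have hA : 6 * ((s : ℝ) + 2) ^ 2 / y ^ J' / δ ≤ ρ / 2 := by
    calc 6 * ((s : ℝ) + 2) ^ 2 / y ^ J' / δ ≤ 6 * ((ε + 2) * l) ^ 2 / l ^ 3 / δ := by
          gcongr; linarith
      _ = 6 * (ε + 2) ^ 2 / δ / l := by field_simp
      _ ≤ ρ / 2 := by
          rw [div_le_iff₀ hl0]
          rw [div_le_iff₀ hρ] at h48
          have : 48 * (ε + 2) ^ 2 / δ = 8 * (6 * (ε + 2) ^ 2 / δ) := by ring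
          have h0 : 0 ≤ 6 * (ε + 2) ^ 2 / δ := by positivity
          linarith
  have hBB : 4 * (1 / (2 * y)) ≤ ρ / 2 := by
    rw [div_le_iff₀ hρ] at hyρ
    have : 4 * (1 / (2 * y)) = 2 / y := by field_simp; norm_num
    rw [this, div_le_iff₀ hy0]
    linarith
  linarith

lemma Regular.eventually_spread {p : (n : ℕ) → Fin n → Fin n → ℝ} (h : Regular p) {a ρ : ℝ}
    (ha : 0 < a) (hρ : 0 < ρ) :
    ∀ᶠ n : ℕ in atTop,
      Pr n (fun σ => ¬ Spread (p n) (horizon n) ((n : ℝ) ^ a / n) σ) ≤ ρ := by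
  filter_upwards [eventually_horizon, eventually_log_ge 1,
    eventually_log_pow_le 97 6 ha hρ] with n hn h1 h97
  have hn0 : (0 : ℝ) < n := by
    have : 0 < n := lt_of_lt_of_le (by positivity) hn
    exact_mod_cast this
  refine (Pr_not_spread_le (h.nonneg n) (fun i => (h.row n i).le) (T := horizon n)
    (le_trans (by gcongr; omega) hn) (by positivity)).trans ?_
  have hT := horizon_le n
  set T : ℝ := (horizon n : ℝ)
  set l := Real.log n with hl
  have hT0 : 0 ≤ T := by positivity
  have h2 : T + T + 2 ≤ 4 * l ^ 2 := by nlinarith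
  have h4 : 1 ≤ l ^ 4 := one_le_pow₀ h1
  rw [div_le_iff₀ (by positivity)]
  calc T * (6 * ((T + T + 2) ^ 2 / n) + 1 / n) ≤
        l ^ 2 * (6 * ((4 * l ^ 2) ^ 2 / n) + l ^ 4 / n) := by gcongr
    _ = 97 * l ^ 6 / n := by ring
    _ ≤ ρ * (n : ℝ) ^ a / n := by gcongr
    _ = _ := by ring

lemma Reaches.mono {p : Fin n → Fin n → ℝ} {N : ℕ} {w δ δ' : ℝ} {B : Finset (Fin n)} {σ : Env n}
    {x : Fin n} (h : Reaches p N w δ B σ x) (hδ : δ ≤ δ') : Reaches p N w δ' B σ x := by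
  obtain ⟨A, h1, h2, h3⟩ := h
  exact ⟨A, h1, h2, by linarith⟩

lemma Regular.eventually_reaches {p : (n : ℕ) → Fin n → Fin n → ℝ} (h : Regular p)
    {ε c δ ρ : ℝ} (hε : 0 < ε) (hc : 0 < c) (hc1 : c ≤ 1 / 4) (hδ : 0 < δ) (hδ1 : δ ≤ 1)
    (hρ : 0 < ρ) :
    ∀ᶠ n : ℕ in atTop, ∀ B : Finset (Fin n) → Env n → Finset (Fin n),
      (∀ W σ σ', (∀ y, y ∉ W → σ y = σ' y) → B W σ' = B W σ) →
      Pr n (fun σ => (∀ W : Finset (Fin n), (W.card : ℝ) ≤ (n : ℝ) ^ (1 / 2 : ℝ) →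
          ((B W σ).card : ℝ) ≤ δ / 4 * n) ∧
        ∃ x, ∀ W : Finset (Fin n), (W.card : ℝ) ≤ (n : ℝ) ^ (1 / 2 : ℝ) →
          ¬ Reaches (p n) (⌊ε * Real.log n⌋₊ + 1) ((n : ℝ) ^ (-c) * (n : ℝ) ^ (-(c / 2)))
            (4 * δ) (B W σ) σ x) ≤ ρ := by
  set G : ℝ := ε + 1 with hG
  have hG1 : 1 ≤ G := by linarith
  filter_upwards [h.eventually_heavy_le hε hδ (show 0 < ρ / 3 by positivity),
    h.sparse (δ * c ^ 2 / (4 * G)) (by positivity),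
    eventually_horizon, eventually_le_horizon ε, eventually_log_ge 1,
    eventually_log_pow_le 1 6 (a := c / 2) (b := 1) (by positivity) one_pos,
    eventually_log_pow_le (2 * G) 4 (a := 1 / 2) (b := 1) (by norm_num) one_pos,
    eventually_log_pow_le (2 * G) 1 (a := 1 / 4) (b := 1) (by norm_num) one_pos,
    eventually_log_pow_le (486 * G ^ 5) 5 (a := 1 / 4) (b := ρ / 3) (by norm_num)
      (by positivity),
    eventually_log_ge (2 / (δ / (4 * G))), eventually_log_ge (-Real.log (ρ / 3)),
    eventually_log_ge (2 * G ^ 2 / δ)]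
    with n hheavy hsp hn hs h1 hl6 hl4 hl1 hl5 hlδ hlρ hlG B hB
  have hn0 : (0 : ℝ) < n := by
    have : 0 < n := lt_of_lt_of_le (by positivity) hn
    exact_mod_cast this
  have hn1 : (1 : ℝ) ≤ n := by
    have : 0 < n := lt_of_lt_of_le (by positivity) hn
    exact_mod_cast this
  set l := Real.log n with hl
  set s := ⌊ε * l⌋₊ with hsdef
  have hl0 : 0 < l := by linarith
  have hsl : (s : ℝ) ≤ ε * l := Nat.floor_le (by positivity)
  have hsT := hs s hsl
  have hsG : (s : ℝ) + 1 ≤ G * l := by rw [hG]; linarith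
  have hs0 : (0 : ℝ) < (s : ℝ) + 1 := by positivity
  have hlogτ : Real.log ((n : ℝ) ^ (-(c / 2))) = -(c / 2) * l := Real.log_rpow hn0 _
  have hγeq : δ * c ^ 2 / (4 * G) * l / Real.log ((n : ℝ) ^ (-(c / 2))) ^ 2 = δ / (G * l) := by
    rw [hlogτ]; field_simp; norm_num
  have hτ1 : (n : ℝ) ^ (-(c / 2)) < 1 := by
    refine Real.rpow_lt_one_of_one_lt_of_neg ?_ (by linarith)
    by_contra hcon
    push Not at hcon
    have : l ≤ 0 := Real.log_nonpos hn0.le hcon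
    linarith
  have hGl : 1 ≤ G * l := by nlinarith
  have hnc : (n : ℝ) ^ c ≤ (n : ℝ) ^ (1 / 4 : ℝ) := Real.rpow_le_rpow_of_exponent_le hn1 hc1
  have hmain := Pr_reaches (h.nonneg n) (h.row n) (s := s) (θ₁ := (l ^ 3)⁻¹) (θ₂ := (l ^ 6)⁻¹)
    (θc := (n : ℝ) ^ (-c)) (τ := (n : ℝ) ^ (-(c / 2))) (γ := δ / (G * l)) (δ := δ)
    (η := δ / 4) (ε₁ := ρ / 3) (K := (n : ℝ) ^ (1 / 2 : ℝ)) (B := B)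
    (by positivity) (inv_le_one_of_one_le₀ (one_le_pow₀ h1)) (by positivity)
    (inv_le_one_of_one_le₀ (one_le_pow₀ h1)) (by positivity) (by positivity)
    (by
      have : (n : ℝ) ^ (-c) = (n : ℝ) ^ (-(c / 2)) * (n : ℝ) ^ (-(c / 2)) := by
        rw [← Real.rpow_add hn0]; ring_nf
      rw [this]
      gcongr
      rw [Real.rpow_neg hn0.le]
      gcongr
      simpa using hl6)
    (by positivity) (by rw [div_le_one (by positivity)]; linarith)
    (fun x => by
      rw [← hγeq]
      exact row_trunc_loss (h.nonneg n) (by positivity) hτ1 x (h.row n x) (hsp x))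
    (by positivity)
    (by
      rw [Real.rpow_neg hn0.le, div_inv_eq_mul, div_inv_eq_mul]
      have e1 : ((s : ℝ) + 1) * l ^ 3 ≤ (n : ℝ) ^ (1 / 2 : ℝ) / 2 := by
        calc ((s : ℝ) + 1) * l ^ 3 ≤ G * l * l ^ 3 := by gcongr
          _ = 2 * G * l ^ 4 / 2 := by ring
          _ ≤ _ := by linarith
      have e2 : ((s : ℝ) + 1) * (n : ℝ) ^ c ≤ (n : ℝ) ^ (1 / 2 : ℝ) / 2 := by
        have e3 : (n : ℝ) ^ (1 / 2 : ℝ) = (n : ℝ) ^ (1 / 4 : ℝ) * (n : ℝ) ^ (1 / 4 : ℝ) := by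
          rw [← Real.rpow_add hn0]; norm_num
        calc ((s : ℝ) + 1) * (n : ℝ) ^ c ≤ G * l * (n : ℝ) ^ (1 / 4 : ℝ) := by gcongr
          _ = 2 * G * l ^ 1 * (n : ℝ) ^ (1 / 4 : ℝ) / 2 := by ring
          _ ≤ 1 * (n : ℝ) ^ (1 / 4 : ℝ) * (n : ℝ) ^ (1 / 4 : ℝ) / 2 := by gcongr
          _ = _ := by rw [e3]; ring
      linarith)
    hB hheavy
    (Pr_not_atMostTwo_le (h.nonneg n) (fun i => (h.row n i).le)
      (le_trans (by gcongr) hn) (by positivity))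
  refine (Pr_mono ?_).trans (hmain.trans ?_)
  · rintro σ ⟨hW, x, hx⟩
    refine ⟨hW, x, fun W hWK hre => hx W hWK (hre.mono ?_)⟩
    have e1 : (s : ℝ) * (δ / (G * l)) + δ / (G * l) ≤ δ := by
      calc (s : ℝ) * (δ / (G * l)) + δ / (G * l) = (s + 1) * (δ / (G * l)) := by ring
        _ ≤ G * l * (δ / (G * l)) := by gcongr
        _ = δ := by field_simp
    have e2 : 2 * ((s : ℝ) + 1) ^ 2 * (l ^ 6)⁻¹ / (l ^ 3)⁻¹ ≤ δ := by
      calc 2 * ((s : ℝ) + 1) ^ 2 * (l ^ 6)⁻¹ / (l ^ 3)⁻¹ ≤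
            2 * (G * l) ^ 2 * (l ^ 6)⁻¹ / (l ^ 3)⁻¹ := by gcongr
        _ = 2 * G ^ 2 / l := by field_simp
        _ ≤ δ := by
            rw [div_le_iff₀ hδ] at hlG
            rw [div_le_iff₀ hl0]; linarith
    linarith
  · have e1 : (n : ℝ) * (((s : ℝ) + 1) * (6 * ((3 * (s : ℝ) + 2) ^ 2 / n) ^ 2 /
        ((n : ℝ) ^ (-c)) ^ 3)) ≤ ρ / 3 := by
      rw [Real.rpow_neg hn0.le]
      have hn4 : (n : ℝ) = ((n : ℝ) ^ (1 / 4 : ℝ)) ^ 4 := by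
        rw [← Real.rpow_natCast, ← Real.rpow_mul hn0.le]; norm_num
      set m := (n : ℝ) ^ (1 / 4 : ℝ) with hm
      have hm0 : 0 < m := by positivity
      calc (n : ℝ) * (((s : ℝ) + 1) * (6 * ((3 * (s : ℝ) + 2) ^ 2 / n) ^ 2 /
            (((n : ℝ) ^ c)⁻¹) ^ 3))
          ≤ n * ((G * l) * (6 * ((3 * (G * l)) ^ 2 / n) ^ 2 / ((m)⁻¹) ^ 3)) := by
            gcongr; linarith
        _ = 486 * G ^ 5 * l ^ 5 * m ^ 3 / n := by field_simp; norm_num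
        _ ≤ (ρ / 3 * m) * m ^ 3 / n := by gcongr
        _ = ρ / 3 := by rw [hn4]; field_simp
    have e2 : (n : ℝ) * Real.exp ((2 * (δ / 4) - δ) / (2 * (s + 1) * (l ^ 3)⁻¹)) ≤ ρ / 3 := by
      have e3 : (2 * (δ / 4) - δ) / (2 * (s + 1) * (l ^ 3)⁻¹) ≤ -(2 * l) := by
        rw [div_le_iff₀ (by positivity)]
        rw [div_le_iff₀ (by positivity)] at hlδ
        have e4 : 4 * l * (s + 1) * (l ^ 3)⁻¹ ≤ 4 * G / l := by
          calc 4 * l * (s + 1) * (l ^ 3)⁻¹ ≤ 4 * l * (G * l) * (l ^ 3)⁻¹ := by gcongr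
            _ = 4 * G / l := by field_simp
        have e5 : 4 * G / l ≤ δ / 2 := by
          rw [div_le_iff₀ hl0]
          have : l * (δ / (4 * G)) * (4 * G) = l * δ := by field_simp
          nlinarith
        linarith
      calc (n : ℝ) * Real.exp ((2 * (δ / 4) - δ) / (2 * (s + 1) * (l ^ 3)⁻¹))
          ≤ Real.exp l * Real.exp (-(2 * l)) := by
            rw [hl, Real.exp_log hn0]; gcongr
        _ = Real.exp (-l) := by rw [← Real.exp_add]; ring_nf
        _ ≤ Real.exp (Real.log (ρ / 3)) := by gcongr; linarith
        _ = ρ / 3 := Real.exp_log (by positivity)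
    linarith

/-- The walk started from a uniform point has weight at least `θ` with high probability as long as
the elapsed entropy is below `-log θ`. -/
lemma Regular.eventually_lightMass_le {p : (n : ℕ) → Fin n → Fin n → ℝ} (h : Regular p)
    {b g C ρ : ℝ} (hg : 0 < g) (hC : 1 ≤ C) (hρ : 0 < ρ) :
    ∀ᶠ n : ℕ in atTop, ∀ t : ℕ, (t : ℝ) ≤ C * Real.log n →
      t * avgEntropy n (p n) ≤ (1 - b - g) * Real.log n →
      Ex (fun σ => (∑ x, lightMass (p n) ((n : ℝ) ^ b / n) t σ x) / n) ≤ ρ := by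
  set K : ℝ := (1 + |Real.log (18 / ρ)|) / g with hKdef
  have hK : 0 < K := by positivity
  set ζ : ℝ := min 1 (ρ / 3) / (C * K ^ 2) with hζdef
  have hζ : 0 < ζ := by positivity
  have hCK : C * K ^ 2 * ζ = min 1 (ρ / 3) := by rw [hζdef]; field_simp
  have hCK1 : C * K ^ 2 * ζ ≤ 1 := hCK.le.trans (min_le_left _ _)
  have hCKρ : C * K ^ 2 * ζ ≤ ρ / 3 := hCK.le.trans (min_le_right _ _)
  filter_upwards [h.sparse ζ hζ, eventually_horizon, eventually_le_horizon C,
    eventually_log_ge 1, eventually_log_pow_le (6 * (C + 2) ^ 2) 2 (a := 1) (b := ρ / 3) one_pos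
      (by positivity)] with n hsp hn hs h1 hl2 t ht htH
  have hn0 : (0 : ℝ) < n := by
    have : 0 < n := lt_of_lt_of_le (by positivity) hn
    exact_mod_cast this
  set l := Real.log n with hl
  have hl0 : 0 < l := by linarith
  have htT := hs t ht
  have hKl : (K / l) ^ 2 * (ζ * l) = K ^ 2 * ζ / l := by field_simp
  have hK2 : 0 < K ^ 2 * ζ := by positivity
  have hle1 : t * (K ^ 2 * ζ / l) ≤ C * K ^ 2 * ζ := by
    calc t * (K ^ 2 * ζ / l) ≤ C * l * (K ^ 2 * ζ / l) := by gcongr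
      _ = C * K ^ 2 * ζ := by field_simp
  refine (lln_light (h.nonneg n) (h.row n) (le_trans (by gcongr; omega) hn)
    (α := K / l) (Q := ζ * l) (by positivity) hsp ?_).trans ?_
  · rw [hKl, div_le_one hl0]
    nlinarith
  have hlog : Real.log ((n : ℝ) ^ b / n) = (b - 1) * l := by
    rw [Real.log_div (by positivity) hn0.ne', Real.log_rpow hn0]; ring
  rw [hKl, hlog]
  have e1 : 6 * (((t : ℝ) + 2) ^ 2 / n) ≤ ρ / 3 := by
    rw [← mul_div_assoc, div_le_iff₀ hn0]
    calc 6 * ((t : ℝ) + 2) ^ 2 ≤ 6 * ((C + 2) * l) ^ 2 := by gcongr; nlinarith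
      _ = 6 * (C + 2) ^ 2 * l ^ 2 := by ring
      _ ≤ ρ / 3 * n := by simpa using hl2
  have e2 : 6 * Real.exp (K / l * ((b - 1) * l) +
      t * (K / l * avgEntropy n (p n) + K ^ 2 * ζ / l)) ≤ ρ / 3 := by
    have e3 : K / l * ((b - 1) * l) + t * (K / l * avgEntropy n (p n) + K ^ 2 * ζ / l) ≤
        -Real.log (18 / ρ) := by
      have e4 : K / l * (t * avgEntropy n (p n)) ≤ K / l * ((1 - b - g) * l) := by gcongr
      have e5 : K / l * ((b - 1) * l) + K / l * ((1 - b - g) * l) = -(K * g) := by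
        field_simp; ring
      have e6 : K * g = 1 + |Real.log (18 / ρ)| := by rw [hKdef]; field_simp
      have := le_abs_self (Real.log (18 / ρ))
      nlinarith
    calc _ ≤ 6 * Real.exp (-Real.log (18 / ρ)) := by gcongr
      _ = ρ / 3 := by
        rw [Real.exp_neg, Real.exp_log (by positivity)]; field_simp; norm_num
  linarith

/-- The walk started from a uniform point has weight at most `θ` with high probability as soon as
the elapsed entropy is above `-log θ`. -/
lemma Regular.eventually_heavyMass_le {p : (n : ℕ) → Fin n → Fin n → ℝ} (h : Regular p)
    {b g C ρ : ℝ} (hg : 0 < g) (hC : 1 ≤ C) (hρ : 0 < ρ) :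
    ∀ᶠ n : ℕ in atTop, ∀ t : ℕ, (t : ℝ) ≤ C * Real.log n →
      (1 - b + g) * Real.log n ≤ t * avgEntropy n (p n) →
      Ex (fun σ => (∑ x, heavyMass (p n) ((n : ℝ) ^ b / n) t σ x) / n) ≤ ρ := by
  set K : ℝ := (1 + |Real.log (18 / ρ)|) / g with hKdef
  have hK : 0 < K := by positivity
  set ζ : ℝ := 1 / (C * K ^ 2) with hζdef
  have hζ : 0 < ζ := by positivity
  have hCK : C * K ^ 2 * ζ = 1 := by rw [hζdef]; field_simp
  filter_upwards [h.sparse ζ hζ, eventually_horizon, eventually_le_horizon C,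
    eventually_log_ge 1, eventually_log_pow_le (6 * (C + 2) ^ 2) 2 (a := 1) (b := ρ / 3) one_pos
      (by positivity)] with n hsp hn hs h1 hl2 t ht htH
  have hn0 : (0 : ℝ) < n := by
    have : 0 < n := lt_of_lt_of_le (by positivity) hn
    exact_mod_cast this
  set l := Real.log n with hl
  have hl0 : 0 < l := by linarith
  have htT := hs t ht
  have hKl : (K / l) ^ 2 * (ζ * l) = K ^ 2 * ζ / l := by field_simp
  have hle1 : t * (K ^ 2 * ζ / l) ≤ C * K ^ 2 * ζ := by
    calc t * (K ^ 2 * ζ / l) ≤ C * l * (K ^ 2 * ζ / l) := by gcongr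
      _ = C * K ^ 2 * ζ := by field_simp
  refine (lln_heavy (h.nonneg n) (fun i => (h.row n i).le) (le_trans (by gcongr; omega) hn)
    (α := K / l) (Q := ζ * l) (by positivity) (by positivity) hsp).trans ?_
  have hlog : Real.log ((n : ℝ) ^ b / n) = (b - 1) * l := by
    rw [Real.log_div (by positivity) hn0.ne', Real.log_rpow hn0]; ring
  rw [hKl, hlog]
  have e1 : 6 * (((t : ℝ) + 2) ^ 2 / n) ≤ ρ / 3 := by
    rw [← mul_div_assoc, div_le_iff₀ hn0]
    calc 6 * ((t : ℝ) + 2) ^ 2 ≤ 6 * ((C + 2) * l) ^ 2 := by gcongr; nlinarith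
      _ = 6 * (C + 2) ^ 2 * l ^ 2 := by ring
      _ ≤ ρ / 3 * n := by simpa using hl2
  have e2 : 6 * Real.exp (-(K / l) * ((b - 1) * l) +
      t * (-(K / l) * avgEntropy n (p n) + K ^ 2 * ζ / l)) ≤ ρ / 3 := by
    have e3 : -(K / l) * ((b - 1) * l) + t * (-(K / l) * avgEntropy n (p n) + K ^ 2 * ζ / l) ≤
        -Real.log (18 / ρ) := by
      have e4 : K / l * ((1 - b + g) * l) ≤ K / l * (t * avgEntropy n (p n)) := by gcongr
      have e5 : -(K / l) * ((b - 1) * l) - K / l * ((1 - b + g) * l) = -(K * g) := by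
        field_simp; ring
      have e6 : K * g = 1 + |Real.log (18 / ρ)| := by rw [hKdef]; field_simp
      have := le_abs_self (Real.log (18 / ρ))
      nlinarith
    calc _ ≤ 6 * Real.exp (-Real.log (18 / ρ)) := by gcongr
      _ = ρ / 3 := by
        rw [Real.exp_neg, Real.exp_log (by positivity)]; field_simp; norm_num
  linarith

lemma mul_sqrt_le {T x y : ℝ} (hT : 0 ≤ T) (hy : 0 ≤ y) (h : T ^ 2 * x ≤ y ^ 2) :
    T * √x ≤ y := by
  calc T * √x = √(T ^ 2 * x) := by rw [Real.sqrt_mul (by positivity), Real.sqrt_sq hT]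
    _ ≤ √(y ^ 2) := Real.sqrt_le_sqrt h
    _ = y := Real.sqrt_sq hy

lemma flow_le {p : Fin n → Fin n → ℝ} (hp : ∀ i j, 0 ≤ p i j) (hrow : ∀ i, ∑ j, p i j = 1)
    {u k T : ℕ} (hu : u ≤ T) (hk : k ≤ T) (hn : 2 * (T + T + 2) ^ 2 ≤ n) {θ θ' a r : ℝ}
    (ha : 0 < a) (hθ' : 0 ≤ θ') (hr : (∑ i, ∑ j, p i j ^ 2) / n ≤ r) (y : Fin n) :
    Ex (fun σ => flow p u k θ θ' σ y) ≤
      (n * a * (6 * (((T : ℝ) + T + 2) ^ 2 / n) + θ') +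
        (12 * (((T : ℝ) + T + 2) ^ 2 / n) + 6 * r ^ k) / a) / 2 := by
  have hp1 : ∀ i, ∑ j, p i j ≤ 1 := fun i => (hrow i).le
  refine (flow_bound hp hrow k ha y).trans ?_
  have h1 := sum_exitMass_sq_le hp hp1 (u := u) (le_trans (by gcongr) hn) (θ := θ) hθ' y
  have h2 := kern_sq_bound hp hp1 (h := k) (le_trans (by gcongr) hn)
  have h3 : 6 * (((u : ℝ) + u + 2) ^ 2 / n) + θ' ≤ 6 * (((T : ℝ) + T + 2) ^ 2 / n) + θ' := by
    gcongr
  have hr0 : 0 ≤ (∑ i, ∑ j, p i j ^ 2) / n := by positivity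
  have h4 : 12 * (((k : ℝ) + k + 2) ^ 2 / n) + 6 * ((∑ i, ∑ j, p i j ^ 2) / n) ^ k ≤
      12 * (((T : ℝ) + T + 2) ^ 2 / n) + 6 * r ^ k := by gcongr
  have h5 := h1.trans h3
  have h6 := h2.trans h4
  gcongr

lemma flow_arith {N T l m r : ℝ} (hT : 0 ≤ T) (hl : 1 ≤ l) (hm : 1 ≤ m) (hN : 0 < N)
    (hmN : m ^ 8 ≤ N) (hTl : T + T + 2 ≤ 4 * l ^ 2) (hr : r ≤ 1 / m ^ 5) :
    (N * (1 / m ^ 4) * (6 * ((T + T + 2) ^ 2 / N) + m ^ 3 / N) +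
      (12 * ((T + T + 2) ^ 2 / N) + 6 * r) / (1 / m ^ 4)) / 2 ≤ 150 * l ^ 6 / m := by
  have hm0 : 0 < m := by linarith
  have hl46 : l ^ 4 ≤ l ^ 6 := pow_le_pow_right₀ hl (by norm_num)
  have hl41 : 1 ≤ l ^ 6 := one_le_pow₀ hl
  have hmm : m ≤ m ^ 4 := le_self_pow₀ hm (by norm_num)
  have h46 : l ^ 4 / m ^ 4 ≤ l ^ 6 / m := by gcongr
  have h16 : 1 / m ≤ l ^ 6 / m := by gcongr
  have e1 : N * (1 / m ^ 4) * (6 * ((T + T + 2) ^ 2 / N) + m ^ 3 / N) ≤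
      96 * (l ^ 4 / m ^ 4) + 1 / m := by
    calc N * (1 / m ^ 4) * (6 * ((T + T + 2) ^ 2 / N) + m ^ 3 / N) ≤
          N * (1 / m ^ 4) * (6 * ((4 * l ^ 2) ^ 2 / N) + m ^ 3 / N) := by gcongr
      _ = 96 * (l ^ 4 / m ^ 4) + 1 / m := by field_simp; ring
  have e2 : (12 * ((T + T + 2) ^ 2 / N) + 6 * r) / (1 / m ^ 4) ≤
      192 * (l ^ 4 / m ^ 4) + 6 * (1 / m) := by
    calc (12 * ((T + T + 2) ^ 2 / N) + 6 * r) / (1 / m ^ 4) ≤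
          (12 * ((4 * l ^ 2) ^ 2 / m ^ 8) + 6 * (1 / m ^ 5)) / (1 / m ^ 4) := by gcongr
      _ = 192 * (l ^ 4 / m ^ 4) + 6 * (1 / m) := by field_simp; ring
  have h0 : 0 ≤ l ^ 6 / m := by positivity
  have h7 : 150 * l ^ 6 / m = 150 * (l ^ 6 / m) := by ring
  rw [h7]
  linarith

set_option maxHeartbeats 1600000 in
lemma Regular.eventually_badMix {p : (n : ℕ) → Fin n → Fin n → ℝ} (h : Regular p)
    {C e ε ε₀ κ a δ η ρ : ℝ} (hC1 : 1 ≤ C) (hC : ∀ n, avgEntropy n (p n) ≤ C)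
    (he0 : 0 < e) (he1 : e < 1) (he : ∀ᶠ n : ℕ in atTop,
      e ≤ avgEntropy n (p n) ∧ (∑ i, ∑ k, p n i k ^ 2) / n ≤ 1 - e)
    (hε : 0 < ε) (hε8 : ε ≤ 1 / 8) (hε₀ : 0 < ε₀) (hεC : ε₀ * C ≤ ε / 4) (hκ : 0 < κ)
    (hκe : 5 * ε ≤ κ * e) (haε : a ≤ ε / 2) (hδ : 0 < δ) (hη : 0 < η) (hρ : 0 < ρ) :
    ∀ᶠ n : ℕ in atTop, Pr n (fun σ => Spread (p n) (horizon n) ((n : ℝ) ^ a / n) σ ∧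
      η * n < (badMix (p n) ⌊(1 - 2 * ε) * Real.log n / avgEntropy n (p n)⌋₊
        (⌊ε₀ * Real.log n⌋₊ + 1) ⌈κ * Real.log n⌉₊ δ σ).card) ≤ ρ := by
  set ρ' : ℝ := ρ * (η * (δ / 2)) with hρ'
  have hρ'0 : 0 < ρ' := by positivity
  have hC2 : 1 ≤ 1 / e + ε₀ + κ + 4 := by
    have : 0 < 1 / e := by positivity
    linarith
  filter_upwards [he,
    h.eventually_lightMass_le (b := ε) (g := ε / 2) (ρ := ρ' / 4) (by positivity) hC2
      (by positivity),
    h.eventually_heavyMass_le (b := 3 * ε) (g := ε / 2) (ρ := ρ' / 4) (by positivity) hC2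
      (by positivity),
    eventually_horizon, eventually_le_horizon (1 / e + ε₀ + κ + 4), eventually_log_ge 1,
    eventually_log_ge (4 * C / ε),
    eventually_log_pow_le 20 6 (a := ε / 2) (b := δ ^ 2) (by positivity) (by positivity),
    eventually_log_pow_le 492 8 (a := ε) (b := ρ') hε hρ'0]
    with n ⟨hH0, hr⟩ hlight hheavy hn hs h1 hlC hl6 hl8
  have hH1 := hC n
  set l := Real.log n with hl
  set H := avgEntropy n (p n) with hH
  have hl0 : 0 < l := by linarith
  have hHpos : 0 < H := by linarith
  have hnN : 0 < n := lt_of_lt_of_le (by positivity) hn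
  have hn0 : (0 : ℝ) < n := by exact_mod_cast hnN
  have hn1 : (1 : ℝ) ≤ n := by exact_mod_cast hnN
  set s := ⌊(1 - 2 * ε) * l / H⌋₊ with hsdef
  set D := ⌊ε₀ * l⌋₊ + 1 with hDdef
  set k := ⌈κ * l⌉₊ with hkdef
  have h2ε : 0 ≤ 1 - 2 * ε := by linarith
  have hsu : (s : ℝ) ≤ (1 - 2 * ε) * l / H := Nat.floor_le (by positivity)
  have hsl : (1 - 2 * ε) * l / H - 1 < s := Nat.sub_one_lt_floor _
  have hDu : (D : ℝ) ≤ ε₀ * l + 1 := by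
    rw [hDdef]; push_cast
    linarith [Nat.floor_le (show 0 ≤ ε₀ * l by positivity)]
  have hku : (k : ℝ) ≤ κ * l + 1 := (Nat.ceil_lt_add_one (by positivity)).le
  have hkl : κ * l ≤ k := Nat.le_ceil _
  have hse : (s : ℝ) ≤ 1 / e * l := by
    refine hsu.trans ?_
    rw [div_le_iff₀ hHpos]
    calc (1 - 2 * ε) * l ≤ 1 / e * l * e := by
          have : 1 / e * l * e = l := by field_simp
          rw [this]; nlinarith
      _ ≤ 1 / e * l * H := by gcongr
  have hsum : ((s + D + (1 + k) : ℕ) : ℝ) ≤ (1 / e + ε₀ + κ + 4) * l := by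
    push_cast; nlinarith
  have hsumT := hs _ hsum
  set T := horizon n with hTdef
  have hT := horizon_le n
  rw [← hTdef, ← hl] at hT
  have hT0 : (0 : ℝ) ≤ T := by positivity
  have hsDT : (s : ℝ) + D ≤ l ^ 2 := by
    have : s + D ≤ T := by omega
    have : (s : ℝ) + D ≤ T := by exact_mod_cast this
    linarith
  have hl21 : 1 ≤ l ^ 2 := one_le_pow₀ h1
  have hTT : (T : ℝ) + T + 2 ≤ 4 * l ^ 2 := by linarith
  set m := (n : ℝ) ^ ε with hm
  have hm0 : 0 < m := by positivity
  have hm1 : 1 ≤ m := Real.one_le_rpow hn1 hε.le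
  have hm8 : m ^ 8 ≤ n := by
    rw [hm, ← Real.rpow_natCast, ← Real.rpow_mul hn0.le]
    calc (n : ℝ) ^ (ε * (8 : ℕ)) ≤ (n : ℝ) ^ (1 : ℝ) :=
          Real.rpow_le_rpow_of_exponent_le hn1 (by push_cast; linarith)
      _ = n := Real.rpow_one _
  have hm3 : (n : ℝ) ^ (3 * ε) = m ^ 3 := by
    rw [hm, ← Real.rpow_natCast, ← Real.rpow_mul hn0.le]; push_cast; ring_nf
  have hεl : C ≤ ε / 4 * l := by
    rw [div_le_iff₀ hε] at hlC; linarith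
  have hsH : (s : ℝ) * H ≤ (1 - 2 * ε) * l := by rwa [le_div_iff₀ hHpos] at hsu
  have hDH : (D : ℝ) * H ≤ ε / 2 * l := by
    calc (D : ℝ) * H ≤ (ε₀ * l + 1) * C := by gcongr
      _ = ε₀ * C * l + C := by ring
      _ ≤ ε / 4 * l + ε / 4 * l := by gcongr
      _ = ε / 2 * l := by ring
  have hL := hlight (s + D)
    (le_trans (by push_cast; linarith [Nat.cast_nonneg (α := ℝ) k]) hsum)
    (by push_cast; linarith)
  have hHe := hheavy s
    (le_trans (by push_cast; linarith [Nat.cast_nonneg (α := ℝ) k, Nat.cast_nonneg (α := ℝ) D])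
      hsum)
    (by
      have : ((1 - 2 * ε) * l / H - 1) * H ≤ s * H := by gcongr
      have h5 : ((1 - 2 * ε) * l / H - 1) * H = (1 - 2 * ε) * l - H := by field_simp
      rw [h5] at this
      linarith)
  rw [hm3] at hHe
  have hR : ∀ d ≤ D, ∀ y, Ex (fun σ => revisitMass (p n) (m / n) (s + d) σ y) ≤
      96 * l ^ 6 / m := by
    intro d hd y
    have hsd : s + d ≤ T := by omega
    refine (revisit_bound (h.nonneg n) (fun i => (h.row n i).le) (T := s + d)
      (le_trans (by gcongr; omega) hn) (by positivity) y).trans ?_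
    have hsd' : ((s + d : ℕ) : ℝ) ≤ T := by exact_mod_cast hsd
    calc ((s + d : ℕ) : ℝ) * (6 * ((((s + d : ℕ) : ℝ) + (s + d : ℕ) + 2) ^ 2 / n)) / (m / n) ≤
          l ^ 2 * (6 * ((4 * l ^ 2) ^ 2 / n)) / (m / n) := by
          gcongr
          · linarith
          · linarith
      _ = 96 * l ^ 6 / m := by field_simp; ring
  have hrk : (1 - e) ^ k ≤ 1 / m ^ 5 := by
    calc (1 - e) ^ k ≤ Real.exp (-e) ^ k :=
          pow_le_pow_left₀ (by linarith) (by linarith [Real.add_one_le_exp (-e)]) _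
      _ = Real.exp (-(e * k)) := by rw [← Real.exp_nat_mul]; ring_nf
      _ ≤ Real.exp (-(5 * ε * l)) := by
          refine Real.exp_le_exp.2 (neg_le_neg ?_)
          calc 5 * ε * l ≤ κ * e * l := by gcongr
            _ = e * (κ * l) := by ring
            _ ≤ e * k := by gcongr
      _ = 1 / m ^ 5 := by
          rw [hm, Real.rpow_def_of_pos hn0, ← Real.exp_nat_mul, ← hl, one_div, ← Real.exp_neg]
          push_cast; ring_nf
  have hl46 : l ^ 4 ≤ l ^ 6 := pow_le_pow_right₀ h1 (by norm_num)
  have hl41 : 1 ≤ l ^ 6 := one_le_pow₀ h1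
  have hF : ∀ d ≤ D, ∀ y, Ex (fun σ => flow (p n) (s + d) k (m / n) (m ^ 3 / n) σ y) ≤
      150 * l ^ 6 / m := by
    intro d hd y
    refine (flow_le (h.nonneg n) (h.row n) (T := T) (a := 1 / m ^ 4) (by omega) (by omega)
      (le_trans (by gcongr; omega) hn) (by positivity) (by positivity) hr y).trans ?_
    exact flow_arith hT0 h1 hm1 hn0 hm8 hTT hrk
  refine (Pr_badMix_le (h.nonneg n) (h.row n) hnN (T := T) (θ := m / n) (θ' := m ^ 3 / n)
    (q := (n : ℝ) ^ a / n) (by positivity) hδ hη (by omega) ?_ hL hHe hR hF).trans ?_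
  · refine mul_sqrt_le hT0 (by positivity) ?_
    have hma : (n : ℝ) ^ a * (n : ℝ) ^ (ε / 2) ≤ m := by
      rw [← Real.rpow_add hn0]
      exact Real.rpow_le_rpow_of_exponent_le hn1 (by linarith)
    have hd : 2 * ((s : ℝ) + D) + 1 ≤ 5 * l ^ 2 := by linarith
    calc (T : ℝ) ^ 2 * ((2 * ((s : ℝ) + D) + 1) / (m / n) * ((n : ℝ) ^ a / n))
        ≤ (l ^ 2) ^ 2 * (5 * l ^ 2 / (m / n) * ((n : ℝ) ^ a / n)) := by gcongr
      _ = 5 * l ^ 6 * (n : ℝ) ^ a / m := by field_simp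
      _ ≤ (δ ^ 2 * (n : ℝ) ^ (ε / 2) / 4) * (n : ℝ) ^ a / m := by gcongr; linarith
      _ = δ ^ 2 / 4 * ((n : ℝ) ^ a * (n : ℝ) ^ (ε / 2)) / m := by ring
      _ ≤ δ ^ 2 / 4 * m / m := by gcongr
      _ = (δ / 2) ^ 2 := by field_simp; norm_num
  · rw [div_le_iff₀ (by positivity), ← hρ']
    have hD2 : (D : ℝ) + 1 ≤ l ^ 2 := by
      have : D + 1 ≤ T := by omega
      have : (D : ℝ) + 1 ≤ T := by exact_mod_cast this
      linarith
    have e3 : ((D : ℝ) + 1) * (96 * l ^ 6 / m + 150 * l ^ 6 / m) ≤ ρ' / 2 := by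
      calc ((D : ℝ) + 1) * (96 * l ^ 6 / m + 150 * l ^ 6 / m) ≤
            l ^ 2 * (96 * l ^ 6 / m + 150 * l ^ 6 / m) := by gcongr
        _ = 492 * l ^ 8 / m / 2 := by ring
        _ ≤ ρ' * m / m / 2 := by gcongr
        _ = ρ' / 2 := by field_simp
    linarith

lemma eventually_horizon_mul_sqrt_le {a β : ℝ} (ha : a ≤ 1 / 16) (hβ : 0 < β) :
    ∀ᶠ n : ℕ in atTop,
      (horizon n : ℝ) * Real.sqrt ((n : ℝ) ^ (1 / 2 : ℝ) * ((n : ℝ) ^ a / n)) ≤ β := by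
  filter_upwards [eventually_gt_atTop 0,
    eventually_log_pow_le 1 4 (a := 1 / 4) (b := β ^ 2) (by norm_num) (by positivity)]
    with n hn hl
  have hn0 : (0 : ℝ) < n := by exact_mod_cast hn
  have hn1 : (1 : ℝ) ≤ n := by exact_mod_cast hn
  refine mul_sqrt_le (by positivity) hβ.le ?_
  have hT := horizon_le n
  calc (horizon n : ℝ) ^ 2 * ((n : ℝ) ^ (1 / 2 : ℝ) * ((n : ℝ) ^ a / n))
      ≤ (Real.log n ^ 2) ^ 2 * ((n : ℝ) ^ (1 / 2 : ℝ) * ((n : ℝ) ^ a / n)) := by gcongr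
    _ = 1 * Real.log n ^ 4 * ((n : ℝ) ^ (1 / 2 : ℝ) * ((n : ℝ) ^ a / n)) := by ring
    _ ≤ β ^ 2 * (n : ℝ) ^ (1 / 4 : ℝ) * ((n : ℝ) ^ (1 / 2 : ℝ) * ((n : ℝ) ^ a / n)) := by gcongr
    _ = β ^ 2 * ((n : ℝ) ^ (1 / 4 + 1 / 2 + a) / n) := by
        rw [Real.rpow_add hn0, Real.rpow_add hn0]; ring
    _ ≤ β ^ 2 * ((n : ℝ) ^ (1 : ℝ) / n) := by gcongr; linarith
    _ = β ^ 2 := by rw [Real.rpow_one, div_self hn0.ne', mul_one]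

lemma Regular.eventually_mix {p : (n : ℕ) → Fin n → Fin n → ℝ} (h : Regular p)
    {δ ρ κ₀ a₀ : ℝ} (hδ : 0 < δ) (hδ1 : δ ≤ 1) (hρ : 0 < ρ) (hκ₀ : 0 < κ₀) (ha₀ : 0 < a₀) :
    ∀ᶠ n : ℕ in atTop, ∃ t k : ℕ,
      (t : ℝ) ≤ Real.log n / avgEntropy n (p n) + κ₀ * Real.log n ∧
      Pr n (fun σ => ¬ ((∀ x, 1 - δ ≤ ov (p n) σ t k x) ∧
        ∑ j, unif (p n) σ k j ^ 2 ≤ (n : ℝ) ^ a₀ / n)) ≤ ρ := by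
  obtain ⟨C, hC1, hC⟩ := h.bdd
  obtain ⟨e, he0, he1, he⟩ := h.entropy
  obtain ⟨κ, hκ, hκκ⟩ : ∃ κ, 0 < κ ∧ κ = κ₀ / 4 := ⟨_, by positivity, rfl⟩
  obtain ⟨ε, hε, hε8, hεκ⟩ : ∃ ε, 0 < ε ∧ ε ≤ 1 / 8 ∧ 5 * ε ≤ κ * e :=
    ⟨min (1 / 8) (κ * e / 5), by positivity, min_le_left _ _, by
      linarith [min_le_right (1 / 8) (κ * e / 5)]⟩
  obtain ⟨ε₀, hε₀, hε₀κ, hε₀C⟩ : ∃ ε₀, 0 < ε₀ ∧ ε₀ ≤ κ₀ / 4 ∧ ε₀ * C ≤ ε / 4 :=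
    ⟨min (κ₀ / 4) (ε / (4 * C)), by positivity, min_le_left _ _, by
      have := min_le_right (κ₀ / 4) (ε / (4 * C))
      calc _ ≤ ε / (4 * C) * C := by gcongr
        _ = ε / 4 := by field_simp⟩
  obtain ⟨a, ha, haa, haε⟩ : ∃ a, 0 < a ∧ a ≤ a₀ ∧ a ≤ ε / 2 :=
    ⟨min a₀ (ε / 2), by positivity, min_le_left _ _, min_le_right _ _⟩
  filter_upwards [he,
    h.eventually_badMix (δ := δ / 6) (η := δ / 6 / 4 / 2) (ρ := ρ / 4) hC1 hC he0 he1 he hε hε8 hε₀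
      hε₀C hκ hεκ haε (by positivity) (by positivity) (by positivity),
    h.eventually_spread (ρ := ρ / 4) ha (by positivity),
    h.eventually_reaches (ε := ε₀) (c := 1 / 4) (δ := δ / 6) (ρ := ρ / 4) hε₀ (by norm_num) le_rfl
      (by positivity) (by linarith) (by positivity),
    eventually_horizon_mul_sqrt_le (a := a) (β := δ / 6 * (δ / 6 / 4) / 4) (by linarith)
      (by positivity),
    eventually_le_horizon (1 / e + ε₀ + κ + 4), eventually_log_ge 1,
    eventually_log_ge (6 / κ₀), eventually_gt_atTop 0]
    with n ⟨hH0, _⟩ hbad hspread hreach hK hs h1 h6 hn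
  set l := Real.log n with hl
  set H := avgEntropy n (p n) with hH
  have hl0 : 0 < l := by linarith
  have hHpos : 0 < H := by linarith
  have hn1 : (1 : ℝ) ≤ n := by exact_mod_cast hn
  have hn0 : (0 : ℝ) < n := by linarith
  set s := ⌊(1 - 2 * ε) * l / H⌋₊ with hsdef
  set D := ⌊ε₀ * l⌋₊ + 1 with hDdef
  set k := ⌈κ * l⌉₊ with hkdef
  have h2ε : 0 ≤ 1 - 2 * ε := by linarith
  have hsu : (s : ℝ) ≤ l / H := by
    refine (Nat.floor_le (by positivity)).trans ?_
    gcongr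
    nlinarith
  have hDu : (D : ℝ) ≤ ε₀ * l + 1 := by
    rw [hDdef]; push_cast
    linarith [Nat.floor_le (show 0 ≤ ε₀ * l by positivity)]
  have hku : (k : ℝ) ≤ κ * l + 1 := (Nat.ceil_lt_add_one (by positivity)).le
  have hse : l / H ≤ 1 / e * l := by
    rw [div_mul_eq_mul_div, one_mul]
    gcongr
  have hsum : s + D + (1 + k) ≤ horizon n := hs _ (by push_cast; nlinarith)
  refine ⟨s + D + (1 + k), k, ?_, ?_⟩
  · rw [div_le_iff₀ hκ₀] at h6
    have h7 : ε₀ * l ≤ κ₀ / 4 * l := by gcongr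
    push_cast
    rw [hκκ] at hku
    linarith
  · have hR := hreach (fun W σ => badMix (kill W (p n)) s D k (2 * (δ / 6)) σ)
      (fun W σ σ' hσ => badMix_kill_congr hσ _ _ _ _ _)
    calc _ ≤ ρ / 4 + (ρ / 4 + ρ / 4) :=
          (Pr_mono ?_).trans ((Pr_or_le _ _).trans
            (add_le_add hspread ((Pr_or_le _ _).trans (add_le_add hbad hR))))
      _ ≤ ρ := by linarith
    intro σ hσ
    by_contra hcon
    push Not at hcon
    obtain ⟨hsp, hb, hr⟩ := hcon
    have hb' := hb hsp
    refine hσ ⟨fun x => ?_, (hsp k (by omega)).trans (by gcongr)⟩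
    obtain ⟨W, hW, hWr⟩ := hr (fun W hW => card_badMix_kill_le (h.nonneg n) (h.row n) hn hsp
      (by positivity) (by linarith) hsum hK hb' hW) x
    have := ov_ge_of_reaches (h.nonneg n) (h.row n) (by positivity) hWr
    linarith

lemma Regular.eventually_heavy_start {p : (n : ℕ) → Fin n → Fin n → ℝ} (h : Regular p)
    {ε ν δ ρ : ℝ} (hε : 0 < ε) (hε8 : ε ≤ 1 / 2) (hν : 0 < ν) (hδ : 0 < δ) (hδ1 : δ ≤ 1)
    (hρ : 0 < ρ) :
    ∀ᶠ n : ℕ in atTop, ∀ t : ℕ, t * avgEntropy n (p n) ≤ (1 - 2 * ε) * Real.log n →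
      ν * Real.log n ≤ t →
      Pr n (fun σ => ¬ ∀ x, 1 - δ ≤ heavyMass (p n) ((n : ℝ) ^ (ε / 2) / n) t σ x) ≤ ρ := by
  obtain ⟨e, he0, he1, he⟩ := h.entropy
  filter_upwards [he,
    h.eventually_lightMass_le (b := ε) (g := ε) (C := 1 / e)
      (ρ := ρ / 4 * (δ / 6 / 4 / 2 * (δ / 6))) hε (by rw [le_div_iff₀ he0]; linarith)
      (by positivity),
    h.eventually_spread (a := 1 / 16) (ρ := ρ / 4) (by norm_num) (by positivity),
    h.eventually_reaches (ε := ν / 2) (c := ε / 3) (δ := δ / 6) (ρ := ρ / 4) (by positivity)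
      (by positivity) (by linarith) (by positivity) (by linarith) (by positivity),
    eventually_horizon_mul_sqrt_le (a := 1 / 16) (β := δ / 6 * (δ / 6 / 4) / 4) le_rfl
      (by positivity),
    eventually_le_horizon (1 / e), eventually_log_ge 1,
    eventually_log_ge (2 / ν), eventually_gt_atTop 0]
    with n ⟨hH0, _⟩ hlight hspread hreach hK hs h1 h2 hn t ht htν
  set l := Real.log n with hl
  set H := avgEntropy n (p n) with hH
  have hl0 : 0 < l := by linarith
  have hn1 : (1 : ℝ) ≤ n := by exact_mod_cast hn
  have hn0 : (0 : ℝ) < n := by linarith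
  have hte : (t : ℝ) ≤ 1 / e * l := by
    rw [div_mul_eq_mul_div, one_mul, le_div_iff₀ he0]
    calc (t : ℝ) * e ≤ t * H := by gcongr
      _ ≤ (1 - 2 * ε) * l := ht
      _ ≤ l := by nlinarith
  have htT := hs t hte
  have hD : ⌊ν / 2 * l⌋₊ + 1 ≤ t := by
    have : ((⌊ν / 2 * l⌋₊ + 1 : ℕ) : ℝ) ≤ t := by
      push_cast
      rw [div_le_iff₀ hν] at h2
      linarith [Nat.floor_le (show 0 ≤ ν / 2 * l by positivity)]
    exact_mod_cast this
  have hw : (n : ℝ) ^ (-(ε / 3)) * (n : ℝ) ^ (-(ε / 3 / 2)) * ((n : ℝ) ^ ε / n) =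
      (n : ℝ) ^ (ε / 2) / n := by
    rw [← Real.rpow_add hn0, ← mul_div_assoc, ← Real.rpow_add hn0]
    congr 2; ring
  have hR := hreach (fun W σ => badLight (kill W (p n)) ((n : ℝ) ^ ε / n) t (2 * (δ / 6)) σ)
    (fun W σ σ' hσ => badLight_kill_congr hσ _ _ _ _)
  have hbad : Pr n (fun σ => δ / 6 / 4 / 2 * n <
      ((badLight (p n) ((n : ℝ) ^ ε / n) t (δ / 6) σ).card : ℝ)) ≤ ρ / 4 := by
    refine (Pr_badLight_le (h.nonneg n) (h.row n) hn (by positivity) (by positivity)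
      (hlight t hte (by linarith))).trans_eq ?_
    field_simp
  calc _ ≤ ρ / 4 + (ρ / 4 + ρ / 4) :=
        (Pr_mono ?_).trans ((Pr_or_le _ _).trans
          (add_le_add hspread ((Pr_or_le _ _).trans (add_le_add hbad hR))))
    _ ≤ ρ := by linarith
  intro σ hσ
  by_contra hcon
  push Not at hcon
  obtain ⟨hsp, hb, hr⟩ := hcon
  refine hσ fun x => ?_
  obtain ⟨W, hW, hWr⟩ := hr (fun W hW => card_badLight_kill_le (h.nonneg n) (h.row n) hn
    (by positivity) hsp (by positivity) htT hK hb hW) x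
  have := heavyMass_ge_of_reaches (h.nonneg n) (h.row n) hD (by positivity) (by positivity) hWr
  rw [hw] at this
  linarith

lemma tendsto_Pr_one {E : (n : ℕ) → Env n → Prop}
    (h : ∀ ρ : ℝ, 0 < ρ → ∀ᶠ n : ℕ in atTop, Pr n (fun σ => ¬ E n σ) ≤ ρ) :
    Tendsto (fun n => Pr n (E n)) atTop (nhds 1) := by
  rw [Metric.tendsto_atTop']
  intro ρ hρ
  obtain ⟨N, hN⟩ := eventually_atTop.1 (h (ρ / 2) (by positivity))
  refine ⟨N, fun n hn => ?_⟩
  have h1 := hN n hn.le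
  rw [Pr_not] at h1
  rw [Real.dist_eq, abs_lt]
  constructor <;> linarith [Pr_le_one (E n)]

lemma Regular.tendsto_stationary {p : (n : ℕ) → Fin n → Fin n → ℝ} (h : Regular p) :
    Tendsto (fun n : ℕ => Pr n (fun σ => ∃! π : Fin n → ℝ, StatDist n (Pmat n (p n) σ) π))
      atTop (nhds 1) := by
  refine tendsto_Pr_one fun ρ hρ => ?_
  filter_upwards [h.eventually_mix (δ := 1 / 4) (κ₀ := 1) (a₀ := 1) (by norm_num) (by norm_num) hρ
    (by norm_num) (by norm_num), eventually_gt_atTop 0] with n ⟨t, k, _, hmix⟩ hn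
  refine (Pr_mono fun σ hσ => ?_).trans hmix
  contrapose! hσ
  obtain ⟨π, h1, h2, -⟩ := stationary_of_ov (h.nonneg n) (h.row n) hn (by norm_num) hσ.1
  exact ⟨π, h1, h2⟩

lemma Regular.tendsto_tv_gt {p : (n : ℕ) → Fin n → Fin n → ℝ} (h : Regular p) {lam δ : ℝ}
    (hlam : 0 < lam) (hlam1 : lam < 1) (hδ : 0 < δ) (hδ1 : δ < 1) {t : ℕ → ℕ}
    (ht : Tendsto (fun n : ℕ => (t n : ℝ) * avgEntropy n (p n) / Real.log n) atTop (nhds lam)) :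
    Tendsto (fun n : ℕ => Pr n (fun σ =>
        ∃ π : Fin n → ℝ, StatDist n (Pmat n (p n) σ) π ∧
          (∀ π' : Fin n → ℝ, StatDist n (Pmat n (p n) σ) π' → π' = π) ∧
          ∀ i : Fin n, 1 - δ < tv n (fun j => matPow n (Pmat n (p n) σ) (t n) i j) π))
      atTop (nhds 1) := by
  refine tendsto_Pr_one fun ρ hρ => ?_
  obtain ⟨C, hC1, hC⟩ := h.bdd
  set ε : ℝ := (1 - lam) / 4 with hε
  have hε0 : 0 < ε := by linarith
  filter_upwards [h.eventually_mix (δ := δ / 6) (κ₀ := 1) (a₀ := ε / 4) (ρ := ρ / 2)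
      (by positivity) (by linarith) (by positivity) (by norm_num) (by positivity),
    h.eventually_heavy_start (ε := ε) (ν := lam / (2 * C)) (δ := δ / 6) (ρ := ρ / 2) hε0
      (by linarith) (by positivity) (by positivity) (by linarith) (by positivity),
    ht.eventually_lt_const (show lam < (1 + lam) / 2 by linarith),
    ht.eventually_const_lt (show lam / 2 < lam by linarith),
    eventually_log_pow_le 1 0 (a := ε / 4) (b := (δ / 4) ^ 2) (by positivity) (by positivity),
    eventually_log_ge 1, eventually_gt_atTop 0]
    with n ⟨u, k, _, hmix⟩ hheavy htu htl hsmall h1 hn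
  have hl0 : 0 < Real.log n := by linarith
  have hn0 : (0 : ℝ) < n := by exact_mod_cast hn
  rw [div_lt_iff₀ hl0] at htu
  rw [lt_div_iff₀ hl0] at htl
  have hst := hheavy (t n) (by rw [hε]; linarith) (by
    rw [div_mul_eq_mul_div, div_le_iff₀ (by positivity)]
    have : (t n : ℝ) * avgEntropy n (p n) ≤ t n * C := by gcongr; exact hC n
    linarith)
  have hsqrt : Real.sqrt (1 / ((n : ℝ) ^ (ε / 2) / n) * ((n : ℝ) ^ (ε / 4) / n)) ≤ δ / 4 := by
    rw [Real.sqrt_le_left (by positivity)]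
    have hsplit : (n : ℝ) ^ (ε / 2) = (n : ℝ) ^ (ε / 4) * (n : ℝ) ^ (ε / 4) := by
      rw [← Real.rpow_add hn0]; ring_nf
    calc 1 / ((n : ℝ) ^ (ε / 2) / n) * ((n : ℝ) ^ (ε / 4) / n) = 1 / (n : ℝ) ^ (ε / 4) := by
          rw [hsplit]; field_simp
      _ ≤ (δ / 4) ^ 2 := by
          rw [div_le_iff₀ (by positivity)]; simpa using hsmall
  calc _ ≤ ρ / 2 + ρ / 2 := (Pr_mono ?_).trans ((Pr_or_le _ _).trans (add_le_add hmix hst))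
    _ = ρ := by ring
  intro σ hσ
  contrapose! hσ
  obtain ⟨⟨hov, hunif⟩, hhv⟩ := hσ
  obtain ⟨π, hπ, huniq, hclose, -⟩ := stationary_of_ov (h.nonneg n) (h.row n) hn (by linarith) hov
  refine ⟨π, hπ, huniq, fun x => ?_⟩
  have := tv_ge_of_heavy (h.nonneg n) (h.row n) (by positivity) (hhv x) hunif hπ.2.1 hclose
  linarith

lemma Regular.tendsto_tv_lt {p : (n : ℕ) → Fin n → Fin n → ℝ} (h : Regular p) {lam δ : ℝ}
    (hlam1 : 1 < lam) (hδ : 0 < δ) (hδ1 : δ < 1) {t : ℕ → ℕ}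
    (ht : Tendsto (fun n : ℕ => (t n : ℝ) * avgEntropy n (p n) / Real.log n) atTop (nhds lam)) :
    Tendsto (fun n : ℕ => Pr n (fun σ =>
        ∃ π : Fin n → ℝ, StatDist n (Pmat n (p n) σ) π ∧
          (∀ π' : Fin n → ℝ, StatDist n (Pmat n (p n) σ) π' → π' = π) ∧
          ∀ i : Fin n, tv n (fun j => matPow n (Pmat n (p n) σ) (t n) i j) π < δ))
      atTop (nhds 1) := by
  refine tendsto_Pr_one fun ρ hρ => ?_
  obtain ⟨C, hC1, hC⟩ := h.bdd
  obtain ⟨e, he0, -, he⟩ := h.entropy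
  have hμ : 0 < (lam - 1) / 2 := by linarith
  filter_upwards [h.eventually_mix (δ := δ / 3) (κ₀ := (lam - 1) / 2 / C) (a₀ := 1)
      (by positivity) (by linarith) hρ (by positivity) (by norm_num), he,
    ht.eventually_const_lt (show 1 + (lam - 1) / 2 < lam by linarith),
    eventually_log_ge 1, eventually_gt_atTop 0]
    with n ⟨u, k, hu, hmix⟩ ⟨hH0, _⟩ htl h1 hn
  have hl0 : 0 < Real.log n := by linarith
  have hH : 0 < avgEntropy n (p n) := by linarith
  rw [lt_div_iff₀ hl0] at htl
  have hut : u ≤ t n := by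
    have : (u : ℝ) ≤ t n := by
      refine hu.trans ?_
      calc Real.log n / avgEntropy n (p n) + (lam - 1) / 2 / C * Real.log n ≤
            Real.log n / avgEntropy n (p n) + (lam - 1) / 2 / avgEntropy n (p n) * Real.log n := by
            gcongr; exact hC n
        _ = (1 + (lam - 1) / 2) * Real.log n / avgEntropy n (p n) := by ring
        _ ≤ t n := by rw [div_le_iff₀ hH]; exact htl.le
    exact_mod_cast this
  refine (Pr_mono fun σ hσ => ?_).trans hmix
  contrapose! hσ
  obtain ⟨π, hπ, huniq, -, htv⟩ := stationary_of_ov (h.nonneg n) (h.row n) hn (by linarith) hσ.1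
  refine ⟨π, hπ, huniq, fun x => ?_⟩
  linarith [htv (t n) hut x]

end Cutoff

theorem stmt0
    (p : (n : ℕ) → Fin n → Fin n → ℝ)
    (hnonneg : ∀ n (i j : Fin n), 0 ≤ p n i j)
    (hrow : ∀ n (i : Fin n), ∑ j : Fin n, p n i j = 1)
    -- sparsity: `H_n = O(1)` ...
    (hHbdd : ∃ C : ℝ, ∀ n : ℕ, avgEntropy n (p n) ≤ C)
    -- ... and `max_i ∑_j p_{i,j} (log p_{i,j})² = o(log n)`
    (hsparse : ∀ ε : ℝ, 0 < ε → ∀ᶠ n : ℕ in atTop, ∀ i : Fin n,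
        ∑ j : Fin n, p n i j * (Real.log (p n i j)) ^ 2 ≤ ε * Real.log n)
    -- non-degeneracy
    (hnondeg : Tendsto (fun ε : ℝ =>
        Filter.limsup (fun n : ℕ =>
          (1 / (n : ℝ)) * ∑ i : Fin n, ∑ j : Fin n,
            if 1 - ε < p n i j then (1 : ℝ) else 0) atTop)
        (nhdsWithin 0 (Set.Ioi 0)) (nhds 0)) :
    -- (a) with high probability there is a unique stationary distribution
    Tendsto (fun n : ℕ =>
        Pr n (fun σ => ∃! π : Fin n → ℝ, StatDist n (Pmat n (p n) σ) π))
      atTop (nhds 1)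
    ∧
    -- (b) cutoff at the entropic time `t_ENT = log n / H_n`
    ∀ lam : ℝ, 0 < lam → ∀ δ : ℝ, δ ∈ Set.Ioo (0 : ℝ) 1 → ∀ t : ℕ → ℕ,
      Tendsto (fun n : ℕ => (t n : ℝ) * avgEntropy n (p n) / Real.log n) atTop (nhds lam) →
      (lam < 1 →
        Tendsto (fun n : ℕ => Pr n (fun σ =>
            ∃ π : Fin n → ℝ, StatDist n (Pmat n (p n) σ) π ∧
              (∀ π' : Fin n → ℝ, StatDist n (Pmat n (p n) σ) π' → π' = π) ∧
              ∀ i : Fin n, 1 - δ < tv n (fun j => matPow n (Pmat n (p n) σ) (t n) i j) π))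
          atTop (nhds 1))
      ∧
      (1 < lam →
        Tendsto (fun n : ℕ => Pr n (fun σ =>
            ∃ π : Fin n → ℝ, StatDist n (Pmat n (p n) σ) π ∧
              (∀ π' : Fin n → ℝ, StatDist n (Pmat n (p n) σ) π' → π' = π) ∧
              ∀ i : Fin n, tv n (fun j => matPow n (Pmat n (p n) σ) (t n) i j) π < δ))
          atTop (nhds 1)) := by
  have hreg : Cutoff.Regular p := by
    obtain ⟨C, hC⟩ := hHbdd
    exact ⟨hnonneg, hrow, ⟨max C 1, le_max_right _ _, fun n => (hC n).trans (le_max_left _ _)⟩,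
      hsparse, fun β hβ => Cutoff.exists_gk_le_of_tendsto hnonneg hrow hnondeg hβ⟩
  exact ⟨hreg.tendsto_stationary, fun lam hlam δ hδ t ht =>
    ⟨fun h1 => hreg.tendsto_tv_gt hlam h1 hδ.1 hδ.2 ht,
      fun h1 => hreg.tendsto_tv_lt h1 hδ.1 hδ.2 ht⟩⟩
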